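/- arXiv:2405.17819 — 2 statements merged into one kernel-verified Lean document; each statement's English description precedes it below -/
import Mathlib

section
/- Let G be a (P2+P3, gem)-free graph. If G contains an induced F1, then either G belongs to the class 𝒞 or χ(G) ≤ ω(G) + 1. -/
open SimpleGraph

/-- The graph `P2 + P3` (disjoint union of a path on 2 and a path on 3 vertices). -/
def graphP2P3 : SimpleGraph (Fin 5) :=
  SimpleGraph.fromRel (fun x y => (x, y) ∈ ([(0,1),(2,3),(3,4)] : List (Fin 5 × Fin 5)))

/-- The gem: a path `P4` (0-1-2-3) plus a vertex 4 adjacent to all of it. -/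
def graphGem : SimpleGraph (Fin 5) :=
  SimpleGraph.fromRel (fun x y =>
    (x, y) ∈ ([(0,1),(1,2),(2,3),(4,0),(4,1),(4,2),(4,3)] : List (Fin 5 × Fin 5)))

/-- The path on three vertices. -/
def graphP3 : SimpleGraph (Fin 3) :=
  SimpleGraph.fromRel (fun x y => (x, y) ∈ ([(0,1),(1,2)] : List (Fin 3 × Fin 3)))

/-- The cycle on five vertices. -/
def graphC5 : SimpleGraph (Fin 5) :=
  SimpleGraph.fromRel (fun x y => y = x + 1)

/-- `F1`: a 5-cycle `v1 v2 v3 v4 v5` (vertices 0..4) plus a vertex 5 adjacent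
exactly to `v5, v1, v2` (i.e. 4, 0, 1). -/
def graphF1 : SimpleGraph (Fin 6) :=
  SimpleGraph.fromRel (fun x y =>
    (x, y) ∈ ([(0,1),(1,2),(2,3),(3,4),(4,0),(5,4),(5,0),(5,1)] : List (Fin 6 × Fin 6)))

/-- `F1'`: a 5-cycle (0..4) plus adjacent vertices 5, 6, where 5 is adjacent to 4,0,1
and 6 is adjacent to 0,1,2. -/
def graphF1' : SimpleGraph (Fin 7) :=
  SimpleGraph.fromRel (fun x y =>
    (x, y) ∈ ([(0,1),(1,2),(2,3),(3,4),(4,0),(5,4),(5,0),(5,1),(6,0),(6,1),(6,2),(5,6)] :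
      List (Fin 7 × Fin 7)))

/-- `F1''`: a 5-cycle (0..4) plus nonadjacent vertices 5, 6, where 5 is adjacent to 4,0,1
and 6 is adjacent to 1,2,3. -/
def graphF1'' : SimpleGraph (Fin 7) :=
  SimpleGraph.fromRel (fun x y =>
    (x, y) ∈ ([(0,1),(1,2),(2,3),(3,4),(4,0),(5,4),(5,0),(5,1),(6,1),(6,2),(6,3)] :
      List (Fin 7 × Fin 7)))

/-- `F2`: a 5-cycle (0..4) plus adjacent vertices 5, 6, each adjacent to `v1,v3,v4`
(i.e. 0, 2, 3). -/
def graphF2 : SimpleGraph (Fin 7) :=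
  SimpleGraph.fromRel (fun x y =>
    (x, y) ∈ ([(0,1),(1,2),(2,3),(3,4),(4,0),(5,6),(5,0),(5,2),(5,3),(6,0),(6,2),(6,3)] :
      List (Fin 7 × Fin 7)))

/-- `F3`: a 5-cycle (0..4) plus adjacent vertices 5 (adjacent to 0,2,3) and
6 (adjacent to 2,3). -/
def graphF3 : SimpleGraph (Fin 7) :=
  SimpleGraph.fromRel (fun x y =>
    (x, y) ∈ ([(0,1),(1,2),(2,3),(3,4),(4,0),(5,6),(5,0),(5,2),(5,3),(6,2),(6,3)] :
      List (Fin 7 × Fin 7)))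

/-- `G` contains no induced copy of `H`. -/
def IsFreeOf {W V : Type*} (G : SimpleGraph V) (H : SimpleGraph W) : Prop :=
  IsEmpty (H ↪g G)

/-- The disjoint union of a clique blowup `C5⟨K_{t 0},…,K_{t 4}⟩` of the 5-cycle and
`ℓ` isolated vertices. -/
def blowupC5 (t : Fin 5 → ℕ) (ℓ : ℕ) :
    SimpleGraph ((Σ i : Fin 5, Fin (t i)) ⊕ Fin ℓ) :=
  SimpleGraph.fromRel (fun x y => ∃ a b, x = Sum.inl a ∧ y = Sum.inl b ∧
    (a.1 = b.1 ∨ b.1 = a.1 + 1))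

/-- Membership in the class `𝒞`: `G` is isomorphic to the disjoint union of a clique
blowup of `C5` and some number of isolated vertices. -/
def InClassC {V : Type*} (G : SimpleGraph V) : Prop :=
  ∃ (t : Fin 5 → ℕ) (ℓ : ℕ), (∀ i, 0 < t i) ∧ Nonempty (G ≃g blowupC5 t ℓ)

/-- The function φ from the paper. -/
noncomputable def phi (x : ℕ) : ℕ :=
  if x = 1 then 1 else if x = 2 then 4 else if x = 3 then 6
  else ⌈(5 * (x : ℚ) - 1) / 4⌉₊

section Stmt
variable {V : Type*} (G : SimpleGraph V)

/-- `S` is complete to `S'`. -/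
def CompleteTo (S S' : Set V) : Prop := ∀ x ∈ S, ∀ y ∈ S', G.Adj x y

/-- `S` is anticomplete to `S'`. -/
def AnticompleteTo (S S' : Set V) : Prop := ∀ x ∈ S, ∀ y ∈ S', ¬ G.Adj x y

/-- `S` is a stable (independent) set. -/
def IsStableSet (S : Set V) : Prop := S.Pairwise (fun x y => ¬ G.Adj x y)

/-- A graph is perfect if every induced subgraph has chromatic number equal to
its clique number. -/
def IsPerfect : Prop :=
  ∀ S : Set V, (G.induce S).chromaticNumber = ((G.induce S).cliqueNum : ℕ∞)

variable (v : Fin 5 → V)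

/-- `v` induces a `C5` in `G`: two cycle vertices are adjacent iff consecutive. -/
def IsInducedC5 : Prop :=
  Function.Injective v ∧ ∀ i j : Fin 5, G.Adj (v i) (v j) ↔ (j = i + 1 ∨ i = j + 1)

def setA (i : Fin 5) : Set V :=
  {u | u ∉ Set.range v ∧ ∀ j, G.Adj u (v j) ↔ j = i}

def setB (i : Fin 5) : Set V :=
  {u | u ∉ Set.range v ∧ ∀ j, G.Adj u (v j) ↔ (j = i ∨ j = i + 1)}

def setX (i : Fin 5) : Set V :=
  {u | u ∉ Set.range v ∧ ∀ j, G.Adj u (v j) ↔ (j = i - 1 ∨ j = i + 1)}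

def setY (i : Fin 5) : Set V :=
  {u | u ∉ Set.range v ∧ ∀ j, G.Adj u (v j) ↔ (j = i - 1 ∨ j = i ∨ j = i + 1)}

def setZ (i : Fin 5) : Set V :=
  {u | u ∉ Set.range v ∧ ∀ j, G.Adj u (v j) ↔ (j = i - 2 ∨ j = i ∨ j = i + 2)}

def setT : Set V :=
  {u | u ∉ Set.range v ∧ ∀ j, ¬ G.Adj u (v j)}

end Stmt


namespace F1Proof

/-! ### A decision procedure for small patterns -/

section Patterns

/-- Some number below `n` satisfies `p`. -/
def anyLT (n : ℕ) (p : ℕ → Bool) : Bool :=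
  Nat.rec false (fun k ih => bif p k then true else ih) n

theorem anyLT_iff (n : ℕ) (p : ℕ → Bool) : anyLT n p = true ↔ ∃ k < n, p k = true := by
  induction n with
  | zero => simp [anyLT]
  | succ n ih =>
    have : anyLT (n + 1) p = bif p n then true else anyLT n p := rfl
    rw [this]
    cases h : p n
    · simp only [cond_false, ih]
      constructor
      · rintro ⟨k, hk, hp⟩
        exact ⟨k, by omega, hp⟩
      · rintro ⟨k, hk, hp⟩
        refine ⟨k, ?_, hp⟩
        rcases Nat.lt_succ_iff_lt_or_eq.1 hk with h' | h'
        · exact h'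
        · subst h'; simp [h] at hp
    · simp only [cond_true, true_iff]
      exact ⟨n, by omega, h⟩

/-- The `i`-th binary digit of `m`. -/
def bit (m i : ℕ) : Bool := Nat.beq (Nat.land (Nat.shiftRight m i) 1) 1

theorem bit_eq_testBit (m i : ℕ) : bit m i = m.testBit i := by
  have h : bit m i = Nat.beq ((m >>> i) &&& 1) 1 := rfl
  rw [h, Nat.testBit, Nat.and_comm, Nat.one_and_eq_mod_two]
  rcases Nat.mod_two_eq_zero_or_one (m >>> i) with h | h <;> rw [h] <;> rfl

/-- The pattern `e` on `0, …, n - 1` contains an induced `P2 + P3`. -/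
def hasP2P3 (n : ℕ) (e : ℕ → ℕ → Bool) : Bool :=
  anyLT n fun d => anyLT n fun c => e c d && anyLT n fun x =>
    e d x && !(e c x) && !(Nat.beq c x) && anyLT n fun a =>
      !(e a c) && !(e a d) && !(e a x) && anyLT n fun b =>
        e a b && !(e b c) && !(e b d) && !(e b x)

/-- The pattern `e` on `0, …, n - 1` contains an induced gem. -/
def hasGem (n : ℕ) (e : ℕ → ℕ → Bool) : Bool :=
  anyLT n fun q => anyLT n fun r => e q r && anyLT n fun z =>
    e z q && e z r && anyLT n fun p =>
      e z p && e p q && !(e p r) && anyLT n fun s =>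
        e z s && e r s && !(e q s) && !(e p s)

/-- The graph on `0, …, 4` whose edges are listed by the ten binary digits of `c`. -/
def unpack (c i j : ℕ) : Bool :=
  bif Nat.blt i j then bit c (j * (j - 1) / 2 + i)
  else bif Nat.blt j i then bit c (i * (i - 1) / 2 + j) else false

/-- The set of codes of graphs on five vertices isomorphic to `P2 + P3` or to the gem. -/
def forbiddenCodes : ℕ :=
  16652921304081747649179820718241212055119049532362639246384562945279467411571532924497828372154261879609052130338582581536954301199632226992434045799090357068443006675571120922691301471366752511657804482296589243527531736871233680255927200542841434741809623499416736811043916494175002167158009434415824896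

set_option maxRecDepth 10000 in
theorem forbiddenCodes_spec : ∀ c < 1024, bit forbiddenCodes c = true →
    (hasP2P3 5 (unpack c) || hasGem 5 (unpack c)) = true := by
  decide +kernel

/-- The value of a Boolean as a number. -/
def val (b : Bool) : ℕ := bif b then 1 else 0

/-- The code of the graph induced by `e` on five vertices. -/
def code (b01 b02 b12 b03 b13 b23 b04 b14 b24 b34 : Bool) : ℕ :=
  Nat.add (val b01) (Nat.add (Nat.mul 2 (val b02)) (Nat.add (Nat.mul 4 (val b12))
  (Nat.add (Nat.mul 8 (val b03)) (Nat.add (Nat.mul 16 (val b13)) (Nat.add (Nat.mul 32 (val b23))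
  (Nat.add (Nat.mul 64 (val b04)) (Nat.add (Nat.mul 128 (val b14)) (Nat.add (Nat.mul 256 (val b24))
  (Nat.mul 512 (val b34))))))))))

theorem code_spec : ∀ b01 b02 b12 b03 b13 b23 b04 b14 b24 b34 : Bool,
    code b01 b02 b12 b03 b13 b23 b04 b14 b24 b34 < 1024 ∧
    ∀ i < 10, bit (code b01 b02 b12 b03 b13 b23 b04 b14 b24 b34) i =
      [b01, b02, b12, b03, b13, b23, b04, b14, b24, b34].getD i false := by
  decide +kernel

/-- Edge of the pattern whose adjacency matrix has the rows of length 16 packed in `B`. -/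
def edge (B i j : ℕ) : Bool := bit B (Nat.add (Nat.mul 16 i) j)

/-- A vertex with neighbourhood `m` cannot be added to the pattern `B`. -/
def badOne (n B m : ℕ) : Bool :=
  anyLT n fun l => anyLT l fun k => anyLT k fun j => anyLT j fun i =>
    bit forbiddenCodes (code (edge B i j) (edge B i k) (edge B j k) (edge B i l) (edge B j l)
      (edge B k l) (bit m i) (bit m j) (bit m k) (bit m l))

/-- Two vertices with neighbourhoods `m`, `m'` and adjacency `a` cannot be added
to the pattern `B`. -/
def badTwo (n B m m' : ℕ) (a : Bool) : Bool :=
  anyLT n fun k => anyLT k fun j => anyLT j fun i =>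
    bit forbiddenCodes (code (edge B i j) (edge B i k) (edge B j k) (bit m i) (bit m j)
      (bit m k) (bit m' i) (bit m' j) (bit m' k) a)

end Patterns

/-! ### Soundness -/

section Soundness

variable {V : Type*} {G : SimpleGraph V}

theorem no_P2P3 (h1 : IsFreeOf G graphP2P3) {a b c d x : V} (hab : G.Adj a b) (hcd : G.Adj c d)
    (hdx : G.Adj d x) (hcx : ¬ G.Adj c x) (hne : c ≠ x) (hac : ¬ G.Adj a c) (had : ¬ G.Adj a d)
    (hax : ¬ G.Adj a x) (hbc : ¬ G.Adj b c) (hbd : ¬ G.Adj b d) (hbx : ¬ G.Adj b x) : False := by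
  have hba := hab.symm
  have hdc := hcd.symm
  have hxd := hdx.symm
  have hxc : ¬ G.Adj x c := fun h => hcx h.symm
  have hca : ¬ G.Adj c a := fun h => hac h.symm
  have hda : ¬ G.Adj d a := fun h => had h.symm
  have hxa : ¬ G.Adj x a := fun h => hax h.symm
  have hcb : ¬ G.Adj c b := fun h => hbc h.symm
  have hdb : ¬ G.Adj d b := fun h => hbd h.symm
  have hxb : ¬ G.Adj x b := fun h => hbx h.symm
  refine h1.elim ⟨⟨![a, b, c, d, x], ?_⟩, ?_⟩
  · intro i j hij
    fin_cases i <;> fin_cases j <;> simp at hij ⊢ <;> subst hij <;> simp_all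
  · intro i j
    change G.Adj (![a, b, c, d, x] i) (![a, b, c, d, x] j) ↔ _
    fin_cases i <;> fin_cases j <;> simp [graphP2P3, *]

theorem no_gem (h2 : IsFreeOf G graphGem) {z p q r s : V} (hzp : G.Adj z p) (hzq : G.Adj z q)
    (hzr : G.Adj z r) (hzs : G.Adj z s) (hpq : G.Adj p q) (hqr : G.Adj q r) (hrs : G.Adj r s)
    (hpr : ¬ G.Adj p r) (hps : ¬ G.Adj p s) (hqs : ¬ G.Adj q s) : False := by
  have := hzp.symm
  have := hzq.symm
  have := hzr.symm
  have := hzs.symm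
  have := hpq.symm
  have := hqr.symm
  have := hrs.symm
  have hrp : ¬ G.Adj r p := fun h => hpr h.symm
  have hsp : ¬ G.Adj s p := fun h => hps h.symm
  have hsq : ¬ G.Adj s q := fun h => hqs h.symm
  refine h2.elim ⟨⟨![p, q, r, s, z], ?_⟩, ?_⟩
  · intro i j hij
    fin_cases i <;> fin_cases j <;> simp at hij ⊢ <;> subst hij <;> simp_all
  · intro i j
    change G.Adj (![p, q, r, s, z] i) (![p, q, r, s, z] j) ↔ _
    fin_cases i <;> fin_cases j <;> simp [graphGem, *]

theorem forbidden_sound (h1 : IsFreeOf G graphP2P3) (h2 : IsFreeOf G graphGem)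
    {c : ℕ} (hc : c < 1024) (g : ℕ → V)
    (hg : ∀ i < 5, ∀ j < 5, i ≠ j → g i ≠ g j)
    (he : ∀ i < 5, ∀ j < 5, unpack c i j = true ↔ G.Adj (g i) (g j)) :
    bit forbiddenCodes c = false := by
  rw [← Bool.not_eq_true]
  intro h
  have h := forbiddenCodes_spec c hc h
  rw [Bool.or_eq_true] at h
  rcases h with h | h
  · simp only [hasP2P3, anyLT_iff, Bool.and_eq_true, Bool.not_eq_true', ← Bool.not_eq_true] at h
    obtain ⟨d, hd, c', hc', hcd, x, hx, ⟨⟨hdx, hcx⟩, hne⟩, a, ha, ⟨⟨hac, had⟩, hax⟩, b, hb,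
      ⟨⟨hab, hbc⟩, hbd⟩, hbx⟩ := h
    rw [he _ (by assumption) _ (by assumption)] at hcd hdx hcx hac had hax hab hbc hbd hbx
    exact no_P2P3 h1 hab hcd hdx hcx (hg _ hc' _ hx (fun h => hne (by simp [h])))
      hac had hax hbc hbd hbx
  · simp only [hasGem, anyLT_iff, Bool.and_eq_true, Bool.not_eq_true', ← Bool.not_eq_true] at h
    obtain ⟨q, hq, r, hr, hqr, z, hz, ⟨hzq, hzr⟩, p, hp, ⟨⟨hzp, hpq⟩, hpr⟩, s, hs,
      ⟨⟨hzs, hrs⟩, hqs⟩, hps⟩ := h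
    rw [he _ (by assumption) _ (by assumption)] at hqr hzq hzr hzp hpq hpr hzs hrs hqs hps
    exact no_gem h2 hzp hzq hzr hzs hpq hqr hrs hpr hps hqs

open Classical in
theorem code_sound (h1 : IsFreeOf G graphP2P3) (h2 : IsFreeOf G graphGem)
    {x0 x1 x2 x3 x4 : V} (h01 : x0 ≠ x1) (h02 : x0 ≠ x2) (h12 : x1 ≠ x2) (h03 : x0 ≠ x3)
    (h13 : x1 ≠ x3) (h23 : x2 ≠ x3) (h04 : x0 ≠ x4) (h14 : x1 ≠ x4) (h24 : x2 ≠ x4)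
    (h34 : x3 ≠ x4) :
    bit forbiddenCodes (code (decide (G.Adj x0 x1)) (decide (G.Adj x0 x2)) (decide (G.Adj x1 x2))
      (decide (G.Adj x0 x3)) (decide (G.Adj x1 x3)) (decide (G.Adj x2 x3)) (decide (G.Adj x0 x4))
      (decide (G.Adj x1 x4)) (decide (G.Adj x2 x4)) (decide (G.Adj x3 x4))) = false := by
  obtain ⟨hc, hb⟩ := code_spec (decide (G.Adj x0 x1)) (decide (G.Adj x0 x2))
    (decide (G.Adj x1 x2)) (decide (G.Adj x0 x3)) (decide (G.Adj x1 x3)) (decide (G.Adj x2 x3))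
    (decide (G.Adj x0 x4)) (decide (G.Adj x1 x4)) (decide (G.Adj x2 x4)) (decide (G.Adj x3 x4))
  generalize code (decide (G.Adj x0 x1)) (decide (G.Adj x0 x2))
    (decide (G.Adj x1 x2)) (decide (G.Adj x0 x3)) (decide (G.Adj x1 x3)) (decide (G.Adj x2 x3))
    (decide (G.Adj x0 x4)) (decide (G.Adj x1 x4)) (decide (G.Adj x2 x4))
    (decide (G.Adj x3 x4)) = c at hc hb
  have b0 := hb 0 (by norm_num)
  have b1 := hb 1 (by norm_num)
  have b2 := hb 2 (by norm_num)
  have b3 := hb 3 (by norm_num)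
  have b4 := hb 4 (by norm_num)
  have b5 := hb 5 (by norm_num)
  have b6 := hb 6 (by norm_num)
  have b7 := hb 7 (by norm_num)
  have b8 := hb 8 (by norm_num)
  have b9 := hb 9 (by norm_num)
  simp only [List.getD_cons_succ, List.getD_cons_zero] at b0 b1 b2 b3 b4 b5 b6 b7 b8 b9
  refine forbidden_sound h1 h2 hc (fun i => [x0, x1, x2, x3, x4].getD i x0) ?_ ?_
  · intro i hi j hj hij
    interval_cases i <;> interval_cases j <;> simp_all [ne_comm]
  · intro i hi j hj
    interval_cases i <;> interval_cases j <;>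
      simp [unpack, Nat.blt, Nat.ble, b0, b1, b2, b3, b4, b5, b6, b7, b8, b9, G.adj_comm]

/-- The vertices `f 0, …, f (n - 1)` are distinct and induce the pattern `B`. -/
structure Rep (G : SimpleGraph V) (n B : ℕ) (f : ℕ → V) : Prop where
  inj : ∀ i < n, ∀ j < n, i ≠ j → f i ≠ f j
  adj : ∀ i < n, ∀ j < n, edge B i j = true ↔ G.Adj (f i) (f j)

open Classical in
/-- The neighbourhood of `u` among `f 0, …, f (n - 1)`. -/
noncomputable def lab (G : SimpleGraph V) (n : ℕ) (f : ℕ → V) (u : V) : ℕ :=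
  Nat.ofBits (fun i : Fin n => decide (G.Adj u (f i)))

theorem lab_lt (n : ℕ) (f : ℕ → V) (u : V) : lab G n f u < 2 ^ n := Nat.ofBits_lt_two_pow _

theorem bit_lab {n : ℕ} {f : ℕ → V} {u : V} {i : ℕ} (hi : i < n) :
    bit (lab G n f u) i = true ↔ G.Adj u (f i) := by
  rw [bit_eq_testBit, lab, Nat.testBit_ofBits_lt _ _ hi]
  simp

open Classical in
theorem bit_lab' {n : ℕ} {f : ℕ → V} {u : V} {i : ℕ} (hi : i < n) :
    bit (lab G n f u) i = decide (G.Adj (f i) u) := by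
  rw [Bool.eq_iff_iff, bit_lab hi, G.adj_comm]; simp

open Classical in
theorem Rep.edge_eq {n B : ℕ} {f : ℕ → V} (hf : Rep G n B f) {i j : ℕ} (hi : i < n) (hj : j < n) :
    edge B i j = decide (G.Adj (f i) (f j)) := by
  rw [Bool.eq_iff_iff, hf.adj i hi j hj]; simp

theorem Rep.badOne_eq (h1 : IsFreeOf G graphP2P3) (h2 : IsFreeOf G graphGem)
    {n B : ℕ} {f : ℕ → V} (hf : Rep G n B f) {u : V} (hu : ∀ i < n, u ≠ f i) :
    badOne n B (lab G n f u) = false := by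
  rw [← Bool.not_eq_true]
  intro h
  simp only [badOne, anyLT_iff] at h
  obtain ⟨l, hl, k, hk, j, hj, i, hi, h⟩ := h
  have hkn : k < n := by omega
  have hjn : j < n := by omega
  have hin : i < n := by omega
  rw [hf.edge_eq, hf.edge_eq, hf.edge_eq, hf.edge_eq, hf.edge_eq, hf.edge_eq, bit_lab', bit_lab',
    bit_lab', bit_lab', code_sound h1 h2] at h
  · cases h
  all_goals first
    | assumption
    | exact (hu _ (by assumption)).symm
    | exact hf.inj _ (by assumption) _ (by assumption) (by omega)

open Classical in
theorem Rep.badTwo_eq (h1 : IsFreeOf G graphP2P3) (h2 : IsFreeOf G graphGem)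
    {n B : ℕ} {f : ℕ → V} (hf : Rep G n B f) {u w : V} (hu : ∀ i < n, u ≠ f i)
    (hw : ∀ i < n, w ≠ f i) (huw : u ≠ w) :
    badTwo n B (lab G n f u) (lab G n f w) (decide (G.Adj u w)) = false := by
  rw [← Bool.not_eq_true]
  intro h
  simp only [badTwo, anyLT_iff] at h
  obtain ⟨k, hkn, j, hj, i, hi, h⟩ := h
  have hjn : j < n := by omega
  have hin : i < n := by omega
  rw [hf.edge_eq, hf.edge_eq, hf.edge_eq, bit_lab', bit_lab',
    bit_lab', bit_lab', bit_lab', bit_lab', code_sound h1 h2] at h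
  · cases h
  all_goals first
    | assumption
    | exact (hu _ (by assumption)).symm
    | exact (hw _ (by assumption)).symm
    | exact hf.inj _ (by assumption) _ (by assumption) (by omega)

end Soundness

/-! ### Types of vertices relative to a base -/

section Types

variable {V : Type*} {G : SimpleGraph V}

open Classical in
/-- The type of a vertex relative to the base `f 0, …, f (n - 1)`: the code of its neighbourhood in
the base, or `2 ^ n + i` if the vertex is `f i` itself. -/
noncomputable def tau (G : SimpleGraph V) (n : ℕ) (f : ℕ → V) (u : V) : ℕ :=
  if h : ∃ i < n, u = f i then 2 ^ n + h.choose else lab G n f u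

/-- Adjacency of a vertex of type `t` to the `i`-th base vertex. -/
def nbr (n B t i : ℕ) : Bool :=
  bif Nat.ble (Nat.pow 2 n) t then edge B (Nat.sub t (Nat.pow 2 n)) i else bit t i

/-- Boolean equality. -/
def eqB (a b : Bool) : Bool := bif a then b else !b

theorem eqB_iff (a b : Bool) : eqB a b = true ↔ a = b := by cases a <;> cases b <;> simp [eqB]

/-- Distinct vertices of types `m` and `k` and adjacency `a` are not excluded by the pattern `B`. -/
def okPair (n B m k : ℕ) (a : Bool) : Bool :=
  bif Nat.ble (Nat.pow 2 n) m then
    (bif Nat.ble (Nat.pow 2 n) k then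
      (!(Nat.beq m k) && eqB (edge B (Nat.sub m (Nat.pow 2 n)) (Nat.sub k (Nat.pow 2 n))) a)
    else eqB (bit k (Nat.sub m (Nat.pow 2 n))) a)
  else bif Nat.ble (Nat.pow 2 n) k then eqB (bit m (Nat.sub k (Nat.pow 2 n))) a
  else !(badTwo n B m k a)

/-- All pairs of types in `L` not excluded by the pattern satisfy `P`. -/
def chk (n B : ℕ) (L : List ℕ) (P : ℕ → ℕ → Bool → Bool) : Bool :=
  L.all fun m => L.all fun k =>
    (P m k true || !(okPair n B m k true)) && (P m k false || !(okPair n B m k false))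

/-- The vertices `f 0, …, f (n - 1)` induce the pattern `B` and all types of vertices lie in `L`. -/
structure Typed (G : SimpleGraph V) (n B : ℕ) (L : List ℕ) (f : ℕ → V) : Prop where
  free1 : IsFreeOf G graphP2P3
  free2 : IsFreeOf G graphGem
  rep : Rep G n B f
  mem : ∀ u, tau G n f u ∈ L

theorem tau_of_not_base {n : ℕ} {f : ℕ → V} {u : V} (hu : ∀ i < n, u ≠ f i) :
    tau G n f u = lab G n f u := by
  rw [tau, dif_neg]
  rintro ⟨i, hi, h⟩
  exact hu i hi h

namespace Rep

variable {n B : ℕ} {f : ℕ → V}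
theorem tau_base (hf : Rep G n B f) {i : ℕ} (hi : i < n) : tau G n f (f i) = 2 ^ n + i := by
  have h : ∃ j < n, f i = f j := ⟨i, hi, rfl⟩
  rw [tau, dif_pos h]
  by_contra hne
  exact hf.inj i hi _ h.choose_spec.1 (fun h' => hne (by rw [← h'])) h.choose_spec.2

theorem tau_cases (hf : Rep G n B f) (u : V) : (∃ i < n, u = f i ∧ tau G n f u = 2 ^ n + i) ∨
    ((∀ i < n, u ≠ f i) ∧ tau G n f u = lab G n f u ∧ tau G n f u < 2 ^ n) := by
  by_cases h : ∃ i < n, u = f i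
  · obtain ⟨i, hi, rfl⟩ := h
    exact Or.inl ⟨i, hi, rfl, hf.tau_base hi⟩
  · push Not at h
    rw [tau_of_not_base h]
    exact Or.inr ⟨h, rfl, lab_lt _ _ _⟩

theorem eq_of_tau (hf : Rep G n B f) {u : V} {i : ℕ} (hi : i < n)
    (h : tau G n f u = 2 ^ n + i) : u = f i := by
  rcases hf.tau_cases u with ⟨j, hj, hu, ht⟩ | ⟨-, -, hlt⟩
  · obtain rfl : i = j := by omega
    exact hu
  · omega

theorem nbr_iff (hf : Rep G n B f) {u : V} {i : ℕ} (hi : i < n) :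
    nbr n B (tau G n f u) i = true ↔ G.Adj u (f i) := by
  rcases hf.tau_cases u with ⟨j, hj, rfl, ht⟩ | ⟨-, ht, hlt⟩
  · have h1 : Nat.ble (Nat.pow 2 n) (2 ^ n + j) = true := by
      rw [Nat.ble_eq]; exact Nat.le_add_right _ _
    have h2 : Nat.sub (2 ^ n + j) (Nat.pow 2 n) = j := by
      have h : 2 ^ n + j - 2 ^ n = j := by omega
      exact h
    rw [ht, nbr, h1, h2, cond_true, hf.adj j hj i hi]
  · have h1 : Nat.ble (Nat.pow 2 n) (lab G n f u) = false := by
      rw [← Bool.not_eq_true, Nat.ble_eq]; exact not_le.2 (lab_lt _ _ _)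
    rw [ht, nbr, h1, cond_false, bit_lab hi]

open Classical in
theorem okPair_eq (hf : Rep G n B f) (h1 : IsFreeOf G graphP2P3) (h2 : IsFreeOf G graphGem)
    {u w : V} (huw : u ≠ w) :
    okPair n B (tau G n f u) (tau G n f w) (decide (G.Adj u w)) = true := by
  have key : ∀ j, Nat.ble (Nat.pow 2 n) (2 ^ n + j) = true := fun j => by
    rw [Nat.ble_eq]; exact Nat.le_add_right _ _
  have key2 : ∀ j, Nat.sub (2 ^ n + j) (Nat.pow 2 n) = j :=
    fun j => by
      have h : 2 ^ n + j - 2 ^ n = j := by omega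
      exact h
  have key3 : ∀ x, Nat.ble (Nat.pow 2 n) (lab G n f x) = false := fun x => by
    rw [← Bool.not_eq_true, Nat.ble_eq]; exact not_le.2 (lab_lt _ _ _)
  rcases hf.tau_cases u with ⟨i, hi, hu, ht⟩ | ⟨hu, ht, hlt⟩ <;>
  rcases hf.tau_cases w with ⟨j, hj, hw, ht'⟩ | ⟨hw, ht', hlt'⟩
  · rw [ht, ht', okPair, key, key, key2, key2, cond_true, cond_true, Bool.and_eq_true, eqB_iff,
      hf.edge_eq hi hj, hu, hw]
    refine ⟨?_, rfl⟩
    rw [Bool.not_eq_true', ← Bool.not_eq_true, Nat.beq_eq]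
    intro h
    obtain rfl : i = j := by omega
    exact huw (hu.trans hw.symm)
  · rw [ht, ht', okPair, key, key3, key2, cond_true, cond_false, eqB_iff, bit_lab' hi, hu]
  · rw [ht, ht', okPair, key, key3, key2, cond_false, cond_true, eqB_iff, bit_lab' hj, hw,
      Bool.eq_iff_iff, decide_eq_true_iff, decide_eq_true_iff, G.adj_comm]
  · rw [ht, ht', okPair, key3, key3, cond_false, cond_false, hf.badTwo_eq h1 h2 hu hw huw]
    rfl

end Rep

namespace Typed

variable {n B : ℕ} {L : List ℕ} {f : ℕ → V}

open Classical in
theorem fact (hT : Typed G n B L f) (P : ℕ → ℕ → Bool → Bool) (hP : chk n B L P = true) {u w : V}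
    (huw : u ≠ w) : P (tau G n f u) (tau G n f w) (decide (G.Adj u w)) = true := by
  rw [chk, List.all_eq_true] at hP
  have h := hP _ (hT.mem u)
  rw [List.all_eq_true] at h
  have h := h _ (hT.mem w)
  have hok := hT.rep.okPair_eq hT.free1 hT.free2 huw
  rw [Bool.and_eq_true] at h
  cases hd : decide (G.Adj u w) <;> rw [hd] at hok <;> rw [hok] at h <;> simp at h <;> simp [h]

theorem nonadj (hT : Typed G n B L f) (p q : ℕ → Bool)
    (hP : chk n B L (fun m k a => !(p m && q k && a)) = true) {u w : V}
    (hu : p (tau G n f u) = true) (hw : q (tau G n f w) = true) : ¬ G.Adj u w := by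
  intro h
  have := hT.fact _ hP h.ne
  simp [hu, hw, h] at this

theorem adj (hT : Typed G n B L f) (p q : ℕ → Bool)
    (hP : chk n B L (fun m k a => !(p m && q k && !a)) = true) {u w : V} (huw : u ≠ w)
    (hu : p (tau G n f u) = true) (hw : q (tau G n f w) = true) : G.Adj u w := by
  have := hT.fact _ hP huw
  simpa [hu, hw] using this

theorem excl (hT : Typed G n B L f) (p q : ℕ → Bool)
    (hP : chk n B L (fun m k _ => !(p m && q k)) = true) {u w : V} (huw : u ≠ w)
    (hu : p (tau G n f u) = true) (hw : q (tau G n f w) = true) : False := by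
  have := hT.fact _ hP huw
  simp [hu, hw] at this

theorem single (hT : Typed G n B L f) (p : ℕ → Bool) (hP : L.all p = true) (u : V) :
    p (tau G n f u) = true := by
  rw [List.all_eq_true] at hP
  exact hP _ (hT.mem u)

/-- Constructing a typed base from a bound on the possible neighbourhoods. -/
theorem of_masks (h1 : IsFreeOf G graphP2P3) (h2 : IsFreeOf G graphGem)
    (hf : Rep G n B f) (Q : ℕ → Bool) (hQ : ∀ u, (∀ i < n, u ≠ f i) → Q (lab G n f u) = true)
    (hL : ∀ m < 2 ^ n, Q m = true → badOne n B m = false → m ∈ L)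
    (hL' : ∀ i < n, 2 ^ n + i ∈ L) : Typed G n B L f := by
  refine ⟨h1, h2, hf, fun u => ?_⟩
  rcases hf.tau_cases u with ⟨i, hi, -, ht⟩ | ⟨hu, ht, -⟩
  · rw [ht]; exact hL' i hi
  · rw [ht]; exact hL _ (lab_lt _ _ _) (hQ u hu) (hf.badOne_eq h1 h2 hu)

end Typed

end Types

/-! ### Colouring -/

section Colouring

variable {V : Type*} {G : SimpleGraph V}

/-- `S` contains no induced path on four vertices. -/
def P4Free (G : SimpleGraph V) (S : Finset V) : Prop :=
  ∀ a ∈ S, ∀ b ∈ S, ∀ c ∈ S, ∀ d ∈ S, G.Adj a b → G.Adj b c → G.Adj c d →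
    G.Adj a c ∨ G.Adj b d ∨ G.Adj a d

theorem P4Free.mono {S T : Finset V} (h : P4Free G T) (hST : S ⊆ T) : P4Free G S :=
  fun a ha b hb c hc d hd => h a (hST ha) b (hST hb) c (hST hc) d (hST hd)

theorem p4Free_of_nbr (h2 : IsFreeOf G graphGem) {S : Finset V} {z : V}
    (hS : ∀ u ∈ S, G.Adj z u) : P4Free G S := by
  intro a ha b hb c hc d hd hab hbc hcd
  by_contra! h
  exact no_gem h2 (hS a ha) (hS b hb) (hS c hc) (hS d hd) hab hbc hcd h.1 h.2.2 h.2.1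

/-- `c` is a proper colouring of `S` with colours below `k`. -/
def Colours (G : SimpleGraph V) (S : Finset V) (k : ℕ) (c : V → ℕ) : Prop :=
  (∀ u ∈ S, c u < k) ∧ ∀ u ∈ S, ∀ w ∈ S, G.Adj u w → c u ≠ c w

theorem exists_maximal_stable (S : Finset V) : ∃ I ⊆ S, (∀ u ∈ I, ∀ w ∈ I, ¬ G.Adj u w) ∧
    ∀ u ∈ S, u ∉ I → ∃ w ∈ I, G.Adj u w := by
  classical
  let P : Finset V → Prop := fun I => ∀ u ∈ I, ∀ w ∈ I, ¬ G.Adj u w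
  obtain ⟨I, hI, hmax⟩ := Finset.exists_max_image (S.powerset.filter P) Finset.card
    ⟨∅, by simp [P]⟩
  rw [Finset.mem_filter, Finset.mem_powerset] at hI
  refine ⟨I, hI.1, hI.2, fun u hu huI => ?_⟩
  by_contra! hno
  have := hmax (insert u I) (by
    rw [Finset.mem_filter, Finset.mem_powerset]
    refine ⟨Finset.insert_subset hu hI.1, ?_⟩
    intro x hx y hy
    rcases Finset.mem_insert.1 hx with rfl | hx' <;> rcases Finset.mem_insert.1 hy with rfl | hy'
    · exact G.irrefl
    · exact hno _ hy'
    · exact fun h => hno _ hx' h.symm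
    · exact hI.2 _ hx' _ hy')
  rw [Finset.card_insert_of_notMem huI] at this
  omega

/-- In a `P4`-free set every maximal stable set meets every maximal clique. -/
theorem P4Free.stable_meets_clique {S I K : Finset V} (hS : P4Free G S) (hI : I ⊆ S)
    (hstab : ∀ u ∈ I, ∀ w ∈ I, ¬ G.Adj u w)
    (hmax : ∀ u ∈ S, u ∉ I → ∃ w ∈ I, G.Adj u w) (hK : K ⊆ S) (hne : K.Nonempty)
    (hcl : ∀ u ∈ K, ∀ w ∈ K, u ≠ w → G.Adj u w) (hdisj : ∀ u ∈ K, u ∉ I) :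
    ∃ i ∈ I, ∀ u ∈ K, G.Adj u i := by
  classical
  obtain ⟨k, hk, hmin⟩ := Finset.exists_min_image K (fun k => (I.filter (G.Adj k)).card) hne
  obtain ⟨i, hi, hki⟩ := hmax k (hK hk) (hdisj k hk)
  refine ⟨i, hi, fun u hu => ?_⟩
  by_contra hui
  have huk : u ≠ k := by rintro rfl; exact hui hki
  have hsub : I.filter (G.Adj u) ⊆ I.filter (G.Adj k) := by
    intro j hj
    rw [Finset.mem_filter] at hj ⊢
    refine ⟨hj.1, ?_⟩
    by_contra hkj
    rcases hS j (hI hj.1) u (hK hu) k (hK hk) i (hI hi) hj.2.symm (hcl u hu k hk huk) hki with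
      h | h | h
    · exact hkj h.symm
    · exact hui h
    · exact hstab j hj.1 i hi h
  have hss : I.filter (G.Adj u) ⊂ I.filter (G.Adj k) := by
    refine Finset.ssubset_iff_subset_ne.2 ⟨hsub, fun h => ?_⟩
    have : i ∈ I.filter (G.Adj u) := by rw [h, Finset.mem_filter]; exact ⟨hi, hki⟩
    exact hui (Finset.mem_filter.1 this).2
  exact absurd (hmin u hu) (not_le.2 (Finset.card_lt_card hss))

/-- `P4`-free sets are coloured with as many colours as the largest clique has vertices. -/
theorem P4Free.exists_colours (k : ℕ) : ∀ {S : Finset V}, P4Free G S →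
    (∀ K ⊆ S, (∀ u ∈ K, ∀ w ∈ K, u ≠ w → G.Adj u w) → K.card ≤ k) →
    ∃ c : V → ℕ, Colours G S k c := by
  classical
  induction k with
  | zero =>
    intro S hS hk
    have hempty : S = ∅ := by
      by_contra hne
      obtain ⟨x, hx⟩ := Finset.nonempty_iff_ne_empty.2 hne
      have := hk {x} (Finset.singleton_subset_iff.2 hx) (by
        intro u hu w hw huw
        rw [Finset.mem_singleton] at hu hw
        exact absurd (hu.trans hw.symm) huw)
      simp at this
    subst hempty
    exact ⟨fun _ => 0, by simp [Colours]⟩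
  | succ k ih =>
    intro S hS hk
    obtain ⟨I, hI, hstab, hmax⟩ := exists_maximal_stable (G := G) S
    obtain ⟨c, hc⟩ := ih (S := S \ I) (hS.mono Finset.sdiff_subset) (by
      intro K hK hcl
      by_contra! hlt
      have hne : K.Nonempty := Finset.card_pos.1 (by omega)
      obtain ⟨i, hi, hadj⟩ := hS.stable_meets_clique hI hstab hmax
        (hK.trans Finset.sdiff_subset) hne hcl (fun u hu => (Finset.mem_sdiff.1 (hK hu)).2)
      have hiK : i ∉ K := fun h => G.irrefl (hadj i h)
      have := hk (insert i K) (Finset.insert_subset (hI hi) (hK.trans Finset.sdiff_subset)) (by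
        intro u hu w hw huw
        rcases Finset.mem_insert.1 hu with rfl | hu' <;> rcases Finset.mem_insert.1 hw with rfl | hw'
        · exact absurd rfl huw
        · exact (hadj _ hw').symm
        · exact hadj _ hu'
        · exact hcl _ hu' _ hw' huw)
      rw [Finset.card_insert_of_notMem hiK] at this
      omega)
    refine ⟨fun u => if u ∈ I then k else c u, fun u hu => ?_, fun u hu w hw h => ?_⟩
    · by_cases h : u ∈ I
      · simp [h]
      · have := hc.1 u (Finset.mem_sdiff.2 ⟨hu, h⟩)
        simp only [h, if_false]; omega
    · by_cases h1 : u ∈ I <;> by_cases h2 : w ∈ I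
      · exact absurd h (hstab u h1 w h2)
      · have := hc.1 w (Finset.mem_sdiff.2 ⟨hw, h2⟩)
        simp only [h1, h2, if_true, if_false]; omega
      · have := hc.1 u (Finset.mem_sdiff.2 ⟨hu, h1⟩)
        simp only [h1, h2, if_true, if_false]; omega
      · simp only [h1, h2, if_false]
        exact hc.2 u (Finset.mem_sdiff.2 ⟨hu, h1⟩) w (Finset.mem_sdiff.2 ⟨hw, h2⟩) h

theorem Colours.swap {S : Finset V} {k : ℕ} {c : V → ℕ} (hc : Colours G S k c) {i j : ℕ}
    (hi : i < k) (hj : j < k) : Colours G S k (fun u => Equiv.swap i j (c u)) := by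
  refine ⟨fun u hu => ?_, fun u hu w hw h => ?_⟩
  · have := hc.1 u hu
    simp only [Equiv.swap_apply_def]
    split_ifs <;> assumption
  · exact fun heq => hc.2 u hu w hw h ((Equiv.swap i j).injective heq)

/-- A vertex may be given any prescribed colour. -/
theorem Colours.exists_eq {S : Finset V} {k : ℕ} {c : V → ℕ} (hc : Colours G S k c) {x : V}
    (hx : x ∈ S) {j : ℕ} (hj : j < k) : ∃ c', Colours G S k c' ∧ c' x = j :=
  ⟨_, hc.swap (hc.1 x hx) hj, Equiv.swap_apply_left _ _⟩

theorem Colours.mono {S T : Finset V} {k l : ℕ} {c : V → ℕ} (hc : Colours G T k c) (hST : S ⊆ T)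
    (hkl : k ≤ l) : Colours G S l c :=
  ⟨fun u hu => (hc.1 u (hST hu)).trans_le hkl, fun u hu w hw => hc.2 u (hST hu) w (hST hw)⟩

/-- `K` is a clique. -/
def Clq (G : SimpleGraph V) (K : Finset V) : Prop := ∀ u ∈ K, ∀ w ∈ K, u ≠ w → G.Adj u w

theorem Clq.mono {K K' : Finset V} (h : Clq G K) (hK : K' ⊆ K) : Clq G K' :=
  fun u hu w hw => h u (hK hu) w (hK hw)

theorem Clq.p4Free {K : Finset V} (h : Clq G K) : P4Free G K := by
  intro a ha b hb c hc d hd hab hbc hcd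
  by_cases hac : a = c
  · subst hac; exact Or.inr (Or.inr hcd)
  · exact Or.inl (h a ha c hc hac)

theorem Clq.exists_colours {K : Finset V} (h : Clq G K) {k : ℕ} (hk : K.card ≤ k) :
    ∃ c, Colours G K k c :=
  h.p4Free.exists_colours k fun _ hK _ => (Finset.card_le_card hK).trans hk

theorem Clq.card_le [Finite V] {K : Finset V} (h : Clq G K) : K.card ≤ G.cliqueNum :=
  SimpleGraph.IsClique.card_le_cliqueNum (t := K) (tc := fun u hu w hw huw => h u hu w hw huw)

theorem Clq.card_add_le [Finite V] {K K' : Finset V} (h : Clq G K) (h' : Clq G K')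
    (hc : ∀ u ∈ K, ∀ w ∈ K', G.Adj u w) : K.card + K'.card ≤ G.cliqueNum := by
  classical
  rw [← Finset.card_union_of_disjoint
    (Finset.disjoint_left.2 fun u hu hu' => G.irrefl (hc u hu u hu'))]
  refine Clq.card_le fun u hu w hw huw => ?_
  rcases Finset.mem_union.1 hu with hu | hu <;> rcases Finset.mem_union.1 hw with hw | hw
  · exact h u hu w hw huw
  · exact hc u hu w hw
  · exact (hc w hw u hu).symm
  · exact h' u hu w hw huw

/-- A largest clique inside `S`. -/
theorem exists_max_clq (G : SimpleGraph V) (S : Finset V) :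
    ∃ K ⊆ S, Clq G K ∧ ∀ K' ⊆ S, Clq G K' → K'.card ≤ K.card := by
  classical
  obtain ⟨K, hK, hmax⟩ := Finset.exists_max_image (S.powerset.filter (Clq G)) Finset.card
    ⟨∅, by simp [Clq]⟩
  rw [Finset.mem_filter, Finset.mem_powerset] at hK
  exact ⟨K, hK.1, hK.2, fun K' h h' => hmax K' (by simp [h, h'])⟩

theorem chromaticNumber_le_of_colouring {k : ℕ} (c : V → ℕ) (hk : ∀ u, c u < k)
    (hc : ∀ u w, G.Adj u w → c u ≠ c w) : G.chromaticNumber ≤ k := by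
  refine SimpleGraph.Colorable.chromaticNumber_le ⟨⟨fun u => ⟨c u, hk u⟩, ?_⟩⟩
  intro u w h
  simpa using hc u w h

end Colouring

/-! ### Combining colourings -/

section Combining

variable {V : Type*} {G : SimpleGraph V}

/-- `S` can be coloured with `k` colours. -/
def Col (G : SimpleGraph V) (S : Finset V) (k : ℕ) : Prop := ∃ c, Colours G S k c

theorem Colours.glue [DecidableEq V] {S T : Finset V} {k : ℕ} {c c' : V → ℕ}
    (hc : Colours G S k c) (hc' : Colours G T k c')
    (h : ∀ u ∈ S, ∀ w ∈ T, w ∉ S → G.Adj u w → c u ≠ c' w) :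
    Colours G (S ∪ T) k fun u => if u ∈ S then c u else c' u := by
  have key : ∀ u ∈ S ∪ T, u ∉ S → u ∈ T := fun u hu hn => (Finset.mem_union.1 hu).resolve_left hn
  refine ⟨fun u hu => ?_, fun u hu w hw huw => ?_⟩
  · by_cases h1 : u ∈ S
    · simpa [h1] using hc.1 u h1
    · simpa [h1] using hc'.1 u (key u hu h1)
  · by_cases h1 : u ∈ S <;> by_cases h2 : w ∈ S <;> simp only [h1, h2, if_true, if_false]
    · exact hc.2 u h1 w h2 huw
    · exact h u h1 w (key w hw h2) h2 huw
    · exact (h w h2 u (key u hu h1) h1 huw.symm).symm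
    · exact hc'.2 u (key u hu h1) w (key w hw h2) huw

theorem Col.par [DecidableEq V] {S T : Finset V} {k : ℕ} (hS : Col G S k) (hT : Col G T k)
    (h : ∀ u ∈ S, ∀ w ∈ T, ¬ G.Adj u w) : Col G (S ∪ T) k := by
  obtain ⟨c, hc⟩ := hS
  obtain ⟨c', hc'⟩ := hT
  exact ⟨_, hc.glue hc' fun u hu w hw _ huw => absurd huw (h u hu w hw)⟩

theorem Col.add [DecidableEq V] {S T : Finset V} {k l : ℕ} (hS : Col G S k) (hT : Col G T l) :
    Col G (S ∪ T) (k + l) := by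
  obtain ⟨c, hc⟩ := hS
  obtain ⟨c', hc'⟩ := hT
  have h : Colours G T (k + l) fun u => k + c' u :=
    ⟨fun u hu => Nat.add_lt_add_left (hc'.1 u hu) k, fun u hu w hw huw h =>
      hc'.2 u hu w hw huw (Nat.add_left_cancel h)⟩
  exact ⟨_, (hc.mono (Finset.Subset.refl S) (Nat.le_add_right k l)).glue h
    fun u hu w _ _ _ => by have := hc.1 u hu; omega⟩

theorem Col.mono {S T : Finset V} {k l : ℕ} (h : Col G T k) (hST : S ⊆ T) (hkl : k ≤ l) :
    Col G S l := by
  obtain ⟨c, hc⟩ := h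
  exact ⟨c, hc.mono hST hkl⟩

theorem col_of_stable {S : Finset V} (hS : ∀ u ∈ S, ∀ w ∈ S, ¬ G.Adj u w) : Col G S 1 :=
  ⟨fun _ => 0, fun _ _ => Nat.one_pos, fun u hu w hw h => absurd h (hS u hu w hw)⟩

theorem Clq.col {K : Finset V} (h : Clq G K) : Col G K K.card := h.exists_colours le_rfl

theorem Col.chromaticNumber_le {S : Finset V} {k : ℕ} (h : Col G S k) (hS : ∀ u, u ∈ S) :
    G.chromaticNumber ≤ k := by
  obtain ⟨c, hc⟩ := h
  exact chromaticNumber_le_of_colouring c (fun u => hc.1 u (hS u))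
    fun u w => hc.2 u (hS u) w (hS w)

/-- A clique can be coloured with a prescribed colour at one of its vertices. -/
theorem Clq.exists_colours_eq {K : Finset V} (h : Clq G K) {k : ℕ} (hk : K.card ≤ k) {x : V}
    (hx : x ∈ K) {j : ℕ} (hj : j < k) : ∃ c, Colours G K k c ∧ c x = j := by
  obtain ⟨c, hc⟩ := h.exists_colours hk
  exact hc.exists_eq hx hj

end Combining

/-! ### Classes of vertices and changes of base -/

section Classes

variable {V : Type*} {G : SimpleGraph V} {n B : ℕ} {L : List ℕ} {f : ℕ → V}

open Classical in
/-- The vertices whose type satisfies `p`. -/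
noncomputable def cls [Fintype V] (G : SimpleGraph V) (n : ℕ) (f : ℕ → V) (p : ℕ → Bool) :
    Finset V :=
  Finset.univ.filter fun u => p (tau G n f u) = true

theorem mem_cls [Fintype V] {p : ℕ → Bool} {u : V} : u ∈ cls G n f p ↔ p (tau G n f u) = true := by
  simp [cls]

/-- The type `t` is adjacent to the base vertices in `pos` and nonadjacent to those in `neg`. -/
def sel (n B : ℕ) (pos neg : List ℕ) (t : ℕ) : Bool :=
  (pos.all fun i => nbr n B t i) && (neg.all fun i => !(nbr n B t i))

theorem Rep.sel_iff (hf : Rep G n B f) {pos neg : List ℕ} (hpos : ∀ i ∈ pos, i < n)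
    (hneg : ∀ i ∈ neg, i < n) {u : V} : sel n B pos neg (tau G n f u) = true ↔
      (∀ i ∈ pos, G.Adj u (f i)) ∧ ∀ i ∈ neg, ¬ G.Adj u (f i) := by
  rw [sel, Bool.and_eq_true, List.all_eq_true, List.all_eq_true]
  refine and_congr (forall₂_congr fun i hi => hf.nbr_iff (hpos i hi)) (forall₂_congr fun i hi => ?_)
  rw [← hf.nbr_iff (hneg i hi), Bool.not_eq_true', Bool.not_eq_true]

/-- Replacing a base vertex by one with the same neighbours in the base. -/
theorem Rep.update (hf : Rep G n B f) {i : ℕ} (hi : i < n) {u : V}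
    (hu : ∀ j < n, j ≠ i → (G.Adj u (f j) ↔ G.Adj (f i) (f j)))
    (hne : ∀ j < n, j ≠ i → u ≠ f j) : Rep G n B (Function.update f i u) := by
  refine ⟨fun j hj k hk hjk => ?_, fun j hj k hk => ?_⟩
  · rcases eq_or_ne j i with rfl | hji <;> rcases eq_or_ne k j with hk' | hk'
    · exact absurd hk'.symm hjk
    · rw [Function.update_self, Function.update_of_ne hk']
      exact hne k hk hk'
    · exact absurd hk'.symm hjk
    · rw [Function.update_of_ne hji]
      rcases eq_or_ne k i with rfl | hki
      · rw [Function.update_self]; exact (hne j hj hji).symm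
      · rw [Function.update_of_ne hki]; exact hf.inj j hj k hk hjk
  · rw [hf.adj j hj k hk]
    rcases eq_or_ne j i with hji | hji <;> rcases eq_or_ne k i with hki | hki
    · subst hji; subst hki; simp
    · subst hji
      rw [Function.update_self, Function.update_of_ne hki]
      exact (hu k hk hki).symm
    · subst hki
      rw [Function.update_self, Function.update_of_ne hji, G.adj_comm, G.adj_comm _ u]
      exact (hu j hj hji).symm
    · rw [Function.update_of_ne hji, Function.update_of_ne hki]

/-- No vertex sees exactly the vertices `f a`, `f b`, `f c` of `f a, f b, f c, f d, f e`. -/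
def NoY (G : SimpleGraph V) (f : ℕ → V) (a b c d e : ℕ) : Prop :=
  ∀ u, G.Adj u (f a) → G.Adj u (f b) → G.Adj u (f c) → G.Adj u (f d) ∨ G.Adj u (f e)

theorem NoY.update {a b c d e i : ℕ} (h : NoY G f a b c d e) (ha : a ≠ i) (hb : b ≠ i) (hc : c ≠ i)
    (hd : d ≠ i) (he : e ≠ i) {x : V} : NoY G (Function.update f i x) a b c d e := by
  intro u
  simp only [Function.update_of_ne ha, Function.update_of_ne hb, Function.update_of_ne hc,
    Function.update_of_ne hd, Function.update_of_ne he]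
  exact h u

/-- The mask `m` is compatible with `NoY`. -/
def notY (a b c d e m : ℕ) : Bool := !(bit m a && bit m b && bit m c) || bit m d || bit m e

theorem NoY.notY {a b c d e : ℕ} (h : NoY G f a b c d e) (ha : a < n) (hb : b < n) (hc : c < n)
    (hd : d < n) (he : e < n) (u : V) : notY a b c d e (lab G n f u) = true := by
  have key := h u
  rw [← bit_lab ha, ← bit_lab hb, ← bit_lab hc, ← bit_lab hd, ← bit_lab he] at key
  rw [F1Proof.notY]
  cases h1 : bit (lab G n f u) a <;> cases h2 : bit (lab G n f u) b <;>
    cases h3 : bit (lab G n f u) c <;> simp_all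

end Classes

/-- Membership of a type in a list. -/
def among (l : List ℕ) (t : ℕ) : Bool := l.any fun s => Nat.beq s t

theorem among_iff {l : List ℕ} {t : ℕ} : among l t = true ↔ t ∈ l := by
  simp [among, List.any_eq_true]

namespace Typed

variable {V : Type*} {G : SimpleGraph V} {n B : ℕ} {L : List ℕ} {f : ℕ → V}

/-- All vertices with a type in `l` are adjacent to the base vertex `f i`. -/
theorem adj_base (hT : Typed G n B L f) {l : List ℕ} {i : ℕ} (hi : i < n)
    (h : (l.all fun t => nbr n B t i) = true) {u : V} (hu : among l (tau G n f u) = true) :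
    G.Adj u (f i) := by
  rw [List.all_eq_true] at h
  exact (hT.rep.nbr_iff hi).1 (h _ (among_iff.1 hu))

theorem nonadj_base (hT : Typed G n B L f) {l : List ℕ} {i : ℕ} (hi : i < n)
    (h : (l.all fun t => !(nbr n B t i)) = true) {u : V} (hu : among l (tau G n f u) = true) :
    ¬ G.Adj u (f i) := by
  rw [List.all_eq_true] at h
  rw [← hT.rep.nbr_iff hi]
  simpa using h _ (among_iff.1 hu)

theorem base_mem (hT : Typed G n B L f) {l : List ℕ} {i : ℕ} (hi : i < n)
    (h : among l (2 ^ n + i) = true) : among l (tau G n f (f i)) = true := by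
  rwa [hT.rep.tau_base hi]

end Typed

section AdjSet

variable {V : Type*} {G : SimpleGraph V} {n B : ℕ} {L : List ℕ} {f : ℕ → V}

open Classical in
/-- The vertices adjacent to all `f i` with `i ∈ pos` and to no `f i` with `i ∈ neg`. -/
noncomputable def adjSet [Fintype V] (G : SimpleGraph V) (f : ℕ → V) (pos neg : List ℕ) :
    Finset V :=
  Finset.univ.filter fun u => (∀ i ∈ pos, G.Adj u (f i)) ∧ ∀ i ∈ neg, ¬ G.Adj u (f i)

theorem mem_adjSet [Fintype V] {pos neg : List ℕ} {u : V} : u ∈ adjSet G f pos neg ↔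
    (∀ i ∈ pos, G.Adj u (f i)) ∧ ∀ i ∈ neg, ¬ G.Adj u (f i) := by
  simp [adjSet]

theorem Rep.mem_adjSet_iff [Fintype V] (hf : Rep G n B f) {pos neg : List ℕ}
    (hpos : ∀ i ∈ pos, i < n) (hneg : ∀ i ∈ neg, i < n) {u : V} :
    u ∈ adjSet G f pos neg ↔ sel n B pos neg (tau G n f u) = true := by
  rw [mem_adjSet, hf.sel_iff hpos hneg]

theorem adjSet_comp [Fintype V] (σ : ℕ → ℕ) (pos neg : List ℕ) :
    adjSet G (fun i => f (σ i)) pos neg = adjSet G f (pos.map σ) (neg.map σ) := by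
  ext u
  simp [mem_adjSet]

/-- Reordering the base. -/
theorem Rep.comp (hf : Rep G n B f) {B' m : ℕ} {σ : ℕ → ℕ} (h : ∀ i < m, σ i < n)
    (hinj : ∀ i < m, ∀ j < m, σ i = σ j → i = j)
    (hB : ∀ i < m, ∀ j < m, edge B (σ i) (σ j) = edge B' i j) : Rep G m B' fun i => f (σ i) :=
  ⟨fun i hi j hj hij => hf.inj _ (h i hi) _ (h j hj) fun h' => hij (hinj i hi j hj h'),
    fun i hi j hj => by rw [← hB i hi j hj]; exact hf.adj _ (h i hi) _ (h j hj)⟩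

theorem Clq.singleton (x : V) : Clq G {x} := fun u hu w hw huw => by
  rw [Finset.mem_singleton] at hu hw
  exact absurd (hu.trans hw.symm) huw

end AdjSet

theorem Clq.card_add_add_le {V : Type*} {G : SimpleGraph V} [Finite V] {K K' K'' : Finset V}
    (h : Clq G K) (h' : Clq G K') (h'' : Clq G K'') (h01 : ∀ u ∈ K, ∀ w ∈ K', G.Adj u w)
    (h02 : ∀ u ∈ K, ∀ w ∈ K'', G.Adj u w) (h12 : ∀ u ∈ K', ∀ w ∈ K'', G.Adj u w) :
    K.card + K'.card + K''.card ≤ G.cliqueNum := by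
  classical
  rw [← Finset.card_union_of_disjoint
    (Finset.disjoint_left.2 fun u hu hu' => G.irrefl (h01 u hu u hu'))]
  refine Clq.card_add_le (fun u hu w hw huw => ?_) h'' fun u hu w hw => ?_
  · rcases Finset.mem_union.1 hu with hu | hu <;> rcases Finset.mem_union.1 hw with hw | hw
    · exact h u hu w hw huw
    · exact h01 u hu w hw
    · exact (h01 w hw u hu).symm
    · exact h' u hu w hw huw
  · rcases Finset.mem_union.1 hu with hu | hu
    · exact h02 u hu w hw
    · exact h12 u hu w hw

theorem Typed.ne {V : Type*} {G : SimpleGraph V} {n B : ℕ} {L : List ℕ} {f : ℕ → V}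
    (hT : Typed G n B L f) (p q : ℕ → Bool) (h : (L.all fun t => !(p t && q t)) = true) {u w : V}
    (hu : p (tau G n f u) = true) (hw : q (tau G n f w) = true) : u ≠ w := by
  rintro rfl
  have := hT.single _ h u
  simp [hu, hw] at this

section Three

variable {V : Type*} {G : SimpleGraph V} {f : ℕ → V}

/-- The cycle `0, …, 4` with vertices of kinds `0`, `2` and `3`. -/
def baseThree : ℕ := 477702561407253875492843919415509042

/-- The admissible types of vertices. -/
def typesThree : List ℕ :=
  [0, 51, 204, 205, 206, 220, 236, 237, 256, 257, 258, 259, 260, 261, 262, 263]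

theorem typed_three (h1 : IsFreeOf G graphP2P3) (h2 : IsFreeOf G graphGem)
    (hf : Rep G 8 baseThree f) (hY1 : NoY G f 0 1 2 3 4) (hY4 : NoY G f 3 4 0 1 2) :
    Typed G 8 baseThree typesThree f := by
  refine Typed.of_masks h1 h2 hf (fun m => notY 0 1 2 3 4 m && notY 3 4 0 1 2 m) (fun u _ => ?_)
    ?_ ?_
  · rw [Bool.and_eq_true]
    exact ⟨hY1.notY (by norm_num) (by norm_num) (by norm_num) (by norm_num) (by norm_num) u,
      hY4.notY (by norm_num) (by norm_num) (by norm_num) (by norm_num) (by norm_num) u⟩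
  · decide +kernel
  · decide +kernel

theorem Typed.three_stable (hT : Typed G 8 baseThree typesThree f) (hY1 : NoY G f 0 1 2 3 4)
    (hY4 : NoY G f 3 4 0 1 2) {q u w : V}
    (hq : among [51, 256, 261] (tau G 8 f q) = true) (hu : among [205, 237] (tau G 8 f u) = true)
    (hw : among [205, 237] (tau G 8 f w) = true) (hqu : ¬ G.Adj u q) : ¬ G.Adj u w := by
  have hu0 := hT.adj_base (i := 0) (by norm_num) (by decide +kernel) hu
  have hw0 := hT.adj_base (i := 0) (by norm_num) (by decide +kernel) hw
  have hq0 : among [51, 261] (tau G 8 f q) = true := by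
    rcases hT.rep.tau_cases q with ⟨i, hi, rfl, ht⟩ | ⟨-, ht, hlt⟩
    · interval_cases i <;> rw [ht] at hq ⊢ <;> first | rfl | exact absurd hu0 hqu | cases hq
    · rw [among_iff] at hq ⊢
      simp at hq ⊢
      omega
  have h5 : ∀ j < 8, j ≠ 5 → (G.Adj q (f j) ↔ G.Adj (f 5) (f j)) := by
    intro j hj hj5
    rw [← hT.rep.nbr_iff hj, ← hT.rep.nbr_iff hj, hT.rep.tau_base (by norm_num : 5 < 8)]
    rw [among_iff] at hq0
    simp only [List.mem_cons, List.not_mem_nil, or_false] at hq0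
    rcases hq0 with h | h <;> rw [h] <;> interval_cases j <;> first | decide | exact absurd rfl hj5
  have hrep := hT.rep.update (i := 5) (by norm_num) h5 (by
    intro j hj hj5 h
    rw [h, hT.rep.tau_base hj] at hq0
    interval_cases j <;> first | exact hj5 rfl | revert hq0; decide)
  have hT' := typed_three hT.free1 hT.free2 hrep
    (hY1.update (by norm_num) (by norm_num) (by norm_num) (by norm_num) (by norm_num))
    (hY4.update (by norm_num) (by norm_num) (by norm_num) (by norm_num) (by norm_num))
  have hu2 := hT.adj_base (i := 2) (by norm_num) (by decide +kernel) hu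
  have hw2 := hT.adj_base (i := 2) (by norm_num) (by decide +kernel) hw
  have hu3 := hT.adj_base (i := 3) (by norm_num) (by decide +kernel) hu
  have hw3 := hT.adj_base (i := 3) (by norm_num) (by decide +kernel) hw
  refine hT'.nonadj (sel 8 baseThree [0, 2, 3] [5]) (sel 8 baseThree [0, 2, 3] [])
    (by decide +kernel) ?_ ?_
  · rw [hrep.sel_iff (by decide) (by decide)]
    simp [Function.update_apply, *]
  · rw [hrep.sel_iff (by decide) (by decide)]
    simp [Function.update_apply, *]

set_option maxHeartbeats 1000000 in
theorem Typed.three_bound [Fintype V] (hT : Typed G 8 baseThree typesThree f)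
    (hY1 : NoY G f 0 1 2 3 4) (hY4 : NoY G f 3 4 0 1 2) :
    G.chromaticNumber ≤ (G.cliqueNum + 1 : ℕ) := by
  classical
  set Q := cls G 8 f (among [51, 256, 261]) with hQ
  set R := cls G 8 f (among [206, 258, 262, 220, 259, 263]) with hR
  set W := cls G 8 f (among [205, 237]) with hW
  set X := cls G 8 f (among [257, 260]) with hX
  set A := cls G 8 f (among [204, 236]) with hA
  set T := cls G 8 f (among [0]) with hT0
  have hcover : ∀ u, u ∈ Q ∨ u ∈ R ∨ u ∈ W ∨ u ∈ X ∨ u ∈ A ∨ u ∈ T := by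
    intro u
    simp only [hQ, hR, hW, hX, hA, hT0, mem_cls, ← Bool.or_eq_true]
    exact hT.single (fun t => (among [51, 256, 261] t || (among [206, 258, 262, 220, 259, 263] t ||
      (among [205, 237] t || (among [257, 260] t || (among [204, 236] t || among [0] t))))))
      (by decide) u
  have cQ : Clq G Q := fun u hu w hw huw =>
    hT.adj _ _ (by decide +kernel) huw (mem_cls.1 hu) (mem_cls.1 hw)
  have cR : Clq G R := fun u hu w hw huw =>
    hT.adj _ _ (by decide +kernel) huw (mem_cls.1 hu) (mem_cls.1 hw)
  have nQR : ∀ u ∈ Q, ∀ w ∈ R, ¬ G.Adj u w := fun u hu w hw =>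
    hT.nonadj _ _ (by decide +kernel) (mem_cls.1 hu) (mem_cls.1 hw)
  have nX : ∀ u ∈ X, ∀ w ∈ X, ¬ G.Adj u w := fun u hu w hw =>
    hT.nonadj _ _ (by decide +kernel) (mem_cls.1 hu) (mem_cls.1 hw)
  have nWX : ∀ u ∈ W, ∀ w ∈ X, ¬ G.Adj u w := fun u hu w hw =>
    hT.nonadj _ _ (by decide +kernel) (mem_cls.1 hu) (mem_cls.1 hw)
  have nAT : ∀ u ∈ A ∪ T, ∀ w ∈ A ∪ T, ¬ G.Adj u w := by
    intro u hu w hw huw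
    rcases Finset.mem_union.1 hu with hu | hu <;> rcases Finset.mem_union.1 hw with hw | hw
    · exact hT.excl (among [204, 236]) (among [204, 236]) (by decide +kernel) huw.ne
        (mem_cls.1 hu) (mem_cls.1 hw)
    · exact hT.nonadj _ _ (by decide +kernel) (mem_cls.1 hu) (mem_cls.1 hw) huw
    · exact hT.nonadj _ _ (by decide +kernel) (mem_cls.1 hu) (mem_cls.1 hw) huw
    · exact hT.nonadj _ _ (by decide +kernel) (mem_cls.1 hu) (mem_cls.1 hw) huw
  have aWR : ∀ u ∈ W, ∀ w ∈ R, G.Adj u w := fun u hu w hw => by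
    refine hT.adj (among [205, 237]) (among [206, 258, 262, 220, 259, 263]) (by decide +kernel) ?_
      (mem_cls.1 hu) (mem_cls.1 hw)
    rintro rfl
    have h1 := mem_cls.1 hu
    have h2 := mem_cls.1 hw
    rw [among_iff] at h1 h2
    simp at h1 h2
    omega
  set F := W.filter fun u => ∀ q ∈ Q, G.Adj u q with hF
  set D := W.filter fun u => ¬ ∀ q ∈ Q, G.Adj u q with hD
  have nD : ∀ u ∈ D, ∀ w ∈ W, ¬ G.Adj u w := by
    intro u hu w hw
    obtain ⟨huW, hu'⟩ := Finset.mem_filter.1 hu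
    push Not at hu'
    obtain ⟨q, hq, hqu⟩ := hu'
    exact hT.three_stable hY1 hY4 (mem_cls.1 hq) (mem_cls.1 huW) (mem_cls.1 hw) hqu
  have nDX : ∀ u ∈ D ∪ X, ∀ w ∈ D ∪ X, ¬ G.Adj u w := by
    intro u hu w hw
    rcases Finset.mem_union.1 hu with hu | hu <;> rcases Finset.mem_union.1 hw with hw | hw
    · exact nD u hu w (Finset.mem_filter.1 hw).1
    · exact nWX u (Finset.mem_filter.1 hu).1 w hw
    · exact fun h => nWX w (Finset.mem_filter.1 hw).1 u hu h.symm
    · exact nX u hu w hw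
  have hFD : ∀ u ∈ W, u ∈ F ∨ u ∈ D := by
    intro u hu
    by_cases h : ∀ q ∈ Q, G.Adj u q
    · exact Or.inl (Finset.mem_filter.2 ⟨hu, h⟩)
    · exact Or.inr (Finset.mem_filter.2 ⟨hu, h⟩)
  obtain ⟨K, hK, hKc, hKmax⟩ := exists_max_clq G F
  have hQa := cQ.card_add_le hKc fun u hu w hw => ((Finset.mem_filter.1 (hK hw)).2 u hu).symm
  have hRa := cR.card_add_le hKc
    fun u hu w hw => (aWR w (Finset.mem_filter.1 (hK hw)).1 u hu).symm
  rcases Nat.eq_zero_or_pos K.card with h0 | h0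
  · have hF0 : ∀ u, u ∉ F := by
      intro u hu
      have := hKmax {u} (Finset.singleton_subset_iff.2 hu) (fun x hx y hy hxy => by
        rw [Finset.mem_singleton] at hx hy; exact absurd (hx.trans hy.symm) hxy)
      rw [Finset.card_singleton] at this
      omega
    have hQ1 : Q.card + 1 ≤ G.cliqueNum := by
      have := cQ.card_add_le (K' := {f 1}) (fun x hx y hy hxy => by
        rw [Finset.mem_singleton] at hx hy; exact absurd (hx.trans hy.symm) hxy) (by
        intro u hu w hw
        rw [Finset.mem_singleton] at hw
        subst hw
        exact hT.adj_base (by norm_num) (by decide +kernel) (mem_cls.1 hu))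
      simpa using this
    have hQ0 : 1 ≤ Q.card := Finset.card_pos.2 ⟨f 0, mem_cls.2
      (hT.base_mem (by norm_num) (by decide))⟩
    have cRA : Clq G (R ∪ A) := by
      intro u hu w hw huw
      rcases Finset.mem_union.1 hu with hu | hu <;> rcases Finset.mem_union.1 hw with hw | hw
      · exact cR u hu w hw huw
      · exact hT.adj _ _ (by decide +kernel) huw (mem_cls.1 hu) (mem_cls.1 hw)
      · exact hT.adj _ _ (by decide +kernel) huw (mem_cls.1 hu) (mem_cls.1 hw)
      · exact hT.adj _ _ (by decide +kernel) huw (mem_cls.1 hu) (mem_cls.1 hw)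
    have hsA : ∀ u ∈ A, ∀ w ∈ A, u = w := by
      intro u hu w hw
      by_contra huw
      exact hT.excl (among [204, 236]) (among [204, 236]) (by decide +kernel) huw
        (mem_cls.1 hu) (mem_cls.1 hw)
    obtain ⟨c, hc, hcA⟩ : ∃ c, Colours G (R ∪ A) G.cliqueNum c ∧
        ∀ u ∈ A, c u = G.cliqueNum - 1 := by
      obtain ⟨c, hc⟩ := cRA.exists_colours cRA.card_le
      rcases A.eq_empty_or_nonempty with hA' | ⟨b, hb⟩
      · exact ⟨c, hc, fun u hu => by simp [hA'] at hu⟩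
      · obtain ⟨c', hc', hb'⟩ := hc.exists_eq (Finset.mem_union_right _ hb)
          (by omega : G.cliqueNum - 1 < G.cliqueNum)
        exact ⟨c', hc', fun u hu => by rw [hsA u hu b hb, hb']⟩
    have nT : ∀ u ∈ T, ∀ w ∈ T, ¬ G.Adj u w := fun u hu w hw =>
      nAT u (Finset.mem_union_right _ hu) w (Finset.mem_union_right _ hw)
    obtain ⟨c', hc'⟩ : Col G (Q ∪ T) (G.cliqueNum - 1) := by
      refine Col.par (cQ.col.mono (Finset.Subset.refl _) (by omega))
        ((col_of_stable nT).mono (Finset.Subset.refl _) (by omega)) fun u hu w hw => ?_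
      exact hT.nonadj _ _ (by decide +kernel) (mem_cls.1 hu) (mem_cls.1 hw)
    have hglue := hc.glue (hc'.mono (Finset.Subset.refl _) (Nat.sub_le _ 1)) (by
      intro u hu w hw _ huw
      rcases Finset.mem_union.1 hu with hu | hu
      · rcases Finset.mem_union.1 hw with hw | hw
        · exact absurd huw.symm (nQR w hw u hu)
        · exact absurd huw (hT.nonadj _ _ (by decide +kernel) (mem_cls.1 hu) (mem_cls.1 hw))
      · rw [hcA u hu]
        exact (hc'.1 w hw).ne')
    refine (Col.add ⟨_, hglue⟩ (col_of_stable nDX)).chromaticNumber_le fun u => ?_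
    simp only [Finset.mem_union]
    rcases hcover u with h | h | h | h | h | h
    · simp [h]
    · simp [h]
    · simp [(hFD u h).resolve_left (hF0 u)]
    · simp [h]
    · simp [h]
    · simp [h]
  · have hcol : Col G ((F ∪ (D ∪ X)) ∪ (Q ∪ R) ∪ (A ∪ T))
        (K.card + (G.cliqueNum - K.card) + 1) := by
      refine (Col.add (Col.par ?_ ((col_of_stable nDX).mono (Finset.Subset.refl _) h0) ?_)
        (Col.par ?_ ?_ nQR)).add (col_of_stable nAT)
      · refine P4Free.exists_colours _ (p4Free_of_nbr hT.free2 (z := f 0) fun u hu => ?_) hKmax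
        exact (hT.adj_base (by norm_num) (by decide +kernel)
          (mem_cls.1 (Finset.mem_filter.1 hu).1)).symm
      · intro u hu w hw
        rcases Finset.mem_union.1 hw with hw | hw
        · exact fun h => nD w hw u (Finset.mem_filter.1 hu).1 h.symm
        · exact nWX u (Finset.mem_filter.1 hu).1 w hw
      · exact cQ.col.mono (Finset.Subset.refl _) (by omega)
      · exact cR.col.mono (Finset.Subset.refl _) (by omega)
    have hle : G.cliqueNum + 1 = K.card + (G.cliqueNum - K.card) + 1 := by omega
    rw [hle]
    refine hcol.chromaticNumber_le fun u => ?_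
    simp only [Finset.mem_union]
    rcases hcover u with h | h | h | h | h | h
    · simp [h]
    · simp [h]
    · rcases hFD u h with h | h <;> simp [h]
    · simp [h]
    · simp [h]
    · simp [h]

end Three

section Two

variable {V : Type*} {G : SimpleGraph V} {f : ℕ → V}

/-- The cycle `0, …, 4` with vertices of kinds `0` and `2`. -/
def baseTwo : ℕ := 1109217245546613555501904232498

/-- The admissible types of vertices. -/
def typesTwo : List ℕ :=
  [0, 2, 37, 49, 51, 53, 69, 76, 77, 78, 97, 100, 101, 108, 109, 113, 117, 128, 129, 130, 131, 132,
    133, 134]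

/-- A base in which only the kinds `0` and `2` are present. -/
structure Two (G : SimpleGraph V) (f : ℕ → V) : Prop where
  typed : Typed G 7 baseTwo typesTwo f
  noY1 : NoY G f 0 1 2 3 4
  noY3 : NoY G f 2 3 4 0 1
  noY4 : NoY G f 3 4 0 1 2

namespace Two

theorem of_rep (h1 : IsFreeOf G graphP2P3) (h2 : IsFreeOf G graphGem) (hf : Rep G 7 baseTwo f)
    (hY1 : NoY G f 0 1 2 3 4) (hY3 : NoY G f 2 3 4 0 1) (hY4 : NoY G f 3 4 0 1 2) : Two G f := by
  refine ⟨Typed.of_masks h1 h2 hf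
    (fun m => notY 0 1 2 3 4 m && (notY 2 3 4 0 1 m && notY 3 4 0 1 2 m)) (fun u _ => ?_)
    ?_ ?_, hY1, hY3, hY4⟩
  · rw [Bool.and_eq_true, Bool.and_eq_true]
    exact ⟨hY1.notY (by norm_num) (by norm_num) (by norm_num) (by norm_num) (by norm_num) u,
      hY3.notY (by norm_num) (by norm_num) (by norm_num) (by norm_num) (by norm_num) u,
      hY4.notY (by norm_num) (by norm_num) (by norm_num) (by norm_num) (by norm_num) u⟩
  · decide +kernel
  · decide +kernel

/-- The reflection of the base. -/
def refl (i : ℕ) : ℕ := [2, 1, 0, 4, 3, 6, 5].getD i 0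

theorem reflect (h : Two G f) : Two G fun i => f (refl i) := by
  refine of_rep h.typed.free1 h.typed.free2 (h.typed.rep.comp ?_ ?_ ?_) ?_ ?_ ?_
  · decide
  · decide
  · decide +kernel
  · exact fun u ha hb hc => (h.noY1 u hc hb ha).symm
  · exact fun u ha hb hc => (h.noY4 u hc hb ha).symm
  · exact fun u ha hb hc => (h.noY3 u hc hb ha).symm

theorem nonadj_left (h : Two G f) {q u w : V} (hq1 : G.Adj q (f 1)) (hq4 : G.Adj q (f 4))
    (hu0 : G.Adj u (f 0)) (hu2 : G.Adj u (f 2)) (hw0 : G.Adj w (f 0)) (hw2 : G.Adj w (f 2))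
    (hqu : ¬ G.Adj u q) : ¬ G.Adj u w := by
  have hT := h.typed
  have hq : among [51, 128, 133] (tau G 7 f q) = true := by
    have h1 := (hT.rep.nbr_iff (by norm_num : 1 < 7)).2 hq1
    have h2 := (hT.rep.nbr_iff (by norm_num : 4 < 7)).2 hq4
    have := hT.single (fun t => !(nbr 7 baseTwo t 1) || !(nbr 7 baseTwo t 4) ||
      among [51, 128, 133] t) (by decide +kernel) q
    simpa [h1, h2] using this
  have hq0 : among [51, 133] (tau G 7 f q) = true := by
    rcases hT.rep.tau_cases q with ⟨i, hi, rfl, ht⟩ | ⟨-, ht, hlt⟩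
    · interval_cases i <;> rw [ht] at hq ⊢ <;>
        first | rfl | exact absurd hu0 hqu | cases hq
    · rw [among_iff] at hq ⊢
      simp at hq ⊢
      omega
  have h5 : ∀ j < 7, j ≠ 5 → (G.Adj q (f j) ↔ G.Adj (f 5) (f j)) := by
    intro j hj hj5
    rw [← hT.rep.nbr_iff hj, ← hT.rep.nbr_iff hj, hT.rep.tau_base (by norm_num : 5 < 7)]
    rw [among_iff] at hq0
    simp only [List.mem_cons, List.not_mem_nil, or_false] at hq0
    rcases hq0 with h | h <;> rw [h] <;> interval_cases j <;> first | decide | exact absurd rfl hj5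
  have hrep := hT.rep.update (i := 5) (by norm_num) h5 (by
    intro j hj hj5 h
    rw [h, hT.rep.tau_base hj] at hq0
    interval_cases j <;> first | exact hj5 rfl | revert hq0; decide)
  have hT' := (of_rep hT.free1 hT.free2 hrep
    (h.noY1.update (by norm_num) (by norm_num) (by norm_num) (by norm_num) (by norm_num))
    (h.noY3.update (by norm_num) (by norm_num) (by norm_num) (by norm_num) (by norm_num))
    (h.noY4.update (by norm_num) (by norm_num) (by norm_num) (by norm_num) (by norm_num))).typed
  refine hT'.nonadj (sel 7 baseTwo [0, 2] [5]) (sel 7 baseTwo [0, 2] [])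
    (by decide +kernel) ?_ ?_
  · rw [hrep.sel_iff (by decide) (by decide)]
    simp [Function.update_apply, *]
  · rw [hrep.sel_iff (by decide) (by decide)]
    simp [Function.update_apply, *]

theorem nonadj_right (h : Two G f) {q u w : V} (hq1 : G.Adj q (f 1)) (hq3 : G.Adj q (f 3))
    (hu0 : G.Adj u (f 0)) (hu2 : G.Adj u (f 2)) (hw0 : G.Adj w (f 0)) (hw2 : G.Adj w (f 2))
    (hqu : ¬ G.Adj u q) : ¬ G.Adj u w :=
  h.reflect.nonadj_left (f := fun i => f (refl i)) hq1 hq3 hu2 hu0 hw2 hw0 hqu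

/-- A nonempty clique of common neighbours of `f 0` and `f 2`, complete to the vertices of kinds
`0` and `2`. -/
structure Core (G : SimpleGraph V) (f : ℕ → V) (K : Finset V) : Prop where
  clq : Clq G K
  pos : 0 < K.card
  adj0 : ∀ u ∈ K, G.Adj u (f 0)
  adj2 : ∀ u ∈ K, G.Adj u (f 2)
  left : ∀ u ∈ K, ∀ q, G.Adj q (f 1) → G.Adj q (f 4) → G.Adj u q
  right : ∀ u ∈ K, ∀ q, G.Adj q (f 1) → G.Adj q (f 3) → G.Adj u q

theorem Core.reflect {K : Finset V} (h : Core G f K) : Core G (fun i => f (refl i)) K :=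
  ⟨h.clq, h.pos, h.adj2, h.adj0, h.right, h.left⟩

variable [Fintype V]

theorem mem_iff (h : Two G f) {pos neg : List ℕ} (hpos : ∀ i ∈ pos, i < 7)
    (hneg : ∀ i ∈ neg, i < 7) {u : V} :
    u ∈ adjSet G f pos neg ↔ sel 7 baseTwo pos neg (tau G 7 f u) = true :=
  h.typed.rep.mem_adjSet_iff hpos hneg

theorem clq_left (h : Two G f) : Clq G (adjSet G f [1, 4] []) := fun u hu w hw huw =>
  h.typed.adj _ _ (by decide +kernel) huw ((h.mem_iff (by decide) (by decide)).1 hu)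
    ((h.mem_iff (by decide) (by decide)).1 hw)

theorem exists_core (h : Two G f) : ∃ K, Core G f K ∧
    ∀ K' ⊆ adjSet G f [0, 2] [], Clq G K' → K'.card ≤ K.card := by
  obtain ⟨K, hK, hKc, hmax⟩ := exists_max_clq G (adjSet G f [0, 2] [])
  have hadj : ∀ u ∈ K, G.Adj u (f 0) ∧ G.Adj u (f 2) := by
    intro u hu
    simpa using (mem_adjSet.1 (hK hu)).1
  rcases Nat.lt_or_ge 1 K.card with h1 | h1
  · have key : ∀ u ∈ K, ∃ w ∈ K, G.Adj u w := by
      intro u hu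
      obtain ⟨w, hw, hne⟩ := Finset.exists_mem_ne h1 u
      exact ⟨w, hw, hKc u hu w hw hne.symm⟩
    refine ⟨K, ⟨hKc, by omega, fun u hu => (hadj u hu).1, fun u hu => (hadj u hu).2, ?_, ?_⟩, hmax⟩
    · intro u hu q hq1 hq4
      obtain ⟨w, hw, huw⟩ := key u hu
      by_contra hqu
      exact h.nonadj_left hq1 hq4 (hadj u hu).1 (hadj u hu).2 (hadj w hw).1 (hadj w hw).2 hqu huw
    · intro u hu q hq1 hq4
      obtain ⟨w, hw, huw⟩ := key u hu
      by_contra hqu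
      exact h.nonadj_right hq1 hq4 (hadj u hu).1 (hadj u hu).2 (hadj w hw).1 (hadj w hw).2 hqu huw
  · refine ⟨{f 1}, ⟨Clq.singleton _, by simp, ?_, ?_, ?_, ?_⟩, fun K' h' h'' => ?_⟩
    · simp only [Finset.mem_singleton, forall_eq]
      exact (h.typed.rep.adj 1 (by norm_num) 0 (by norm_num)).1 (by decide +kernel)
    · simp only [Finset.mem_singleton, forall_eq]
      exact (h.typed.rep.adj 1 (by norm_num) 2 (by norm_num)).1 (by decide +kernel)
    · simp only [Finset.mem_singleton, forall_eq]
      exact fun q hq _ => hq.symm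
    · simp only [Finset.mem_singleton, forall_eq]
      exact fun q hq _ => hq.symm
    · rw [Finset.card_singleton]
      exact (hmax K' h' h'').trans h1

theorem Core.card_add_le (h : Two G f) {K : Finset V} (hK : Core G f K) :
    K.card + (adjSet G f [1, 4] []).card ≤ G.cliqueNum :=
  hK.clq.card_add_le h.clq_left fun u hu q hq => by
    have := (mem_adjSet.1 hq).1
    simp at this
    exact hK.left u hu q this.1 this.2

/-- Cliques of vertices adjacent to `f 0`, `f 2` and `f 4`. -/
theorem card_lt_of_clq (h : Two G f) {K : Finset V} (hK : Clq G K)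
    (hK' : ∀ u ∈ K, G.Adj u (f 0) ∧ G.Adj u (f 2) ∧ G.Adj u (f 4)) :
    K.card + (adjSet G f [1, 4] []).card + 1 ≤ G.cliqueNum := by
  have hT := h.typed
  have h135 : ∀ u ∈ K, sel 7 baseTwo [0, 2, 4] [] (tau G 7 f u) = true := by
    intro u hu
    rw [hT.rep.sel_iff (by decide) (by decide)]
    simpa using hK' u hu
  have := hK.card_add_add_le h.clq_left (Clq.singleton (f 4)) (fun u hu w hw => ?_)
    (fun u hu w hw => ?_) (fun u hu w hw => ?_)
  · simpa using this
  · refine hT.adj _ (sel 7 baseTwo [1, 4] []) (by decide +kernel) ?_ (h135 u hu)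
      ((h.mem_iff (by decide) (by decide)).1 hw)
    exact hT.ne _ (sel 7 baseTwo [1, 4] []) (by decide +kernel) (h135 u hu)
      ((h.mem_iff (by decide) (by decide)).1 hw)
  · rw [Finset.mem_singleton] at hw
    rw [hw]
    exact (hK' u hu).2.2
  · rw [Finset.mem_singleton] at hw
    rw [hw]
    have := (mem_adjSet.1 hu).1
    simp at this
    exact this.2

theorem not_adj_of_card (h : Two G f) {K : Finset V} (hK : Core G f K)
    (hc : K.card + (adjSet G f [1, 4] []).card = G.cliqueNum) :
    ∀ u, G.Adj u (f 0) → G.Adj u (f 4) → G.Adj u (f 5) → ¬ G.Adj u (f 1) → G.Adj u (f 2) := by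
  intro z hz0 hz4 hz5 hz1
  by_contra hz2
  have hT := h.typed
  have hz : among [49, 113] (tau G 7 f z) = true := by
    have := (hT.rep.sel_iff (u := z) (pos := [0, 4, 5]) (neg := [1, 2]) (by decide)
      (by decide)).2 (by simp [*])
    have h' := hT.single (fun t => !(sel 7 baseTwo [0, 4, 5] [1, 2] t) || among [49, 113] t)
      (by decide +kernel) z
    simpa [this] using h'
  have hzQ : ∀ w ∈ adjSet G f [1, 4] [], G.Adj z w := fun w hw =>
    hT.adj _ _ (by decide +kernel) (hT.ne _ _ (by decide +kernel) hz
      ((h.mem_iff (by decide) (by decide)).1 hw)) hz ((h.mem_iff (by decide) (by decide)).1 hw)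
  have hQK : ∀ w ∈ adjSet G f [1, 4] [], ∀ u ∈ K, G.Adj w u := fun w hw u hu => by
    have := (mem_adjSet.1 hw).1
    simp at this
    exact (hK.left u hu w this.1 this.2).symm
  have h4 : ∀ u ∈ K, ¬ G.Adj u (f 4) := by
    intro u hu h4
    have hall : ∀ w ∈ K, G.Adj w (f 4) := by
      intro w hw
      by_contra hw4
      have hne : u ≠ w := by rintro rfl; exact hw4 h4
      refine hT.nonadj (sel 7 baseTwo [0, 2, 4] []) (sel 7 baseTwo [0, 2] [4]) (by decide +kernel)
        ?_ ?_ (hK.clq u hu w hw hne)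
      · rw [hT.rep.sel_iff (by decide) (by decide)]
        simp [h4, hK.adj0 u hu, hK.adj2 u hu]
      · rw [hT.rep.sel_iff (by decide) (by decide)]
        simp [hw4, hK.adj0 w hw, hK.adj2 w hw]
    have := h.card_lt_of_clq hK.clq fun w hw => ⟨hK.adj0 w hw, hK.adj2 w hw, hall w hw⟩
    omega
  rcases Nat.lt_or_ge 1 K.card with h1 | h1
  · have hKz : ∀ u ∈ K, G.Adj u z := by
      intro u hu
      obtain ⟨w, hw, hne⟩ := Finset.exists_mem_ne h1 u
      have h5 := hK.left u hu (f 5)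
        ((hT.rep.adj 5 (by norm_num) 1 (by norm_num)).1 (by decide +kernel))
        ((hT.rep.adj 5 (by norm_num) 4 (by norm_num)).1 (by decide +kernel))
      have h6 := hK.right u hu (f 6)
        ((hT.rep.adj 6 (by norm_num) 1 (by norm_num)).1 (by decide +kernel))
        ((hT.rep.adj 6 (by norm_num) 3 (by norm_num)).1 (by decide +kernel))
      have hu' := (hT.rep.sel_iff (u := u) (pos := [0, 2, 5, 6]) (neg := [4]) (by decide)
        (by decide)).2 (by simp [h5, h6, h4 u hu, hK.adj0 u hu, hK.adj2 u hu])
      have hw' := (hT.rep.sel_iff (u := w) (pos := [0, 2]) (neg := []) (by decide)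
        (by decide)).2 (by simp [hK.adj0 w hw, hK.adj2 w hw])
      by_cases hu1 : among [129] (tau G 7 f u) = true
      · exact absurd (hK.clq u hu w hw hne.symm)
          (hT.nonadj (among [129]) (sel 7 baseTwo [0, 2] []) (by decide +kernel) hu1 hw')
      · have hu2 : among [101, 109] (tau G 7 f u) = true := by
          have := hT.single (fun t => !(sel 7 baseTwo [0, 2, 5, 6] [4] t) || among [129] t ||
            among [101, 109] t) (by decide +kernel) u
          simpa [hu', hu1] using this
        exact hT.adj _ _ (by decide +kernel) (hT.ne _ _ (by decide +kernel) hu2 hz) hu2 hz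
    have := h.clq_left.card_add_add_le hK.clq (Clq.singleton z) hQK
      (fun u hu w hw => by rw [Finset.mem_singleton.1 hw]; exact (hzQ u hu).symm)
      (fun u hu w hw => by rw [Finset.mem_singleton.1 hw]; exact hKz u hu)
    simp at this
    omega
  · have := h.clq_left.card_add_add_le (Clq.singleton z) (Clq.singleton (f 4))
      (fun u hu w hw => by rw [Finset.mem_singleton.1 hw]; exact (hzQ u hu).symm)
      (fun u hu w hw => by
        rw [Finset.mem_singleton.1 hw]
        exact (mem_adjSet.1 hu).1 4 (by simp))
      (fun u hu w hw => by
        rw [Finset.mem_singleton.1 hu, Finset.mem_singleton.1 hw]; exact hz4)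
    have hpos := hK.pos
    simp only [Finset.card_singleton] at this
    omega

theorem col_common (h : Two G f) {k : ℕ}
    (hmax : ∀ K' ⊆ adjSet G f [0, 2] [], Clq G K' → K'.card ≤ k) :
    Col G (adjSet G f [0, 2] []) k :=
  P4Free.exists_colours _ (p4Free_of_nbr h.typed.free2 (z := f 0) fun _ hu =>
    ((mem_adjSet.1 hu).1 0 (by simp)).symm) hmax

theorem clq_right (h : Two G f) : Clq G (adjSet G f [1, 3] []) := by
  have := h.reflect.clq_left
  rw [adjSet_comp] at this
  exact this

theorem nonadj_left_right (h : Two G f) : ∀ u ∈ adjSet G f [1, 4] [], ∀ w ∈ adjSet G f [1, 3] [],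
    ¬ G.Adj u w := fun u hu w hw =>
  h.typed.nonadj _ _ (by decide +kernel) ((h.mem_iff (by decide) (by decide)).1 hu)
    ((h.mem_iff (by decide) (by decide)).1 hw)

theorem stable_spare (h : Two G f) : ∀ u ∈ cls G 7 f (among [131, 0, 97, 100, 2, 49, 113]),
    ∀ w ∈ cls G 7 f (among [131, 0, 97, 100, 2, 49, 113]), ¬ G.Adj u w := fun u hu w hw =>
  h.typed.nonadj _ _ (by decide +kernel) (mem_cls.1 hu) (mem_cls.1 hw)

theorem cover (h : Two G f) (u : V) : u ∈ adjSet G f [0, 2] [] ∨ u ∈ adjSet G f [1, 4] [] ∨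
    u ∈ adjSet G f [1, 3] [] ∨ u ∈ cls G 7 f (among [131, 0, 97, 100, 2, 49, 113]) ∨
    u = f 4 ∨ u ∈ cls G 7 f (among [76, 108]) := by
  rw [h.mem_iff (by decide) (by decide), h.mem_iff (by decide) (by decide),
    h.mem_iff (by decide) (by decide), mem_cls, mem_cls]
  have := h.typed.single (fun t => sel 7 baseTwo [0, 2] [] t || sel 7 baseTwo [1, 4] [] t ||
    sel 7 baseTwo [1, 3] [] t || among [131, 0, 97, 100, 2, 49, 113] t || among [132] t ||
    among [76, 108] t) (by decide +kernel) u
  simp only [Bool.or_eq_true] at this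
  rcases this with ((((h' | h') | h') | h') | h') | h'
  · exact Or.inl h'
  · exact Or.inr (Or.inl h')
  · exact Or.inr (Or.inr (Or.inl h'))
  · exact Or.inr (Or.inr (Or.inr (Or.inl h')))
  · have := among_iff.1 h'
    rw [List.mem_singleton] at this
    exact Or.inr (Or.inr (Or.inr (Or.inr (Or.inl
      (h.typed.rep.eq_of_tau (by norm_num : 4 < 7) this)))))
  · exact Or.inr (Or.inr (Or.inr (Or.inr (Or.inr h'))))

theorem bound_of_lt (h : Two G f) {K : Finset V}
    (hmax : ∀ K' ⊆ adjSet G f [0, 2] [], Clq G K' → K'.card ≤ K.card)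
    (hl : K.card + (adjSet G f [1, 4] []).card < G.cliqueNum)
    (hr : K.card + (adjSet G f [1, 3] []).card < G.cliqueNum) :
    G.chromaticNumber ≤ (G.cliqueNum + 1 : ℕ) := by
  classical
  have nP : ∀ u ∈ cls G 7 f (among [132, 76, 108]), ∀ w ∈ cls G 7 f (among [132, 76, 108]),
      ¬ G.Adj u w := fun u hu w hw =>
    h.typed.nonadj _ _ (by decide +kernel) (mem_cls.1 hu) (mem_cls.1 hw)
  have hcol := (((h.col_common hmax).add (Col.par
    (h.clq_left.col.mono (l := G.cliqueNum - K.card - 1) (Finset.Subset.refl _) (by omega))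
    (h.clq_right.col.mono (Finset.Subset.refl _) (by omega)) h.nonadj_left_right)).add
    (col_of_stable h.stable_spare)).add (col_of_stable nP)
  have hle : G.cliqueNum + 1 = K.card + (G.cliqueNum - K.card - 1) + 1 + 1 := by omega
  rw [hle]
  refine hcol.chromaticNumber_le fun u => ?_
  simp only [Finset.mem_union]
  rcases h.cover u with h' | h' | h' | h' | h' | h'
  · simp [h']
  · simp [h']
  · simp [h']
  · simp [h']
  · refine Or.inr (mem_cls.2 ?_)
    rw [h']
    exact h.typed.base_mem (by norm_num) (by decide)
  · refine Or.inr (mem_cls.2 ?_)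
    rw [mem_cls, among_iff] at h'
    rw [among_iff]
    exact List.mem_cons_of_mem _ h'

theorem bound_of_eq (h : Two G f) {K : Finset V} (hK : Core G f K)
    (hmax : ∀ K' ⊆ adjSet G f [0, 2] [], Clq G K' → K'.card ≤ K.card)
    (hl : K.card + (adjSet G f [1, 4] []).card = G.cliqueNum)
    (hr : (adjSet G f [1, 3] []).card ≤ (adjSet G f [1, 4] []).card) :
    G.chromaticNumber ≤ (G.cliqueNum + 1 : ℕ) := by
  classical
  have hT := h.typed
  have hpos := hK.pos
  obtain ⟨c0, hc0⟩ : Col G (adjSet G f [0, 2, 4] []) (K.card - 1) := by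
    refine P4Free.exists_colours _ (p4Free_of_nbr hT.free2 (z := f 0) fun _ hu =>
      ((mem_adjSet.1 hu).1 0 (by simp)).symm) fun K' hK' hc => ?_
    have := h.card_lt_of_clq hc fun u hu => by
      have := (mem_adjSet.1 (hK' hu)).1
      simpa using this
    omega
  obtain ⟨c1, hc1⟩ : Col G (adjSet G f [0, 2] [4]) K.card := by
    refine (h.col_common hmax).mono (fun u hu => ?_) le_rfl
    rw [mem_adjSet] at hu ⊢
    exact ⟨hu.1, by simp⟩
  have hc2 : Colours G {f 4} K.card fun _ => K.card - 1 :=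
    ⟨fun _ _ => Nat.sub_lt hpos Nat.one_pos, fun u hu w hw huw =>
      absurd ((Finset.mem_singleton.1 hu).trans (Finset.mem_singleton.1 hw).symm) huw.ne⟩
  have hW : Col G (adjSet G f [0, 2, 4] [] ∪ ({f 4} ∪ adjSet G f [0, 2] [4])) K.card := by
    refine ⟨_, (hc0.mono (Finset.Subset.refl _) (Nat.sub_le _ 1)).glue (hc2.glue hc1 ?_) ?_⟩
    · intro u hu w hw _ huw
      rw [Finset.mem_singleton.1 hu] at huw
      exact absurd huw.symm ((mem_adjSet.1 hw).2 4 (by simp))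
    · intro u hu w hw _ huw
      by_cases hw4 : w = f 4
      · have := hc0.1 u hu
        simp only [hw4, Finset.mem_singleton, if_true]
        omega
      · have hw' := (Finset.mem_union.1 hw).resolve_left fun h' => hw4 (Finset.mem_singleton.1 h')
        exact absurd huw (hT.nonadj _ _ (by decide +kernel)
          ((h.mem_iff (by decide) (by decide)).1 hu) ((h.mem_iff (by decide) (by decide)).1 hw'))
  have hf0 : f 0 ∈ adjSet G f [1, 4] [] := (h.mem_iff (by decide) (by decide)).2 (by
    rw [hT.rep.tau_base (by norm_num : 0 < 7)]
    decide +kernel)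
  obtain ⟨c3, hc3, h30⟩ := h.clq_left.exists_colours_eq le_rfl hf0 (Finset.card_pos.2 ⟨_, hf0⟩)
  set Z := cls G 7 f (among [76, 108]) with hZ
  have hsZ : ∀ u ∈ Z, ∀ w ∈ Z, u = w := by
    intro u hu w hw
    by_contra huw
    exact hT.excl (among [76, 108]) (among [76, 108]) (by decide +kernel) huw
      (mem_cls.1 hu) (mem_cls.1 hw)
  have cRZ : Clq G (adjSet G f [1, 3] [] ∪ Z) := by
    intro u hu w hw huw
    rcases Finset.mem_union.1 hu with hu | hu <;> rcases Finset.mem_union.1 hw with hw | hw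
    · exact h.clq_right u hu w hw huw
    · exact hT.adj _ _ (by decide +kernel) huw ((h.mem_iff (by decide) (by decide)).1 hu)
        (mem_cls.1 hw)
    · exact hT.adj _ _ (by decide +kernel) huw (mem_cls.1 hu)
        ((h.mem_iff (by decide) (by decide)).1 hw)
    · exact absurd (hsZ u hu w hw) huw
  obtain ⟨c4, hc4, h40⟩ : ∃ c, Colours G (adjSet G f [1, 3] [] ∪ Z)
      (adjSet G f [1, 4] []).card c ∧ ∀ u ∈ Z, c u = 0 := by
    rcases Z.eq_empty_or_nonempty with hZ' | ⟨z, hz⟩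
    · obtain ⟨c, hc⟩ := cRZ.exists_colours (k := (adjSet G f [1, 4] []).card)
        (by rw [hZ', Finset.union_empty]; exact hr)
      exact ⟨c, hc, fun u hu => by simp [hZ'] at hu⟩
    · have hlt : (adjSet G f [1, 3] []).card < (adjSet G f [1, 4] []).card := by
        refine lt_of_le_of_ne hr fun heq => ?_
        have hz' := mem_cls.1 hz
        have h3 := h.reflect.not_adj_of_card hK.reflect (by
          rw [adjSet_comp]
          change K.card + (adjSet G f [1, 3] []).card = _
          omega) z (hT.adj_base (i := 2) (by norm_num) (by decide +kernel) hz')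
          (hT.adj_base (i := 3) (by norm_num) (by decide +kernel) hz')
          (hT.adj_base (i := 6) (by norm_num) (by decide +kernel) hz')
          (hT.nonadj_base (i := 1) (by norm_num) (by decide +kernel) hz')
        exact hT.nonadj_base (i := 0) (by norm_num) (by decide +kernel) hz' h3
      have hZ1 : Z.card ≤ 1 := Finset.card_le_one.2 fun u hu w hw => hsZ u hu w hw
      obtain ⟨c, hc, hcz⟩ := cRZ.exists_colours_eq (k := (adjSet G f [1, 4] []).card)
        ((Finset.card_union_le _ _).trans (by omega)) (Finset.mem_union_right _ hz)
        (j := 0) (by omega)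
      exact ⟨c, hc, fun u hu => by rw [hsZ u hu z hz, hcz]⟩
  have hQR := hc3.glue hc4 (by
    intro u hu w hw _ huw
    rcases Finset.mem_union.1 hw with hw | hw
    · exact absurd huw (h.nonadj_left_right u hu w hw)
    · rw [h40 w hw, ← h30]
      refine hc3.2 u hu _ hf0 (h.clq_left u hu _ hf0 ?_)
      rintro rfl
      exact hT.nonadj_base (i := 0) (by norm_num) (by decide +kernel) (mem_cls.1 hw) huw.symm)
  rw [← hl]
  refine ((hW.add ⟨_, hQR⟩).add (col_of_stable h.stable_spare)).chromaticNumber_le fun u => ?_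
  simp only [Finset.mem_union]
  rcases h.cover u with h' | h' | h' | h' | h' | h'
  · by_cases h4 : G.Adj u (f 4)
    · refine Or.inl (Or.inl (Or.inl (mem_adjSet.2 ?_)))
      simpa [mem_adjSet, h4] using h'
    · refine Or.inl (Or.inl (Or.inr (Or.inr (mem_adjSet.2 ?_))))
      simpa [mem_adjSet, h4] using h'
  · simp [h']
  · simp [h']
  · simp [h']
  · simp [h']
  · simp [h', hZ]

theorem bound (h : Two G f) : G.chromaticNumber ≤ (G.cliqueNum + 1 : ℕ) := by
  obtain ⟨K, hK, hmax⟩ := h.exists_core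
  have hl := Core.card_add_le h hK
  have hr := Core.card_add_le h.reflect hK.reflect
  have hmax' : ∀ K' ⊆ adjSet G (fun i => f (refl i)) [0, 2] [], Clq G K' →
      K'.card ≤ K.card := by
    refine fun K' hK' => hmax K' (hK'.trans fun u hu => ?_)
    rw [adjSet_comp, mem_adjSet] at hu
    rw [mem_adjSet]
    simpa [refl, and_comm] using hu
  have e1 : adjSet G (fun i => f (refl i)) [1, 4] [] = adjSet G f [1, 3] [] := adjSet_comp _ _ _
  have e2 : adjSet G (fun i => f (refl i)) [1, 3] [] = adjSet G f [1, 4] [] := adjSet_comp _ _ _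
  rw [e1] at hr
  by_cases h1 : K.card + (adjSet G f [1, 4] []).card < G.cliqueNum ∧
      K.card + (adjSet G f [1, 3] []).card < G.cliqueNum
  · exact h.bound_of_lt hmax h1.1 h1.2
  · rcases le_total (adjSet G f [1, 3] []).card (adjSet G f [1, 4] []).card with h2 | h2
    · exact h.bound_of_eq hK hmax (by omega) h2
    · exact h.reflect.bound_of_eq hK.reflect hmax' (by rw [e1]; omega) (by rw [e1, e2]; exact h2)

end Two

end Two

theorem inClassC_of_classes {V : Type*} [Fintype V] {G : SimpleGraph V} (k : V → ℕ)
    (hk : ∀ u, k u ≤ 5) (hne : ∀ i < 5, ∃ u, k u = i)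
    (hadj : ∀ u w, u ≠ w → (G.Adj u w ↔ k u < 5 ∧ k w < 5 ∧
      (k u = k w ∨ k w = (k u + 1) % 5 ∨ k u = (k w + 1) % 5))) : InClassC G := by
  classical
  let e1 : ∀ i : Fin 5, {u : V // k u = i} ≃ Fin (Fintype.card {u : V // k u = i}) :=
    fun i => Fintype.equivFin _
  let e2 : {u : V // k u = 5} ≃ Fin (Fintype.card {u : V // k u = 5}) := Fintype.equivFin _
  let φ : V → (Σ i : Fin 5, Fin (Fintype.card {u : V // k u = i})) ⊕
      Fin (Fintype.card {u : V // k u = 5}) := fun u =>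
    if h : k u < 5 then Sum.inl ⟨⟨k u, h⟩, e1 ⟨k u, h⟩ ⟨u, rfl⟩⟩
    else Sum.inr (e2 ⟨u, le_antisymm (hk u) (not_lt.1 h)⟩)
  let ψ : (Σ i : Fin 5, Fin (Fintype.card {u : V // k u = i})) ⊕
      Fin (Fintype.card {u : V // k u = 5}) → V :=
    Sum.elim (fun a => ((e1 a.1).symm a.2).1) fun b => (e2.symm b).1
  have hφψ : Function.LeftInverse ψ φ := by
    intro u
    by_cases h : k u < 5 <;> simp [φ, ψ, h]
  have hφ1 : ∀ u (h : k u < 5), ∃ a, φ u = Sum.inl a ∧ a.1 = ⟨k u, h⟩ := fun u h =>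
    ⟨_, dif_pos h, rfl⟩
  have hφ2 : ∀ u, ¬ k u < 5 → ∃ b, φ u = Sum.inr b := fun u h =>
    ⟨_, dif_neg h⟩
  have hψφ : Function.RightInverse ψ φ := by
    have hinj : Function.Injective ψ := by
      rintro (⟨i, a⟩ | a) (⟨j, b⟩ | b) h
      · have h' : ((e1 i).symm a).1 = ((e1 j).symm b).1 := h
        have hij : i = j := by
          have hi := ((e1 i).symm a).2
          rw [h', ((e1 j).symm b).2] at hi
          exact Fin.ext hi.symm
        subst hij
        rw [(e1 i).symm.injective (Subtype.ext h')]
      · have h' : ((e1 i).symm a).1 = (e2.symm b).1 := h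
        have hi := ((e1 i).symm a).2
        rw [h', (e2.symm b).2] at hi
        have := i.2
        omega
      · have h' : (e2.symm a).1 = ((e1 j).symm b).1 := h
        have hj := ((e1 j).symm b).2
        rw [← h', (e2.symm a).2] at hj
        have := j.2
        omega
      · have h' : (e2.symm a).1 = (e2.symm b).1 := h
        rw [e2.symm.injective (Subtype.ext h')]
    intro x
    exact hinj (hφψ _)
  refine ⟨fun i => Fintype.card {u : V // k u = i}, Fintype.card {u : V // k u = 5}, fun i => ?_,
    ⟨⟨⟨φ, ψ, hφψ, hψφ⟩, ?_⟩⟩⟩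
  · obtain ⟨u, hu⟩ := hne i i.2
    exact Fintype.card_pos_iff.2 ⟨⟨u, hu⟩⟩
  · intro u w
    change (blowupC5 _ _).Adj (φ u) (φ w) ↔ _
    by_cases huw : u = w
    · subst huw; simp
    · have hne' : φ u ≠ φ w := fun h => huw (hφψ.injective h)
      rw [hadj u w huw, blowupC5, SimpleGraph.fromRel_adj]
      by_cases hu : k u < 5
      · by_cases hw : k w < 5
        · obtain ⟨a, ha, ha'⟩ := hφ1 u hu
          obtain ⟨b, hb, hb'⟩ := hφ1 w hw
          have key : ∀ x y : Fin 5, y = x + 1 ↔ (y : ℕ) = ((x : ℕ) + 1) % 5 := by decide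
          rw [ha, hb] at hne' ⊢
          simp only [Sum.inl.injEq, exists_and_left, exists_eq_left', hne', hu, hw, ne_eq,
            not_false_iff, true_and, ha', hb', key, Fin.ext_iff, Fin.val_mk]
          constructor
          · rintro ((h | h) | (h | h))
            · exact Or.inl h
            · exact Or.inr (Or.inl h)
            · exact Or.inl h.symm
            · exact Or.inr (Or.inr h)
          · rintro (h | h | h)
            · exact Or.inl (Or.inl h)
            · exact Or.inl (Or.inr h)
            · exact Or.inr (Or.inr h)
        · obtain ⟨b, hb⟩ := hφ2 w hw
          simp [hb, hw]
      · obtain ⟨a, ha⟩ := hφ2 u hu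
        simp [ha, hu]

section Four

variable {V : Type*} {G : SimpleGraph V} {f : ℕ → V}

/-- The cycle `0, …, 4` with vertices of kinds `0`, `1`, `2` and `3`. -/
def baseFour : ℕ := 53085783480048354418918337045222578782322

/-- The admissible types of vertices. -/
def typesFour : List ℕ :=
  [0, 115, 231, 313, 412, 462, 512, 513, 514, 515, 516, 517, 518, 519, 520]

/-- The class of the blowup, or `5` for isolated vertices, of a vertex of type `t`. -/
def kind (t : ℕ) : ℕ :=
  bif among [115, 512, 517] t then 0 else bif among [231, 513, 518] t then 1
  else bif among [462, 514, 519] t then 2 else bif among [412, 515, 520] t then 3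
  else bif among [313, 516] t then 4 else 5

/-- Distinct vertices in the classes `i` and `j` are adjacent. -/
def joined (i j : ℕ) : Bool :=
  Nat.blt i 5 && (Nat.blt j 5 && (Nat.beq i j || (Nat.beq j ((i + 1) % 5) ||
    Nat.beq i ((j + 1) % 5))))

theorem inClassC_of_four [Fintype V] (h1 : IsFreeOf G graphP2P3) (h2 : IsFreeOf G graphGem)
    (hf : Rep G 9 baseFour f) : InClassC G := by
  classical
  have hT : Typed G 9 baseFour typesFour f :=
    Typed.of_masks h1 h2 hf (fun _ => true) (fun _ _ => rfl) (by decide +kernel)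
      (by decide +kernel)
  refine inClassC_of_classes (fun u => kind (tau G 9 f u)) (fun u => ?_) (fun i hi => ⟨f i, ?_⟩)
    fun u w huw => ?_
  · simpa using hT.single (fun t => Nat.ble (kind t) 5) (by decide +kernel) u
  · simp only [hT.rep.tau_base (by omega : i < 9)]
    interval_cases i <;> decide +kernel
  · have := hT.fact (fun m k a => eqB (joined (kind m) (kind k)) a) (by decide +kernel) huw
    rw [eqB_iff, Bool.eq_iff_iff, decide_eq_true_iff] at this
    rw [← this]
    simp [joined, Nat.blt_eq, Nat.beq_eq]

end Four

section Mono

variable {V : Type*} {G : SimpleGraph V} {f : ℕ → V}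

/-- The cycle `0, …, 4` with a vertex of kind `0`. -/
def baseMono : ℕ := 22970346894814518897344562

/-- The admissible types of vertices. -/
def typesMono : List ℕ :=
  [0, 2, 5, 9, 12, 13, 16, 18, 33, 35, 36, 37, 39, 40, 41, 43, 44, 45, 49, 51, 53, 57, 64, 65, 66,
    67, 68, 69]

/-- A base whose types are those possible when neither the kind `2` nor the kind `3` is present. -/
structure Mono (G : SimpleGraph V) (f : ℕ → V) : Prop where
  typed : Typed G 6 baseMono typesMono f

/-- `u` is adjacent to one of the two vertices of the cycle far from `f 5`. -/
def Up (G : SimpleGraph V) (f : ℕ → V) (u : V) : Prop := G.Adj u (f 2) ∨ G.Adj u (f 3)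

/-- The base with `f 0` and `f 5` replaced by `x` and `y`. -/
def rebase (f : ℕ → V) (x y : V) (i : ℕ) : V :=
  if i = 0 then x else if i = 5 then y else f i

/-- The types of the vertices satisfying `Up` and selected by `pos` and `neg`. -/
def upSel (pos neg : List ℕ) (t : ℕ) : Bool :=
  (nbr 6 baseMono t 2 || nbr 6 baseMono t 3) && sel 6 baseMono pos neg t

namespace Mono

theorem of_rep (h1 : IsFreeOf G graphP2P3) (h2 : IsFreeOf G graphGem) (hf : Rep G 6 baseMono f)
    (hY3 : NoY G f 1 2 3 4 0) (hY4 : NoY G f 2 3 4 0 1) : Mono G f := by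
  refine ⟨Typed.of_masks h1 h2 hf
    (fun m => notY 1 2 3 4 0 m && notY 2 3 4 0 1 m) (fun u _ => ?_) ?_ ?_⟩
  · rw [Bool.and_eq_true]
    exact ⟨hY3.notY (by norm_num) (by norm_num) (by norm_num) (by norm_num) (by norm_num) u,
      hY4.notY (by norm_num) (by norm_num) (by norm_num) (by norm_num) (by norm_num) u⟩
  · decide +kernel
  · decide +kernel

theorem upSel_iff (h : Mono G f) {pos neg : List ℕ} (hpos : ∀ i ∈ pos, i < 6)
    (hneg : ∀ i ∈ neg, i < 6) {u : V} : upSel pos neg (tau G 6 f u) = true ↔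
      Up G f u ∧ (∀ i ∈ pos, G.Adj u (f i)) ∧ ∀ i ∈ neg, ¬ G.Adj u (f i) := by
  rw [upSel, Bool.and_eq_true, h.typed.rep.sel_iff hpos hneg, Bool.or_eq_true,
    h.typed.rep.nbr_iff (by norm_num), h.typed.rep.nbr_iff (by norm_num), Up]

theorem sel_iff (h : Mono G f) {pos neg : List ℕ} (hpos : ∀ i ∈ pos, i < 6)
    (hneg : ∀ i ∈ neg, i < 6) {u : V} : sel 6 baseMono pos neg (tau G 6 f u) = true ↔
      (∀ i ∈ pos, G.Adj u (f i)) ∧ ∀ i ∈ neg, ¬ G.Adj u (f i) :=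
  h.typed.rep.sel_iff hpos hneg

theorem adj_cycle (h : Mono G f) {i j : ℕ} (hi : i < 6) (hj : j < 6)
    (hij : edge baseMono i j = true) : G.Adj (f i) (f j) := (h.typed.rep.adj i hi j hj).1 hij

theorem not_adj (h : Mono G f) {i j : ℕ} (hi : i < 6) (hj : j < 6)
    (hij : edge baseMono i j = false) : ¬ G.Adj (f i) (f j) := by
  rw [← h.typed.rep.adj i hi j hj, hij]
  exact Bool.false_ne_true

theorem rep_rebase (h : Mono G f) {x y : V} (hxy : G.Adj x y)
    (hx : G.Adj x (f 1) ∧ G.Adj x (f 4) ∧ ¬ Up G f x)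
    (hy : G.Adj y (f 1) ∧ G.Adj y (f 4) ∧ ¬ Up G f y) : Rep G 6 baseMono (rebase f x y) := by
  have key : ∀ z, G.Adj z (f 1) ∧ G.Adj z (f 4) ∧ ¬ Up G f z → ∀ j < 6, j ≠ 0 → j ≠ 5 →
      z ≠ f j ∧ (edge baseMono 0 j = true ↔ G.Adj z (f j)) ∧
        (edge baseMono j 0 = true ↔ G.Adj (f j) z) ∧
        (edge baseMono 5 j = true ↔ G.Adj z (f j)) ∧
        (edge baseMono j 5 = true ↔ G.Adj (f j) z) := by
    rintro z ⟨h1, h4, hn⟩ j hj hj0 hj5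
    rw [Up, not_or] at hn
    have h1' := h1.symm
    have h4' := h4.symm
    have hn2 : ¬ G.Adj (f 2) z := fun h => hn.1 h.symm
    have hn3 : ¬ G.Adj (f 3) z := fun h => hn.2 h.symm
    refine ⟨?_, ?_⟩
    · rintro rfl
      interval_cases j
      · exact hj0 rfl
      · exact G.irrefl h1
      · exact hn.2 (h.adj_cycle (by norm_num) (by norm_num) (by decide +kernel))
      · exact hn.1 (h.adj_cycle (by norm_num) (by norm_num) (by decide +kernel))
      · exact G.irrefl h4
      · exact hj5 rfl
    · interval_cases j <;> simp_all [edge, bit, baseMono]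
  refine ⟨fun i hi j hj hij => ?_, fun i hi j hj => ?_⟩
  · by_cases hi0 : i = 0 <;> by_cases hi5 : i = 5 <;> by_cases hj0 : j = 0 <;>
      by_cases hj5 : j = 5 <;> simp only [rebase, hi0, hi5, hj0, hj5, if_true, if_false] <;>
      first
      | omega
      | exact hxy.ne
      | exact hxy.ne.symm
      | exact (key x hx j hj hj0 hj5).1
      | exact (key y hy j hj hj0 hj5).1
      | exact (key x hx i hi hi0 hi5).1.symm
      | exact (key y hy i hi hi0 hi5).1.symm
      | exact h.typed.rep.inj i hi j hj hij
  · by_cases hi0 : i = 0 <;> by_cases hi5 : i = 5 <;> by_cases hj0 : j = 0 <;>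
      by_cases hj5 : j = 5 <;> simp only [rebase, hi0, hi5, hj0, hj5, if_true, if_false] <;>
      first
      | omega
      | exact h.typed.rep.adj i hi j hj
      | exact (key x hx j hj hj0 hj5).2.1
      | exact (key y hy j hj hj0 hj5).2.2.2.1
      | exact (key x hx i hi hi0 hi5).2.2.1
      | exact (key y hy i hi hi0 hi5).2.2.2.2
      | exact iff_of_true (by decide +kernel) hxy
      | exact iff_of_true (by decide +kernel) hxy.symm
      | exact iff_of_false (by decide +kernel) G.irrefl

theorem not_adj_three (h : Mono G f) {i : ℕ} (hi : i = 1 ∨ i = 2) (u : V) :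
    ¬ (G.Adj u (f i) ∧ G.Adj u (f (i + 1)) ∧ G.Adj u (f (i + 2))) := by
  have := h.typed.single (fun t => !(sel 6 baseMono [1, 2, 3] [] t) &&
    !(sel 6 baseMono [2, 3, 4] [] t)) (by decide +kernel) u
  rw [Bool.and_eq_true, Bool.not_eq_true', Bool.not_eq_true', ← Bool.not_eq_true,
    ← Bool.not_eq_true, h.sel_iff (by decide) (by decide), h.sel_iff (by decide) (by decide)] at this
  rcases hi with rfl | rfl
  · simpa using this.1
  · simpa using this.2

theorem rebase_mono (h : Mono G f) {x y : V} (hxy : G.Adj x y)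
    (hx : G.Adj x (f 1) ∧ G.Adj x (f 4) ∧ ¬ Up G f x)
    (hy : G.Adj y (f 1) ∧ G.Adj y (f 4) ∧ ¬ Up G f y) : Mono G (rebase f x y) := by
  refine of_rep h.typed.free1 h.typed.free2 (h.rep_rebase hxy hx hy) ?_ ?_
  · exact fun u h1 h2 h3 => absurd ⟨h1, h2, h3⟩ (h.not_adj_three (i := 1) (Or.inl rfl) u)
  · exact fun u h1 h2 h3 => absurd ⟨h1, h2, h3⟩ (h.not_adj_three (i := 2) (Or.inr rfl) u)

theorem nonadj_of_split (h : Mono G f) {u w : V} (hu : Up G f u) (hu0 : G.Adj u (f 0))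
    (hu5 : ¬ G.Adj u (f 5)) (hw : Up G f w) (hw0 : G.Adj w (f 0)) : ¬ G.Adj u w := by
  refine h.typed.nonadj (upSel [0] [5]) (upSel [0] []) (by decide +kernel) ?_ ?_ <;>
    rw [h.upSel_iff (by decide) (by decide)] <;> simp [*]

theorem far_cases (h : Mono G f) {u : V} (hu : Up G f u) (hu0 : ¬ G.Adj u (f 0))
    (hu5 : ¬ G.Adj u (f 5)) : u = f 2 ∨ u = f 3 ∨ among [12] (tau G 6 f u) = true := by
  have hu' := (h.upSel_iff (u := u) (pos := []) (neg := [0, 5]) (by decide) (by decide)).2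
    (by simp [*])
  have := h.typed.single (fun t => !(upSel [] [0, 5] t) || among [12, 66, 67] t)
    (by decide +kernel) u
  simp only [hu', Bool.not_true, Bool.false_or, among_iff, List.mem_cons, List.not_mem_nil,
    or_false] at this
  rcases this with h' | h' | h'
  · exact Or.inr (Or.inr (among_iff.2 (by simp [h'])))
  · exact Or.inl (h.typed.rep.eq_of_tau (by norm_num) h')
  · exact Or.inr (Or.inl (h.typed.rep.eq_of_tau (by norm_num) h'))

theorem adj_of_split (h : Mono G f) {u w : V} (hu : Up G f u) (hu0 : G.Adj u (f 0))
    (hu5 : ¬ G.Adj u (f 5)) (hw : Up G f w) (h2 : w ≠ f 2) (h3 : w ≠ f 3) :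
    G.Adj w (f 0) ∨ G.Adj w (f 5) := by
  by_contra! hn
  rcases h.far_cases hw hn.1 hn.2 with h' | h' | h'
  · exact h2 h'
  · exact h3 h'
  · refine h.typed.excl (upSel [0] [5]) (among [12]) (by decide +kernel) ?_ ?_ h' (u := u)
    · rintro rfl
      exact hn.1 hu0
    · rw [h.upSel_iff (by decide) (by decide)]
      simp [*]

theorem nonadj_low (h : Mono G f) {u w : V} (hu : ¬ Up G f u) (hw : ¬ Up G f w) {i : ℕ}
    (hi : i = 1 ∨ i = 4) (hui : ¬ G.Adj u (f i)) (hwi : ¬ G.Adj w (f i)) : ¬ G.Adj u w := by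
  rw [Up, not_or] at hu hw
  rcases hi with rfl | rfl
  · refine h.typed.nonadj (sel 6 baseMono [] [1, 2, 3]) (sel 6 baseMono [] [1, 2, 3])
      (by decide +kernel) ?_ ?_ <;> rw [h.sel_iff (by decide) (by decide)] <;> simp [*]
  · refine h.typed.nonadj (sel 6 baseMono [] [2, 3, 4]) (sel 6 baseMono [] [2, 3, 4])
      (by decide +kernel) ?_ ?_ <;> rw [h.sel_iff (by decide) (by decide)] <;> simp [*]

theorem nonadj_up_low (h : Mono G f) {u w : V} (hu : Up G f u) (hu0 : G.Adj u (f 0))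
    (hu5 : ¬ G.Adj u (f 5)) (hw : ¬ Up G f w) (hw1 : ¬ G.Adj w (f 1)) (hw4 : ¬ G.Adj w (f 4)) :
    ¬ G.Adj u w := by
  rw [Up, not_or] at hw
  refine h.typed.nonadj (upSel [0] [5]) (sel 6 baseMono [] [1, 2, 3, 4]) (by decide +kernel) ?_ ?_
  · rw [h.upSel_iff (by decide) (by decide)]
    simp [*]
  · rw [h.sel_iff (by decide) (by decide)]
    simp [*]

theorem eq_of_low (h : Mono G f) {u w : V} (hu : ¬ Up G f u) (hw : ¬ Up G f w)
    (hu0 : G.Adj u (f 0)) (hw0 : G.Adj w (f 0)) (hu5 : G.Adj u (f 5)) (hw5 : G.Adj w (f 5))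
    (hu' : ¬ (G.Adj u (f 1) ∧ G.Adj u (f 4))) (hw' : ¬ (G.Adj w (f 1) ∧ G.Adj w (f 4))) :
    u = w := by
  have key : ∀ z, ¬ Up G f z → G.Adj z (f 0) → G.Adj z (f 5) → ¬ (G.Adj z (f 1) ∧ G.Adj z (f 4)) →
      among [33, 35, 49] (tau G 6 f z) = true := by
    intro z hz hz0 hz5 hz'
    have := h.typed.single (fun t => nbr 6 baseMono t 2 || nbr 6 baseMono t 3 ||
      !(nbr 6 baseMono t 0) || !(nbr 6 baseMono t 5) ||
      (nbr 6 baseMono t 1 && nbr 6 baseMono t 4) || among [33, 35, 49] t) (by decide +kernel) z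
    simp only [Bool.or_eq_true, Bool.and_eq_true, Bool.not_eq_true', ← Bool.not_eq_true,
      h.typed.rep.nbr_iff (by norm_num : 0 < 6), h.typed.rep.nbr_iff (by norm_num : 1 < 6),
      h.typed.rep.nbr_iff (by norm_num : 2 < 6), h.typed.rep.nbr_iff (by norm_num : 3 < 6),
      h.typed.rep.nbr_iff (by norm_num : 4 < 6), h.typed.rep.nbr_iff (by norm_num : 5 < 6)] at this
    rw [Up] at hz
    simpa [hz, hz0, hz5, hz', not_or.1 hz] using this
  by_contra huw
  exact h.typed.excl (among [33, 35, 49]) (among [33, 35, 49]) (by decide +kernel) huw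
    (key u hu hu0 hu5 hu') (key w hw hw0 hw5 hw')

theorem stable_far (h : Mono G f) {u w : V} (hu : among [12] (tau G 6 f u) = true)
    (hw : among [12] (tau G 6 f w) = true) : ¬ G.Adj u w :=
  h.typed.nonadj _ _ (by decide +kernel) hu hw

theorem nonadj_far (h : Mono G f) {u w : V} (hu : among [12] (tau G 6 f u) = true)
    (hw : ¬ Up G f w) (hw0 : ¬ G.Adj w (f 0)) : ¬ G.Adj u w := by
  rw [Up, not_or] at hw
  refine h.typed.nonadj (among [12]) (sel 6 baseMono [] [0, 2, 3]) (by decide +kernel) hu ?_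
  rw [h.sel_iff (by decide) (by decide)]
  simp [*]

theorem p4Free_low (h : Mono G f) {S : Finset V} (hS : ∀ u ∈ S, ¬ Up G f u) : P4Free G S := by
  intro a ha b hb c hc d _ hab hbc hcd
  have key : ∀ u ∈ S, ¬ G.Adj (f 2) u ∧ ¬ G.Adj (f 3) u := fun u hu => by
    have := hS u hu
    rw [Up, not_or] at this
    exact ⟨fun h => this.1 h.symm, fun h => this.2 h.symm⟩
  by_cases hac : a = c
  · subst hac; exact Or.inr (Or.inr hcd)
  · by_contra hn
    exact no_P2P3 h.typed.free1 (h.adj_cycle (i := 2) (j := 3) (by norm_num) (by norm_num)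
      (by decide +kernel)) hab hbc (fun h' => hn (Or.inl h')) hac (key a ha).1 (key b hb).1
      (key c hc).1 (key a ha).2 (key b hb).2 (key c hc).2

end Mono

/-- A largest clique `K` of vertices with the same neighbours on the cycle as `f 5`, apart from
`f 0`, which contains `f 0` and `f 5`. -/
structure MonoMax (G : SimpleGraph V) (f : ℕ → V) (K : Finset V) : Prop where
  mono : Mono G f
  clq : Clq G K
  mem : ∀ u ∈ K, G.Adj u (f 1) ∧ G.Adj u (f 4) ∧ ¬ Up G f u
  max : ∀ K', Clq G K' → (∀ u ∈ K', G.Adj u (f 1) ∧ G.Adj u (f 4) ∧ ¬ Up G f u) →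
    K'.card ≤ K.card
  zero : f 0 ∈ K
  five : f 5 ∈ K

theorem Mono.exists_max [Fintype V] (h : Mono G f) : ∃ f' K, MonoMax G f' K := by
  classical
  have e01 : G.Adj (f 0) (f 1) := h.adj_cycle (by norm_num) (by norm_num) (by decide +kernel)
  have e04 : G.Adj (f 0) (f 4) := h.adj_cycle (by norm_num) (by norm_num) (by decide +kernel)
  have e05 : G.Adj (f 0) (f 5) := h.adj_cycle (by norm_num) (by norm_num) (by decide +kernel)
  have e51 : G.Adj (f 5) (f 1) := h.adj_cycle (by norm_num) (by norm_num) (by decide +kernel)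
  have e54 : G.Adj (f 5) (f 4) := h.adj_cycle (by norm_num) (by norm_num) (by decide +kernel)
  have n0 : ¬ Up G f (f 0) := not_or.2
    ⟨h.not_adj (by norm_num) (by norm_num) (by decide +kernel),
      h.not_adj (by norm_num) (by norm_num) (by decide +kernel)⟩
  have n5 : ¬ Up G f (f 5) := not_or.2
    ⟨h.not_adj (by norm_num) (by norm_num) (by decide +kernel),
      h.not_adj (by norm_num) (by norm_num) (by decide +kernel)⟩
  obtain ⟨K, hK, hc, hmax⟩ := exists_max_clq G
    (Finset.univ.filter fun u => G.Adj u (f 1) ∧ G.Adj u (f 4) ∧ ¬ Up G f u)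
  have hmem : ∀ u ∈ K, G.Adj u (f 1) ∧ G.Adj u (f 4) ∧ ¬ Up G f u := fun u hu =>
    (Finset.mem_filter.1 (hK hu)).2
  have h2 : 1 < K.card := by
    refine lt_of_lt_of_le ?_ (hmax {f 0, f 5} ?_ ?_)
    · rw [Finset.card_pair e05.ne]
      norm_num
    · intro u hu
      rw [Finset.mem_insert, Finset.mem_singleton] at hu
      rcases hu with rfl | rfl <;> simp [*]
    · intro u hu w hw huw
      rw [Finset.mem_insert, Finset.mem_singleton] at hu hw
      rcases hu with rfl | rfl <;> rcases hw with rfl | rfl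
      · exact absurd rfl huw
      · exact e05
      · exact e05.symm
      · exact absurd rfl huw
  obtain ⟨x, hx, y, hy, hxy⟩ := Finset.one_lt_card.1 h2
  exact ⟨rebase f x y, K, h.rebase_mono (hc x hx y hy hxy) (hmem x hx) (hmem y hy), hc, hmem,
    fun K' hc' h' => hmax K' (fun u hu => Finset.mem_filter.2 ⟨Finset.mem_univ u, h' u hu⟩) hc', hx, hy⟩

namespace MonoMax

variable {K : Finset V}

theorem rebase_mono (h : MonoMax G f K) {x y : V} (hx : x ∈ K) (hy : y ∈ K) (hxy : x ≠ y) :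
    Mono G (rebase f x y) :=
  h.mono.rebase_mono (h.clq x hx y hy hxy) (h.mem x hx) (h.mem y hy)

theorem nonadj_of_split (h : MonoMax G f K) {x y : V} (hx : x ∈ K) (hy : y ∈ K) {u w : V}
    (hu : Up G f u) (hux : G.Adj u x) (huy : ¬ G.Adj u y) (hw : Up G f w) (hwx : G.Adj w x) :
    ¬ G.Adj u w :=
  (h.rebase_mono hx hy (by rintro rfl; exact huy hux)).nonadj_of_split hu hux huy hw hwx

theorem adj_of_split (h : MonoMax G f K) {x y : V} (hx : x ∈ K) (hy : y ∈ K) {u w : V}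
    (hu : Up G f u) (hux : G.Adj u x) (huy : ¬ G.Adj u y) (hw : Up G f w) (h2 : w ≠ f 2)
    (h3 : w ≠ f 3) : G.Adj w x ∨ G.Adj w y :=
  (h.rebase_mono hx hy (by rintro rfl; exact huy hux)).adj_of_split hu hux huy hw h2 h3

theorem nonadj_up_low (h : MonoMax G f K) {x y : V} (hx : x ∈ K) (hy : y ∈ K) {u w : V}
    (hu : Up G f u) (hux : G.Adj u x) (huy : ¬ G.Adj u y) (hw : ¬ Up G f w)
    (hw1 : ¬ G.Adj w (f 1)) (hw4 : ¬ G.Adj w (f 4)) : ¬ G.Adj u w :=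
  (h.rebase_mono hx hy (by rintro rfl; exact huy hux)).nonadj_up_low hu hux huy hw hw1 hw4

theorem two_le (h : MonoMax G f K) : 2 ≤ K.card :=
  Finset.one_lt_card.2 ⟨f 0, h.zero, f 5, h.five,
    h.mono.typed.rep.inj 0 (by norm_num) 5 (by norm_num) (by norm_num)⟩

theorem card_le_low (h : MonoMax G f K) {Z : Finset V} (hZ : Clq G Z) (hn : ∀ u ∈ Z, ¬ Up G f u) :
    Z.card ≤ K.card + 1 := by
  classical
  have h2 := h.two_le
  have e := Finset.card_filter_add_card_filter_not (s := Z)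
    (fun u => G.Adj u (f 1) ∧ G.Adj u (f 4))
  set P := Z.filter fun u => G.Adj u (f 1) ∧ G.Adj u (f 4) with hP
  set Q := Z.filter fun u => ¬ (G.Adj u (f 1) ∧ G.Adj u (f 4)) with hQ
  have hPZ : P ⊆ Z := Finset.filter_subset _ _
  have hQZ : Q ⊆ Z := Finset.filter_subset _ _
  have hPm : ∀ u ∈ P, G.Adj u (f 1) ∧ G.Adj u (f 4) ∧ ¬ Up G f u := fun u hu =>
    ⟨(Finset.mem_filter.1 hu).2.1, (Finset.mem_filter.1 hu).2.2, hn u (hPZ hu)⟩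
  have hQn : ∀ u ∈ Q, ¬ (G.Adj u (f 1) ∧ G.Adj u (f 4)) := fun u hu => (Finset.mem_filter.1 hu).2
  have hPc := h.max P (hZ.mono hPZ) hPm
  rcases Nat.lt_or_ge 1 P.card with h1 | h1
  · obtain ⟨x, hx, y, hy, hxy⟩ := Finset.one_lt_card.1 h1
    have hm := h.mono.rebase_mono (hZ x (hPZ hx) y (hPZ hy) hxy) (hPm x hx) (hPm y hy)
    have hadj : ∀ u ∈ Q, ∀ z ∈ P, G.Adj u z := fun u hu z hz =>
      hZ u (hQZ hu) z (hPZ hz) fun h' => hQn u hu (h' ▸ (Finset.mem_filter.1 hz).2)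
    have : Q.card ≤ 1 := Finset.card_le_one.2 fun u hu w hw =>
      hm.eq_of_low (hn u (hQZ hu)) (hn w (hQZ hw)) (hadj u hu x hx) (hadj w hw x hx)
        (hadj u hu y hy) (hadj w hw y hy) (hQn u hu) (hQn w hw)
    omega
  · have key : ∀ i, i = 1 ∨ i = 4 → (Z.filter fun u => ¬ G.Adj u (f i)).card ≤ 1 := by
      refine fun i hi => Finset.card_le_one.2 fun u hu w hw => ?_
      by_contra huw
      rw [Finset.mem_filter] at hu hw
      exact h.mono.nonadj_low (hn u hu.1) (hn w hw.1) hi hu.2 hw.2 (hZ u hu.1 w hw.1 huw)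
    have hQ' : Q ⊆ (Z.filter fun u => ¬ G.Adj u (f 1)) ∪ Z.filter fun u => ¬ G.Adj u (f 4) := by
      intro u hu
      rw [Finset.mem_union, Finset.mem_filter, Finset.mem_filter]
      rcases not_and_or.1 (hQn u hu) with h' | h'
      · exact Or.inl ⟨hQZ hu, h'⟩
      · exact Or.inr ⟨hQZ hu, h'⟩
    have := (Finset.card_le_card hQ').trans (Finset.card_union_le _ _)
    have := key 1 (Or.inl rfl)
    have := key 4 (Or.inr rfl)
    omega

theorem card_add_two_le [Finite V] (h : MonoMax G f K) {Z : Finset V} (hZ : Clq G Z)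
    (hn : ∀ u ∈ Z, ¬ Up G f u) (hZ' : ∀ u ∈ Z, G.Adj u (f 1) ∨ G.Adj u (f 4))
    (hc : K.card + 1 ≤ Z.card) : K.card + 2 ≤ G.cliqueNum := by
  have h2 := h.two_le
  have hall : ∀ i, (∀ u ∈ Z, G.Adj u (f i)) → K.card + 2 ≤ G.cliqueNum := by
    intro i hi
    have := hZ.card_add_le (Clq.singleton (f i)) fun u hu w hw => by
      rw [Finset.mem_singleton.1 hw]
      exact hi u hu
    rw [Finset.card_singleton] at this
    omega
  by_contra hlt
  have h1 : ∃ a ∈ Z, ¬ G.Adj a (f 1) := by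
    by_contra! h'
    exact hlt (hall 1 h')
  have h4 : ∃ b ∈ Z, ¬ G.Adj b (f 4) := by
    by_contra! h'
    exact hlt (hall 4 h')
  obtain ⟨a, ha, ha1⟩ := h1
  obtain ⟨b, hb, hb4⟩ := h4
  have ha4 := (hZ' a ha).resolve_left ha1
  have hb1 := (hZ' b hb).resolve_right hb4
  have hab : a ≠ b := by
    rintro rfl
    exact ha1 hb1
  classical
  obtain ⟨z, hz, hz'⟩ := Finset.exists_mem_notMem_of_card_lt_card
    (lt_of_le_of_lt (Finset.card_le_two (a := a) (b := b)) (by omega : 2 < Z.card))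
  rw [Finset.mem_insert, Finset.mem_singleton, not_or] at hz'
  have hz1 : G.Adj z (f 1) := by
    by_contra h'
    exact h.mono.nonadj_low (hn z hz) (hn a ha) (Or.inl rfl) h' ha1 (hZ z hz a ha hz'.1)
  have hz4 : G.Adj z (f 4) := by
    by_contra h'
    exact h.mono.nonadj_low (hn z hz) (hn b hb) (Or.inr rfl) h' hb4 (hZ z hz b hb hz'.2)
  exact no_gem h.mono.typed.free2 hz1 (hZ z hz b hb hz'.2) (hZ z hz a ha hz'.1) hz4 hb1.symm
    (hZ b hb a ha hab.symm) ha4 (fun h' => ha1 h'.symm)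
    (h.mono.not_adj (by norm_num) (by norm_num) (by decide +kernel)) hb4

theorem card_add_le [Finite V] (h : MonoMax G f K) {F : Finset V} (hF : Clq G F)
    (hF' : ∀ u ∈ F, ∀ x ∈ K, G.Adj u x) : F.card + K.card ≤ G.cliqueNum :=
  hF.card_add_le h.clq hF'

theorem adj_two_three (h : MonoMax G f K) : G.Adj (f 2) (f 3) :=
  h.mono.adj_cycle (by norm_num) (by norm_num) (by decide +kernel)

open Classical in
/-- The vertices satisfying `Up` and complete to `K`. -/
noncomputable def full [Fintype V] (G : SimpleGraph V) (f : ℕ → V) (K : Finset V) : Finset V :=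
  Finset.univ.filter fun u => Up G f u ∧ ∀ x ∈ K, G.Adj u x

open Classical in
/-- The vertices not satisfying `Up`. -/
noncomputable def low [Fintype V] (G : SimpleGraph V) (f : ℕ → V) : Finset V :=
  Finset.univ.filter fun u => ¬ Up G f u

theorem mem_full [Fintype V] {u : V} : u ∈ full G f K ↔ Up G f u ∧ ∀ x ∈ K, G.Adj u x := by
  simp [full]

theorem mem_low [Fintype V] {u : V} : u ∈ low G f ↔ ¬ Up G f u := by
  simp [low]

variable [Fintype V]

theorem exists_full (h : MonoMax G f K) :
    ∃ a, 1 ≤ a ∧ a + K.card ≤ G.cliqueNum ∧ Col G (full G f K) a := by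
  obtain ⟨F, hF, hFc, hmax⟩ := exists_max_clq G (full G f K)
  refine ⟨F.card, ?_, h.card_add_le hFc fun u hu => (mem_full.1 (hF hu)).2,
    P4Free.exists_colours _ (p4Free_of_nbr h.mono.typed.free2 (z := f 0) fun u hu =>
      ((mem_full.1 hu).2 _ h.zero).symm) hmax⟩
  have := hmax {f 1} ?_ (Clq.singleton _)
  · simpa using this
  · rw [Finset.singleton_subset_iff, mem_full]
    exact ⟨Or.inl (h.mono.adj_cycle (by norm_num) (by norm_num) (by decide +kernel)),
      fun x hx => (h.mem x hx).1.symm⟩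

theorem col_low (h : MonoMax G f K) : Col G (low G f) (K.card + 1) :=
  P4Free.exists_colours _ (h.mono.p4Free_low fun _ hu => mem_low.1 hu) fun _ hZ hc =>
    h.card_le_low hc fun _ hu => mem_low.1 (hZ hu)

theorem bound_of_uniform (h : MonoMax G f K)
    (hu : ∀ u, Up G f u → ∀ x ∈ K, ∀ y ∈ K, G.Adj u x → G.Adj u y) :
    G.chromaticNumber ≤ (G.cliqueNum + 1 : ℕ) := by
  classical
  obtain ⟨a, -, ha, hF⟩ := h.exists_full
  have h2 := h.two_le
  obtain ⟨c, hc⟩ := h.col_low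
  have h0 : f 0 ∈ low G f := mem_low.2 (h.mem _ h.zero).2.2
  obtain ⟨c, hc, hc0⟩ := hc.exists_eq h0 (by omega : 0 < K.card + 1)
  have h3 : Colours G {f 2, f 3} (K.card + 1) fun u => if u = f 2 then 1 else 2 := by
    refine ⟨fun u _ => ?_, fun u hu w hw huw => ?_⟩
    · dsimp only
      split_ifs <;> omega
    · rw [Finset.mem_insert, Finset.mem_singleton] at hu hw
      have := h.adj_two_three.ne
      rcases hu with rfl | rfl <;> rcases hw with rfl | rfl
      · exact absurd huw G.irrefl
      · simp [this.symm]
      · simp [this.symm]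
      · exact absurd huw G.irrefl
  have h4 := hc.glue h3 fun u hu w hw _ huw => by
    rw [Finset.mem_insert, Finset.mem_singleton] at hw
    have := not_or.1 (mem_low.1 hu)
    rcases hw with rfl | rfl
    · exact absurd huw this.1
    · exact absurd huw this.2
  have h5 : Colours G (cls G 6 f (among [12])) (K.card + 1) fun _ => 0 :=
    ⟨fun _ _ => Nat.succ_pos _, fun u hu w hw huw =>
      absurd huw (h.mono.stable_far (mem_cls.1 hu) (mem_cls.1 hw))⟩
  have h6 := h4.glue h5 fun u hu w hw _ huw => by
    by_cases hul : u ∈ low G f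
    · have hu0 : G.Adj u (f 0) := by
        by_contra hu0
        exact h.mono.nonadj_far (mem_cls.1 hw) (mem_low.1 hul) hu0 huw.symm
      have := hc.2 u hul _ h0 hu0
      simpa [hul, hc0] using this
    · simp only [hul, if_false]
      split_ifs <;> norm_num
  refine ((hF.add ⟨_, h6⟩).mono (Finset.Subset.refl _)
    (by omega : _ ≤ G.cliqueNum + 1)).chromaticNumber_le fun u => ?_
  simp only [Finset.mem_union, mem_full, mem_low, mem_cls, Finset.mem_insert,
    Finset.mem_singleton]
  by_cases hup : Up G f u
  · by_cases h0 : G.Adj u (f 0)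
    · exact Or.inl ⟨hup, fun x hx => hu u hup _ h.zero x hx h0⟩
    · have h5 : ¬ G.Adj u (f 5) := fun h' => h0 (hu u hup _ h.five _ h.zero h')
      rcases h.mono.far_cases hup h0 h5 with h' | h' | h' <;> simp [h']
  · simp [hup]

theorem bound_of_split (h : MonoMax G f K) {d x y : V} (hd : Up G f d) (hx : x ∈ K) (hy : y ∈ K)
    (hdx : G.Adj d x) (hdy : ¬ G.Adj d y) : G.chromaticNumber ≤ (G.cliqueNum + 1 : ℕ) := by
  classical
  obtain ⟨a, ha1, ha, hF⟩ := h.exists_full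
  have h2 := h.two_le
  have split : ∀ u, Up G f u → u ≠ f 2 → u ≠ f 3 → ∃ z ∈ K, G.Adj u z := fun u hu h2 h3 => by
    rcases h.adj_of_split hx hy hd hdx hdy hu h2 h3 with h' | h'
    · exact ⟨x, hx, h'⟩
    · exact ⟨y, hy, h'⟩
  set D : Finset V := Finset.univ.filter fun u => Up G f u ∧ u ≠ f 2 ∧ u ≠ f 3 ∧
    ∃ z ∈ K, ¬ G.Adj u z with hD
  set D1 := D.filter fun u => ¬ G.Adj u (f 0) with hD1
  set D2 := D.filter fun u => G.Adj u (f 0) with hD2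
  have mD : ∀ u ∈ D, Up G f u ∧ u ≠ f 2 ∧ u ≠ f 3 ∧ ∃ z ∈ K, ¬ G.Adj u z := fun u hu =>
    (Finset.mem_filter.1 hu).2
  have s1 : Col G D1 1 := col_of_stable fun u hu w hw => by
    rw [hD1, Finset.mem_filter] at hu hw
    obtain ⟨hu1, hu2, hu3, -⟩ := mD u hu.1
    obtain ⟨hw1, hw2, hw3, -⟩ := mD w hw.1
    obtain ⟨z, hz, huz⟩ := split u hu1 hu2 hu3
    have hwz := (h.adj_of_split hz h.zero hu1 huz hu.2 hw1 hw2 hw3).resolve_right hw.2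
    exact h.nonadj_of_split hz h.zero hu1 huz hu.2 hw1 hwz
  have s2 : Col G D2 1 := col_of_stable fun u hu w hw => by
    rw [hD2, Finset.mem_filter] at hu hw
    obtain ⟨hu1, -, -, z, hz, huz⟩ := mD u hu.1
    exact h.nonadj_of_split h.zero hz hu1 hu.2 huz (mD w hw.1).1 hw.2
  have hFD : ∀ u ∈ full G f K, ∀ w ∈ D, ¬ G.Adj u w := fun u hu w hw huw => by
    obtain ⟨hw1, hw2, hw3, z, hz, hwz⟩ := mD w hw
    obtain ⟨z', hz', hwz'⟩ := split w hw1 hw2 hw3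
    rw [mem_full] at hu
    exact h.nonadj_of_split hz' hz hw1 hwz' hwz hu.1 (hu.2 z' hz') huw.symm
  have hp : Col G {f 2, f 3} K.card := by
    refine (Clq.col fun u hu w hw huw => ?_).mono (Finset.Subset.refl _)
      (Finset.card_le_two.trans h2)
    rw [Finset.mem_insert, Finset.mem_singleton] at hu hw
    rcases hu with rfl | rfl <;> rcases hw with rfl | rfl
    · exact absurd rfl huw
    · exact h.adj_two_three
    · exact h.adj_two_three.symm
    · exact absurd rfl huw
  have hlow : ∀ u ∈ low G f, ∀ w ∈ ({f 2, f 3} : Finset V), ¬ G.Adj u w := by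
    intro u hu w hw huw
    rw [Finset.mem_insert, Finset.mem_singleton] at hw
    have := not_or.1 (mem_low.1 hu)
    rcases hw with rfl | rfl
    · exact this.1 huw
    · exact this.2 huw
  have cover : ∀ u, u ∈ full G f K ∨ u ∈ D1 ∨ u ∈ D2 ∨ u ∈ low G f ∨
      u ∈ ({f 2, f 3} : Finset V) := by
    intro u
    by_cases hup : Up G f u
    · by_cases hu' : u ∈ ({f 2, f 3} : Finset V)
      · simp [hu']
      by_cases hK : ∀ z ∈ K, G.Adj u z
      · exact Or.inl (mem_full.2 ⟨hup, hK⟩)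
      · push Not at hK
        rw [Finset.mem_insert, Finset.mem_singleton, not_or] at hu'
        have : u ∈ D := Finset.mem_filter.2 ⟨Finset.mem_univ _, hup, hu'.1, hu'.2, hK⟩
        by_cases h0 : G.Adj u (f 0)
        · exact Or.inr (Or.inr (Or.inl (Finset.mem_filter.2 ⟨this, h0⟩)))
        · exact Or.inr (Or.inl (Finset.mem_filter.2 ⟨this, h0⟩))
    · simp [mem_low, hup]
  set E := (low G f).filter fun u => ¬ (G.Adj u (f 1) ∨ G.Adj u (f 4)) with hE
  set N := (low G f).filter fun u => G.Adj u (f 1) ∨ G.Adj u (f 4) with hN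
  by_cases hM : ∀ Z ⊆ N, Clq G Z → Z.card ≤ K.card
  · have cE : Col G (D2 ∪ E) 1 := by
      refine s2.par (col_of_stable fun u hu w hw => ?_) fun u hu w hw => ?_
      · rw [hE, Finset.mem_filter, mem_low, not_or] at hu hw
        exact h.mono.nonadj_low hu.1 hw.1 (Or.inl rfl) hu.2.1 hw.2.1
      · rw [hE, Finset.mem_filter, mem_low, not_or] at hw
        rw [hD2, Finset.mem_filter] at hu
        obtain ⟨hu1, -, -, z, hz, huz⟩ := mD u hu.1
        exact h.nonadj_up_low h.zero hz hu1 hu.2 huz hw.1 hw.2.1 hw.2.2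
    have cF : Col G (full G f K ∪ D1) a := hF.par (s1.mono (Finset.Subset.refl _) ha1)
      fun u hu w hw => hFD u hu w (Finset.mem_filter.1 hw).1
    have cN : Col G (N ∪ {f 2, f 3}) K.card := by
      refine Col.par ?_ hp fun u hu => hlow u (Finset.mem_filter.1 hu).1
      exact P4Free.exists_colours _
        (h.mono.p4Free_low fun u hu => mem_low.1 (Finset.mem_filter.1 hu).1) hM
    refine (((cF.add cN).add cE).mono (Finset.Subset.refl _)
      (by omega : _ ≤ G.cliqueNum + 1)).chromaticNumber_le fun u => ?_
    simp only [Finset.mem_union]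
    rcases cover u with h' | h' | h' | h' | h'
    · simp only [h', true_or]
    · simp only [h', true_or, or_true]
    · simp only [h', true_or, or_true]
    · by_cases h'' : G.Adj u (f 1) ∨ G.Adj u (f 4)
      · have : u ∈ N := Finset.mem_filter.2 ⟨h', h''⟩
        simp only [this, true_or, or_true]
      · have : u ∈ E := Finset.mem_filter.2 ⟨h', h''⟩
        simp only [this, or_true]
    · simp only [h', true_or, or_true]
  · push Not at hM
    obtain ⟨Z, hZN, hZ, hZc⟩ := hM
    have hω := h.card_add_two_le hZ
      (fun u hu => mem_low.1 (Finset.mem_filter.1 (hZN hu)).1)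
      (fun u hu => (Finset.mem_filter.1 (hZN hu)).2) hZc
    have cF : Col G (full G f K ∪ (D1 ∪ D2)) (Nat.max a 2) := by
      refine (hF.mono (Finset.Subset.refl _) (Nat.le_max_left _ _)).par
        ((s1.add s2).mono (Finset.Subset.refl _) (Nat.le_max_right _ _)) fun u hu w hw => ?_
      rcases Finset.mem_union.1 hw with hw | hw
      · exact hFD u hu w (Finset.mem_filter.1 hw).1
      · exact hFD u hu w (Finset.mem_filter.1 hw).1
    have cM : Col G (low G f ∪ {f 2, f 3}) (K.card + 1) :=
      h.col_low.par (hp.mono (Finset.Subset.refl _) (Nat.le_succ _)) hlow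
    refine ((cF.add cM).mono (Finset.Subset.refl _)
      (?_ : _ ≤ G.cliqueNum + 1)).chromaticNumber_le fun u => ?_
    · rcases Nat.le_total a 2 with h' | h'
      · rw [Nat.max_eq_max, max_eq_right h']
        omega
      · rw [Nat.max_eq_max, max_eq_left h']
        omega
    · simp only [Finset.mem_union]
      rcases cover u with h' | h' | h' | h' | h' <;> simp only [h', true_or, or_true]

theorem bound (h : MonoMax G f K) : G.chromaticNumber ≤ (G.cliqueNum + 1 : ℕ) := by
  by_cases hu : ∀ u, Up G f u → ∀ x ∈ K, ∀ y ∈ K, G.Adj u x → G.Adj u y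
  · exact h.bound_of_uniform hu
  · push Not at hu
    obtain ⟨u, hu, x, hx, y, hy, hux, huy⟩ := hu
    exact h.bound_of_split hu hx hy hux huy

end MonoMax

theorem Mono.bound [Fintype V] (h : Mono G f) :
    G.chromaticNumber ≤ (G.cliqueNum + 1 : ℕ) := by
  obtain ⟨f', K, h'⟩ := h.exists_max
  exact h'.bound

end Mono

section Cycle

variable {V : Type*} {G : SimpleGraph V} {v : Fin 5 → V}

/-- `j` is at distance at most one from `i` on the cycle. -/
def near (i j : Fin 5) : Bool := decide (j = i - 1 ∨ j = i ∨ j = i + 1)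

theorem adj_of_mem_setY {i : Fin 5} {u : V} (hu : u ∈ setY G v i) (j : Fin 5) :
    G.Adj u (v j) ↔ near i j = true := by
  rw [hu.2 j, near, decide_eq_true_eq]

theorem adj_iff_near (hv : IsInducedC5 G v) {i j : Fin 5} (hij : i ≠ j) :
    G.Adj (v i) (v j) ↔ near i j = true := by
  rw [hv.2 i j]
  revert i j
  decide

theorem adj_setY_iff (h2 : IsFreeOf G graphGem) (hv : IsInducedC5 G v) {i j : Fin 5} (hij : i ≠ j)
    {u w : V} (hu : u ∈ setY G v i) (hw : w ∈ setY G v j) : G.Adj u w ↔ near i j = true := by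
  have yes : ∀ {i : Fin 5} {u w : V}, u ∈ setY G v i → w ∈ setY G v (i + 1) → G.Adj u w := by
    intro i u w hu hw
    by_contra huw
    refine no_gem h2 (z := v i) (p := v (i - 1)) (q := u) (r := v (i + 1)) (s := w)
      ?_ ?_ ?_ ?_ ?_ ?_ ?_ ?_ ?_ ?_
    · rw [hv.2]; clear hu hw; revert i; decide
    · rw [G.adj_comm, adj_of_mem_setY hu]; clear hu hw; revert i; decide
    · rw [hv.2]; clear hu hw; revert i; decide
    · rw [G.adj_comm, adj_of_mem_setY hw]; clear hu hw; revert i; decide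
    · rw [G.adj_comm, adj_of_mem_setY hu]; clear hu hw; revert i; decide
    · rw [adj_of_mem_setY hu]; clear hu hw; revert i; decide
    · rw [G.adj_comm, adj_of_mem_setY hw]; clear hu hw; revert i; decide
    · rw [hv.2]; clear hu hw; revert i; decide
    · rw [G.adj_comm, adj_of_mem_setY hw]; clear hu hw; revert i; decide
    · exact huw
  have no : ∀ {i : Fin 5} {u w : V}, u ∈ setY G v i → w ∈ setY G v (i + 2) → ¬ G.Adj u w := by
    intro i u w hu hw huw
    refine no_gem h2 (z := v (i + 1)) (p := v i) (q := u) (r := w) (s := v (i + 2))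
      ?_ ?_ ?_ ?_ ?_ huw ?_ ?_ ?_ ?_
    · rw [hv.2]; clear hu hw; revert i; decide
    · rw [G.adj_comm, adj_of_mem_setY hu]; clear hu hw; revert i; decide
    · rw [G.adj_comm, adj_of_mem_setY hw]; clear hu hw; revert i; decide
    · rw [hv.2]; clear hu hw; revert i; decide
    · rw [G.adj_comm, adj_of_mem_setY hu]; clear hu hw; revert i; decide
    · rw [adj_of_mem_setY hw]; clear hu hw; revert i; decide
    · rw [G.adj_comm, adj_of_mem_setY hw]; clear hu hw; revert i; decide
    · rw [hv.2]; clear hu hw; revert i; decide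
    · rw [adj_of_mem_setY hu]; clear hu hw; revert i; decide
  have cases : ∀ i j : Fin 5, i ≠ j → j = i + 1 ∨ i = j + 1 ∨ j = i + 2 ∨ i = j + 2 := by decide
  rcases cases i j hij with rfl | rfl | rfl | rfl
  · exact iff_of_true (yes hu hw) (by clear hu hw hij; revert i; decide)
  · exact iff_of_true (yes hw hu).symm (by clear hu hw hij; revert j; decide)
  · exact iff_of_false (no hu hw) (by clear hu hw hij; revert i; decide)
  · exact iff_of_false (fun h => no hw hu h.symm) (by clear hu hw hij; revert j; decide)

/-- The cycle `v` followed by vertices of the kinds prescribed by `k`. -/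
def extend (v Y : Fin 5 → V) (k : ℕ → Fin 5) (i : ℕ) : V := if i < 5 then v (k i) else Y (k i)

theorem rep_extend (h2 : IsFreeOf G graphGem) (hv : IsInducedC5 G v) {Y : Fin 5 → V}
    {k : ℕ → Fin 5} {n B : ℕ} (hY : ∀ i < n, 5 ≤ i → Y (k i) ∈ setY G v (k i))
    (hk : ∀ i < n, ∀ j < n, (i < 5 ↔ j < 5) → k i = k j → i = j)
    (hB : ∀ i < n, ∀ j < n, edge B i j = (!(i == j) && near (k i) (k j))) :
    Rep G n B (extend v Y k) := by
  have key : ∀ i < n, ∀ j < n, i ≠ j → extend v Y k i ≠ extend v Y k j ∧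
      (G.Adj (extend v Y k i) (extend v Y k j) ↔ near (k i) (k j) = true) := by
    intro i hi j hj hij
    have hne : (i < 5 ↔ j < 5) → k i ≠ k j := fun h h' => hij (hk i hi j hj h h')
    have hsymm : ∀ a b, near a b = near b a := by decide
    unfold extend
    split_ifs with h h' h'
    · exact ⟨fun h'' => hne (iff_of_true h h') (hv.1 h''),
        adj_iff_near hv (hne (iff_of_true h h'))⟩
    · have := hY j hj (not_lt.1 h')
      refine ⟨fun h'' => this.1 ⟨_, h''⟩, ?_⟩
      rw [G.adj_comm, adj_of_mem_setY this, hsymm]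
    · have := hY i hi (not_lt.1 h)
      exact ⟨fun h'' => this.1 ⟨_, h''.symm⟩, adj_of_mem_setY this _⟩
    · have e := hne (iff_of_false h h')
      have hi' := hY i hi (not_lt.1 h)
      have hj' := hY j hj (not_lt.1 h')
      refine ⟨fun h'' => e ?_, adj_setY_iff h2 hv e hi' hj'⟩
      have hn : ∀ a b : Fin 5, (∀ c, near a c = near b c) → a = b := by decide
      refine hn _ _ fun c => ?_
      rw [Bool.eq_iff_iff, ← adj_of_mem_setY hi', ← adj_of_mem_setY hj', h'']
  refine ⟨fun i hi j hj hij => (key i hi j hj hij).1, fun i hi j hj => ?_⟩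
  rw [hB i hi j hj]
  rcases eq_or_ne i j with rfl | hij
  · simp
  · simp [(key i hi j hj hij).2, hij]

theorem noY_extend (hv : IsInducedC5 G v) {Y : Fin 5 → V} {k : ℕ → Fin 5} {i : Fin 5}
    (hi : ¬ (setY G v i).Nonempty) {a b c d e : ℕ}
    (hlt : a < 5 ∧ b < 5 ∧ c < 5 ∧ d < 5 ∧ e < 5)
    (h : ∀ j, (j = k a ∨ j = k b ∨ j = k c ∨ j = k d ∨ j = k e) ∧
      near i (k a) = true ∧ near i (k b) = true ∧ near i (k c) = true ∧
      near i (k d) = false ∧ near i (k e) = false) :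
    NoY G (extend v Y k) a b c d e := by
  obtain ⟨ha', hb', hc', hd', he'⟩ := hlt
  intro u
  simp only [extend, ha', hb', hc', hd', he', if_true]
  intro ha hb hc
  by_contra! hn
  have far : ∀ j, (G.Adj (v j) (v (k a)) ∧ G.Adj (v j) (v (k b)) ∧ G.Adj (v j) (v (k c))) →
      ¬ near i j = false := by
    intro j ⟨ha, hb, hc⟩ hj
    have hji : G.Adj (v j) (v i) := by
      have hii : near i i = true := by simp [near]
      obtain ⟨h' | h' | h' | h' | h', h1, h2, h3, h4, h5⟩ := h i <;> simp_all
    have : ∀ i j, near i j = near j i ∧ near i i = true := by decide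
    rw [adj_iff_near hv (by rintro rfl; simp [(this j j).2] at hj), (this j i).1, hj] at hji
    exact Bool.false_ne_true hji
  refine hi ⟨u, ?_, fun j => ?_⟩
  · rintro ⟨j, rfl⟩
    rcases (h j).1 with h' | h' | h' | h' | h' <;> subst h'
    · exact G.irrefl ha
    · exact G.irrefl hb
    · exact G.irrefl hc
    · exact far _ ⟨ha, hb, hc⟩ (h i).2.2.2.2.1
    · exact far _ ⟨ha, hb, hc⟩ (h i).2.2.2.2.2
  · rw [← decide_eq_true_iff (p := j = i - 1 ∨ j = i ∨ j = i + 1)]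
    change _ ↔ near i j = true
    obtain ⟨h', h1, h2, h3, h4, h5⟩ := h j
    rcases h' with rfl | rfl | rfl | rfl | rfl <;> simp [*]

theorem IsInducedC5.rotate (hv : IsInducedC5 G v) (r : Fin 5) :
    IsInducedC5 G (fun i => v (i + r)) := by
  refine ⟨fun i j h => add_right_cancel (hv.1 h), fun i j => ?_⟩
  rw [hv.2]
  revert i j r
  decide

theorem setY_rotate (v : Fin 5 → V) (r i : Fin 5) :
    setY G (fun i => v (i + r)) i = setY G v (i + r) := by
  have hr : Set.range (fun i => v (i + r)) = Set.range v :=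
    (Equiv.addRight r).surjective.range_comp v
  ext u
  unfold setY
  rw [Set.mem_ofPred_eq, Set.mem_ofPred_eq, hr,
    ← (Equiv.addRight r).forall_congr_right (q := fun j =>
    G.Adj u (v j) ↔ (j = i + r - 1 ∨ j = i + r ∨ j = i + r + 1))]
  refine and_congr_right fun _ => forall_congr' fun j => iff_congr Iff.rfl ?_
  simp only [Equiv.coe_addRight]
  clear hr
  revert i j r
  decide

theorem isInducedC5_of_F1 (e : graphF1 ↪g G) :
    IsInducedC5 G (fun i => e i.castSucc) ∧ e 5 ∈ setY G (fun i => e i.castSucc) 0 := by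
  refine ⟨⟨fun i j h => Fin.castSucc_injective _ (e.injective h), fun i j => ?_⟩, ?_, fun j => ?_⟩
  · rw [e.map_adj_iff, graphF1, SimpleGraph.fromRel_adj]
    revert i j
    decide
  · rintro ⟨i, h⟩
    replace h := e.injective h
    revert i
    decide
  · rw [e.map_adj_iff, graphF1, SimpleGraph.fromRel_adj]
    revert j
    decide

/-- The possible arrangements, up to rotation, of a nonempty set of kinds. -/
theorem kinds_cases : ∀ p : Fin 5 → Bool, p 0 = true → ∃ r,
    (p (0 + r) = true ∧ p (1 + r) = true ∧ p (2 + r) = true ∧ p (3 + r) = true) ∨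
    (p (0 + r) = true ∧ p (2 + r) = true ∧ p (3 + r) = true ∧ p (1 + r) = false ∧
      p (4 + r) = false) ∨
    (p (0 + r) = true ∧ p (2 + r) = true ∧ p (1 + r) = false ∧ p (3 + r) = false ∧
      p (4 + r) = false) ∨
    (p (0 + r) = true ∧ p (2 + r) = false ∧ p (3 + r) = false) := by
  decide +kernel

end Cycle

theorem inClassC_or_chi_le_of_kinds {V : Type*} [Fintype V] {G : SimpleGraph V}
    (h1 : IsFreeOf G graphP2P3) (h2 : IsFreeOf G graphGem) {v : Fin 5 → V} (hv : IsInducedC5 G v)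
    {p : Fin 5 → Prop} (hp : ∀ i, p i ↔ (setY G v i).Nonempty)
    (h : (p 0 ∧ p 1 ∧ p 2 ∧ p 3) ∨ (p 0 ∧ p 2 ∧ p 3 ∧ ¬ p 1 ∧ ¬ p 4) ∨
      (p 0 ∧ p 2 ∧ ¬ p 1 ∧ ¬ p 3 ∧ ¬ p 4) ∨ (p 0 ∧ ¬ p 2 ∧ ¬ p 3)) :
    InClassC G ∨ G.chromaticNumber ≤ (G.cliqueNum + 1 : ℕ) := by
  simp only [hp] at h
  have hY : ∃ Y : Fin 5 → V, ∀ i, (setY G v i).Nonempty → Y i ∈ setY G v i := by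
    have : Nonempty V := ⟨v 0⟩
    choose! Y hY using fun i (h : (setY G v i).Nonempty) => h
    exact ⟨Y, hY⟩
  obtain ⟨Y, hY⟩ := hY
  rcases h with ⟨y0, y1, y2, y3⟩ | ⟨y0, y2, y3, n1, n4⟩ | ⟨y0, y2, n1, n3, n4⟩ | ⟨y0, n2, n3⟩
  · refine .inl (inClassC_of_four h1 h2
      (f := extend v Y fun i => [0, 1, 2, 3, 4, 0, 1, 2, 3].getD i 0)
      (rep_extend h2 hv ?_ (by decide +kernel) (by decide +kernel)))
    intro i hi h5
    interval_cases i
    exacts [hY 0 y0, hY 1 y1, hY 2 y2, hY 3 y3]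
  · have hf := rep_extend (k := fun i => [0, 1, 2, 3, 4, 0, 2, 3].getD i 0) (n := 8)
      (B := baseThree) h2 hv (Y := Y) (by
        intro i hi h5
        interval_cases i
        exacts [hY 0 y0, hY 2 y2, hY 3 y3]) (by decide +kernel) (by decide +kernel)
    have hY1 := noY_extend hv (Y := Y) (k := fun i => [0, 1, 2, 3, 4, 0, 2, 3].getD i 0) n1
      (a := 0) (b := 1) (c := 2) (d := 3) (e := 4) (by decide) (by decide)
    have hY4 := noY_extend hv (Y := Y) (k := fun i => [0, 1, 2, 3, 4, 0, 2, 3].getD i 0) n4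
      (a := 3) (b := 4) (c := 0) (d := 1) (e := 2) (by decide) (by decide)
    exact .inr ((typed_three h1 h2 hf hY1 hY4).three_bound hY1 hY4)
  · have hf := rep_extend (k := fun i => [0, 1, 2, 3, 4, 0, 2].getD i 0) (n := 7)
      (B := baseTwo) h2 hv (Y := Y) (by
        intro i hi h5
        interval_cases i
        exacts [hY 0 y0, hY 2 y2]) (by decide +kernel) (by decide +kernel)
    exact .inr (Two.of_rep h1 h2 hf
      (noY_extend hv n1 (by decide) (by decide)) (noY_extend hv n3 (by decide) (by decide))
      (noY_extend hv n4 (by decide) (by decide))).bound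
  · have hf := rep_extend (k := fun i => [0, 1, 2, 3, 4, 0].getD i 0) (n := 6)
      (B := baseMono) h2 hv (Y := Y) (by
        intro i hi h5
        interval_cases i
        exacts [hY 0 y0]) (by decide +kernel) (by decide +kernel)
    exact .inr (Mono.of_rep h1 h2 hf
      (noY_extend hv n2 (by decide) (by decide)) (noY_extend hv n3 (by decide) (by decide))).bound

end F1Proof

/-- A (P2+P3, gem)-free graph containing an induced `F1` is in `𝒞` or satisfies
`χ(G) ≤ ω(G) + 1`. -/
theorem inClassC_or_chi_le_of_F1 {V : Type*} [Fintype V] (G : SimpleGraph V)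
    (h1 : IsFreeOf G graphP2P3) (h2 : IsFreeOf G graphGem)
    (hF : Nonempty (graphF1 ↪g G)) :
    InClassC G ∨ G.chromaticNumber ≤ (G.cliqueNum : ℕ∞) + 1 := by
  classical
  obtain ⟨e⟩ := hF
  obtain ⟨hv, hu⟩ := F1Proof.isInducedC5_of_F1 e
  set v : Fin 5 → V := fun i => e i.castSucc
  obtain ⟨r, hr⟩ := F1Proof.kinds_cases (fun i => decide (setY G v i).Nonempty)
    (decide_eq_true ⟨_, hu⟩)
  simp only [decide_eq_true_eq, decide_eq_false_iff_not, ← F1Proof.setY_rotate] at hr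
  have := F1Proof.inClassC_or_chi_le_of_kinds h1 h2 (F1Proof.IsInducedC5.rotate hv r)
    (p := fun i => (setY G (fun i => v (i + r)) i).Nonempty)
    (fun _ => Iff.rfl) hr
  exact_mod_cast this
end

section
/- Let G be a (P2+P3, gem, F1)-free graph. If G contains an induced F2, then χ(G) ≤ ω(G) + 1. -/
open SimpleGraph

/-- The `i`-th binary digit of `m`. -/
def bit (m i : ℕ) : Bool := Nat.beq (Nat.land (Nat.shiftRight m i) 1) 1

/-- The neighbourhoods in `graphF2` of its vertices, as bit masks. -/
def rowF2 : ℕ → ℕ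
  | 0 => 114 | 1 => 5 | 2 => 106 | 3 => 116 | 4 => 9 | 5 => 77 | _ => 45

/-- The choice among three values made by the indices `7`, `8` and above. -/
def pick {α : Type*} (a b c : α) (i : ℕ) : α :=
  bif Nat.beq i 7 then a else bif Nat.beq i 8 then b else c

/-- The adjacency relation of `graphF2`, with vertices `0` to `6`, extended by vertices `7`, `8` and
`9` with neighbourhoods `m₁`, `m₂`, `m₃` in it and mutual adjacencies `r₁`, `r₂`, `r₃`. -/
def extAdj (m₁ m₂ m₃ : ℕ) (r₁ r₂ r₃ : Bool) (i j : ℕ) : Bool :=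
  bif Nat.ble i 6 then
    bif Nat.ble j 6 then bit (rowF2 i) j else bit (pick m₁ m₂ m₃ j) i
  else bif Nat.ble j 6 then bit (pick m₁ m₂ m₃ i) j
  else pick (pick false r₁ r₂ j) (pick r₁ false r₃ j) (pick r₂ r₃ false j) i

/-- A search for an induced `P2 + P3` among the vertices in `l`. -/
def searchP2P3 (l : List ℕ) (r : ℕ → ℕ → Bool) : Bool :=
  l.any fun a => l.any fun b => r a b && l.any fun c => !r a c && !r b c &&
    l.any fun d => r c d && !r a d && !r b d &&
      l.any fun e => r d e && !r c e && !r a e && !r b e && l.any fun z => r c z && !r e z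

/-- A search for an induced gem among the vertices in `l`. -/
def searchGem (l : List ℕ) (r : ℕ → ℕ → Bool) : Bool :=
  l.any fun b => l.any fun e => r b e && l.any fun a => r a b && r e a &&
    l.any fun c => r b c && r e c && !r a c &&
      l.any fun d => r c d && r e d && !r a d && !r b d

/-- A search for an induced `F1` among the vertices in `l`. -/
def searchF1 (l : List ℕ) (r : ℕ → ℕ → Bool) : Bool :=
  l.any fun a => l.any fun b => r a b && l.any fun f => r f a && r f b &&
    l.any fun c => r b c && !r a c && !r f c &&
      l.any fun e => r e a && r f e && !r b e && !r c e &&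
        l.any fun d => r c d && r d e && !r a d && !r b d && !r f d

/-- A search for an induced `P2 + P3`, gem or `F1`. -/
@[irreducible] def search (l : List ℕ) (r : ℕ → ℕ → Bool) : Bool :=
  searchGem l r || searchP2P3 l r || searchF1 l r

/-- `search` applied to all extensions of `graphF2` by two vertices with neighbourhoods in `l₁`,
`l₂` and mutual adjacency in `s`. -/
@[irreducible] def excl₂ (l₁ l₂ : List ℕ) (s : List Bool) : Bool :=
  l₁.all fun a => l₂.all fun b => s.all fun t =>
    search [7, 8, 0, 1, 2, 3, 4, 5, 6] (extAdj a b b t t false)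

/-- `search` applied to all extensions of `graphF2` by three vertices with neighbourhoods in
`l₁`, `l₂`, `l₃`, where the first is adjacent to the second, and adjacent to the third iff `s`. -/
@[irreducible] def excl₃ (l₁ l₂ l₃ : List ℕ) (s : Bool) : Bool :=
  l₁.all fun a => l₂.all fun b => l₃.all fun c => [true, false].all fun t =>
    search [7, 8, 9, 0, 1, 2, 3, 4, 5, 6] (extAdj a b c true s t)

theorem bit_eq_testBit (m i : ℕ) : bit m i = m.testBit i := by
  have h : bit m i = Nat.beq (m >>> i &&& 1) 1 := rfl
  rw [h, Nat.and_one_is_mod, Nat.testBit_eq_decide_div_mod_eq, Nat.shiftRight_eq_div_pow,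
    Bool.eq_iff_iff, Nat.beq_eq, decide_eq_true_iff]

theorem pick_apply {α β : Type*} (f : α → β) (a b c : α) (i : ℕ) :
    f (pick a b c i) = pick (f a) (f b) (f c) i := by
  unfold pick
  cases Nat.beq i 7 <;> cases Nat.beq i 8 <;> rfl

section Forbidden

variable {V : Type*} {G : SimpleGraph V}

theorem IsFreeOf.false_of_adj_iff {n : ℕ} {H : SimpleGraph (Fin n)} (h : IsFreeOf G H)
    (f : Fin n → V) (hinj : Function.Injective f)
    (hf : ∀ i j, G.Adj (f i) (f j) ↔ H.Adj i j) : False :=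
  h.false ⟨⟨f, hinj⟩, hf _ _⟩

theorem IsFreeOf.p2p3 (h : IsFreeOf G graphP2P3) {a b c d e : V} (hab : G.Adj a b)
    (hcd : G.Adj c d) (hde : G.Adj d e) (hac : ¬ G.Adj a c) (had : ¬ G.Adj a d)
    (hae : ¬ G.Adj a e) (hbc : ¬ G.Adj b c) (hbd : ¬ G.Adj b d) (hbe : ¬ G.Adj b e)
    (hce : ¬ G.Adj c e) (hne : c ≠ e) : False := by
  refine h.false_of_adj_iff ![a, b, c, d, e] ?_ ?_
  · intro i j hij
    fin_cases i <;> fin_cases j <;> simp_all [G.adj_comm]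
  · intro i j
    fin_cases i <;> fin_cases j <;> simp_all [graphP2P3, G.adj_comm]

theorem IsFreeOf.gem (h : IsFreeOf G graphGem) {a b c d e : V} (hab : G.Adj a b)
    (hbc : G.Adj b c) (hcd : G.Adj c d) (hea : G.Adj e a) (heb : G.Adj e b) (hec : G.Adj e c)
    (hed : G.Adj e d) (hac : ¬ G.Adj a c) (had : ¬ G.Adj a d) (hbd : ¬ G.Adj b d) : False := by
  refine h.false_of_adj_iff ![a, b, c, d, e] ?_ ?_
  · intro i j hij
    fin_cases i <;> fin_cases j <;> simp_all [G.adj_comm]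
  · intro i j
    fin_cases i <;> fin_cases j <;> simp_all [graphGem, G.adj_comm]

theorem IsFreeOf.f1 (h : IsFreeOf G graphF1) {a b c d e f : V} (hab : G.Adj a b)
    (hbc : G.Adj b c) (hcd : G.Adj c d) (hde : G.Adj d e) (hea : G.Adj e a) (hfe : G.Adj f e)
    (hfa : G.Adj f a) (hfb : G.Adj f b) (hac : ¬ G.Adj a c) (had : ¬ G.Adj a d)
    (hbd : ¬ G.Adj b d) (hbe : ¬ G.Adj b e) (hce : ¬ G.Adj c e) (hfc : ¬ G.Adj f c)
    (hfd : ¬ G.Adj f d) : False := by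
  refine h.false_of_adj_iff ![a, b, c, d, e, f] ?_ ?_
  · intro i j hij
    fin_cases i <;> fin_cases j <;> simp_all [G.adj_comm]
  · intro i j
    fin_cases i <;> fin_cases j <;> simp_all [graphF1, G.adj_comm]

theorem search_eq_false (h1 : IsFreeOf G graphP2P3) (h2 : IsFreeOf G graphGem)
    (hF1 : IsFreeOf G graphF1) (l : List ℕ) {r : ℕ → ℕ → Bool} {ψ : ℕ → V}
    (hr : ∀ i j, r i j = true ↔ G.Adj (ψ i) (ψ j)) : search l r = false := by
  have hr' : ∀ i j, r i j = false ↔ ¬ G.Adj (ψ i) (ψ j) := by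
    intro i j
    rw [← hr, Bool.not_eq_true]
  rw [← Bool.not_eq_true]
  intro h
  simp only [search, Bool.or_eq_true] at h
  rcases h with (h | h) | h
  · simp only [searchGem, List.any_eq_true, Bool.and_eq_true, Bool.not_eq_true', hr, hr'] at h
    obtain ⟨b, -, e, -, hbe, a, -, ⟨hab, hea⟩, c, -, ⟨⟨hbc, hec⟩, hac⟩, d, -, ⟨⟨hcd, hed⟩, had⟩, hbd⟩
      := h
    exact h2.gem hab hbc hcd hea hbe.symm hec hed hac had hbd
  · simp only [searchP2P3, List.any_eq_true, Bool.and_eq_true, Bool.not_eq_true', hr, hr'] at h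
    obtain ⟨a, -, b, -, hab, c, -, ⟨hac, hbc⟩, d, -, ⟨⟨hcd, had⟩, hbd⟩, e, -,
      ⟨⟨⟨hde, hce⟩, hae⟩, hbe⟩, z, -, hcz, hez⟩ := h
    exact h1.p2p3 hab hcd hde hac had hae hbc hbd hbe hce fun h => hez (h ▸ hcz)
  · simp only [searchF1, List.any_eq_true, Bool.and_eq_true, Bool.not_eq_true', hr, hr'] at h
    obtain ⟨a, -, b, -, hab, f, -, ⟨hfa, hfb⟩, c, -, ⟨⟨hbc, hac⟩, hfc⟩, e, -,
      ⟨⟨⟨hea, hfe⟩, hbe⟩, hce⟩, d, -, ⟨⟨⟨hcd, hde⟩, had⟩, hbd⟩, hfd⟩ := h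
    exact hF1.f1 hab hbc hcd hde hea hfe hfa hfb hac had hbd hbe hce hfc hfd

end Forbidden

/-- The first seven values of `φ` span a copy of `graphF2` in `G`, and `code u` is the bit mask of
the neighbourhood of `u` in this copy. -/
structure IsCoding {V : Type*} (G : SimpleGraph V) (φ : ℕ → V) (code : V → ℕ) : Prop where
  base : ∀ i < 7, ∀ j < 7, bit (rowF2 i) j = true ↔ G.Adj (φ i) (φ j)
  lt : ∀ u, code u < 128
  bits : ∀ u, ∀ i < 7, bit (code u) i = true ↔ G.Adj u (φ i)

section Coding

variable {V : Type*} {G : SimpleGraph V} {φ : ℕ → V} {code : V → ℕ}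

theorem exists_isCoding (hφ : ∀ i < 7, ∀ j < 7, bit (rowF2 i) j = true ↔ G.Adj (φ i) (φ j)) :
    ∃ code, IsCoding G φ code := by
  classical
  refine ⟨fun u => Nat.ofBits fun i : Fin 7 => decide (G.Adj u (φ i)), hφ,
    fun u => Nat.ofBits_lt_two_pow _, fun u i hi => ?_⟩
  rw [bit_eq_testBit, Nat.testBit_ofBits_lt _ _ hi, decide_eq_true_iff]

theorem IsCoding.search_eq_false (hc : IsCoding G φ code) (h1 : IsFreeOf G graphP2P3)
    (h2 : IsFreeOf G graphGem) (hF1 : IsFreeOf G graphF1) (l : List ℕ) (u v w : V)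
    {r₁ r₂ r₃ : Bool} (huv : r₁ = true ↔ G.Adj u v) (huw : r₂ = true ↔ G.Adj u w)
    (hvw : r₃ = true ↔ G.Adj v w) :
    search l (extAdj (code u) (code v) (code w) r₁ r₂ r₃) = false := by
  refine _root_.search_eq_false h1 h2 hF1 l
    (ψ := fun i => bif Nat.ble i 6 then φ i else pick u v w i) fun i j => ?_
  have hlt : ∀ k, Nat.ble k 6 = true → k < 7 := fun k hk =>
    Nat.lt_succ_of_le (Nat.le_of_ble_eq_true hk)
  unfold extAdj
  cases hi : Nat.ble i 6 <;> cases hj : Nat.ble j 6 <;> simp only [cond_true, cond_false]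
  · unfold pick
    cases Nat.beq i 7 <;> cases Nat.beq i 8 <;> cases Nat.beq j 7 <;> cases Nat.beq j 8 <;>
      simp [huv, huw, hvw, G.adj_comm]
  · rw [← pick_apply code, hc.bits _ _ (hlt _ hj)]
  · rw [← pick_apply code, hc.bits _ _ (hlt _ hi), G.adj_comm]
  · exact hc.base _ (hlt _ hi) _ (hlt _ hj)

end Coding

section Coloring

variable {V : Type*} {G : SimpleGraph V}

theorem exists_coloring_of_isFreeP4 [Fintype V] (H : SimpleGraph V)
    (hP4 : ∀ a b c d, H.Adj a b → H.Adj b c → H.Adj c d → ¬ H.Adj a c → ¬ H.Adj a d →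
      ¬ H.Adj b d → False) :
    ∃ c : V → ℕ, (∀ u w, H.Adj u w → c u ≠ c w) ∧
      ∀ v, ∃ s : Finset V, H.IsClique (s : Set V) ∧ s.card = c v + 1 := by
  classical
  obtain ⟨c, hc, hmin⟩ : ∃ c : V → ℕ, (∀ u w, H.Adj u w → c u ≠ c w) ∧
      ∀ v, ∀ j < c v, ∃ w, H.Adj v w ∧ c w = j := by
    let P : ℕ → Prop := fun n => ∃ c : V → ℕ, (∀ u w, H.Adj u w → c u ≠ c w) ∧ ∑ v, c v = n
    have hP : ∃ n, P n := by
      refine ⟨_, fun v => (Fintype.equivFin V v : ℕ), fun u w huw h => huw.ne ?_, rfl⟩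
      exact (Fintype.equivFin V).injective (Fin.ext h)
    obtain ⟨c, hc, hsum⟩ := Nat.find_spec hP
    refine ⟨c, hc, fun v j hj => ?_⟩
    by_contra! hno
    refine Nat.find_min hP (m := ∑ x, Function.update c v j x) ?_
      ⟨Function.update c v j, fun u w huw => ?_, rfl⟩
    · rw [← hsum]
      refine Finset.sum_lt_sum (fun x _ => ?_) ⟨v, Finset.mem_univ v, by simpa using hj⟩
      rcases eq_or_ne x v with rfl | hx
      · simpa using hj.le
      · simp [hx]
    · rcases eq_or_ne u v with rfl | hu
      · simpa [huw.ne'] using (hno w huw).symm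
      · rcases eq_or_ne w v with rfl | hw
        · simpa [hu] using hno u huw.symm
        · simpa [hu, hw] using hc u w huw
  refine ⟨c, hc, fun v => ?_⟩
  have key : ∀ n ≤ c v, ∃ s : Finset V, H.IsClique (s : Set V) ∧ s.card = n + 1 ∧
      ∀ x ∈ s, c v - n ≤ c x := by
    intro n
    induction n with
    | zero => exact fun _ => ⟨{v}, by simp, by simp, by simp⟩
    | succ n ih =>
      intro hn
      obtain ⟨s, hs, hcard, hle⟩ := ih (by omega)
      have hnb : ∀ x ∈ s, ∃ w, H.Adj x w ∧ c w = c v - (n + 1) := fun x hx =>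
        hmin x _ (by have := hle x hx; omega)
      obtain ⟨x₀, hx₀⟩ : s.Nonempty := Finset.card_pos.1 (by omega)
      obtain ⟨w₀, -, hw₀⟩ := hnb x₀ hx₀
      obtain ⟨u, hu, hmax⟩ := Finset.exists_max_image
        (Finset.univ.filter fun w => c w = c v - (n + 1))
        (fun w => (s.filter fun x => H.Adj w x).card) ⟨w₀, by simp [hw₀]⟩
      simp only [Finset.mem_filter, Finset.mem_univ, true_and] at hu hmax
      by_cases hall : ∀ x ∈ s, H.Adj u x
      · refine ⟨insert u s, ?_, ?_, ?_⟩
        · rw [Finset.coe_insert]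
          exact hs.insert fun x hx _ => hall x hx
        · rw [Finset.card_insert_of_notMem fun h => (hall u h).ne rfl, hcard]
        · intro x hx
          rcases Finset.mem_insert.1 hx with rfl | hx
          · exact hu.ge
          · have := hle x hx
            omega
      · push Not at hall
        obtain ⟨q, hq, huq⟩ := hall
        obtain ⟨w, hqw, hw⟩ := hnb q hq
        obtain ⟨y, hy, huy, hwy⟩ : ∃ y ∈ s, H.Adj u y ∧ ¬ H.Adj w y := by
          by_contra! hsub
          refine (hmax w hw).not_gt (Finset.card_lt_card ?_)
          refine (Finset.ssubset_iff_of_subset fun x hx => ?_).2 ⟨q, ?_, ?_⟩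
          · rw [Finset.mem_filter] at hx ⊢
            exact ⟨hx.1, hsub x hx.1 hx.2⟩
          · simp [hq, hqw.symm]
          · simp [huq]
        have hyq : H.Adj y q := hs hy hq fun h => huq (h ▸ huy)
        exact (hP4 u y q w huy hyq hqw huq (fun h => hc u w h (hu.trans hw.symm))
          fun h => hwy h.symm).elim
  obtain ⟨s, hs, hcard, -⟩ := key (c v) le_rfl
  exact ⟨s, hs, hcard⟩

theorem colorable_of_cover {n : ℕ} (hn : 2 ≤ n) {c : V → ℕ} {Z S T A B C : V → Prop}
    (hcov : ∀ u, Z u ∨ S u ∨ T u ∨ A u ∨ B u ∨ C u)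
    (hlt : ∀ u, Z u → c u < n) (hZ : ∀ u w, Z u → Z w → G.Adj u w → c u ≠ c w)
    (hZS : ∀ u w, Z u → S w → ¬ G.Adj u w) (hZT : ∀ u w, Z u → T w → ¬ G.Adj u w)
    (hS : ∀ u w, S u → S w → ¬ G.Adj u w) (hT : ∀ u w, T u → T w → ¬ G.Adj u w)
    (hA : ∀ u w, A u → A w → ¬ G.Adj u w) (hB : ∀ u w, B u → B w → ¬ G.Adj u w)
    (hC : ∀ u w, C u → C w → ¬ G.Adj u w) : G.Colorable (n + 3) := by
  classical
  let f : V → ℕ := fun u => if Z u then c u else if S u then 0 else if T u then 1 else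
    if A u then n else if B u then n + 1 else n + 2
  have hf : ∀ u, f u < n + 3 := by
    intro u
    have := hlt u
    simp only [f]
    split_ifs <;> grind
  refine ⟨Coloring.mk (fun u => (⟨f u, hf u⟩ : Fin (n + 3))) fun {u w} huw h => ?_⟩
  have h' : f u = f w := congrArg Fin.val h
  have hwu := huw.symm
  have := hlt u
  have := hlt w
  have := hcov u
  have := hcov w
  simp only [f] at h'
  split_ifs at h' <;> grind

end Coloring

section Coding

variable {V : Type*} {G : SimpleGraph V} {φ : ℕ → V} {code : V → ℕ}

theorem search_extAdj_one : ∀ m < 128,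
    search [7, 0, 1, 2, 3, 4, 5, 6] (extAdj m m m false false false) = true ∨
      m ∈ [0, 32, 64, 96, 13, 45, 77, 109, 11, 21, 1, 12, 5, 9, 4, 8, 50, 82, 114, 100, 104, 108,
        106, 97, 98, 99, 116, 112, 113] := by
  decide +kernel

theorem IsCoding.not_adj_of_excl₂ (hc : IsCoding G φ code) (h1 : IsFreeOf G graphP2P3)
    (h2 : IsFreeOf G graphGem) (hF1 : IsFreeOf G graphF1) {l₁ l₂ : List ℕ}
    (h : excl₂ l₁ l₂ [true] = true) ⦃u v : V⦄ (hu : code u ∈ l₁) (hv : code v ∈ l₂) :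
    ¬ G.Adj u v := by
  intro huv
  simp only [excl₂, List.all_eq_true] at h
  have := h _ hu _ hv true (List.mem_singleton.2 rfl)
  rw [hc.search_eq_false h1 h2 hF1 _ u v v (by simpa using huv) (by simpa using huv)
    (by simp)] at this
  exact Bool.false_ne_true this

theorem IsCoding.false_of_excl₂ (hc : IsCoding G φ code) (h1 : IsFreeOf G graphP2P3)
    (h2 : IsFreeOf G graphGem) (hF1 : IsFreeOf G graphF1) {l₁ l₂ : List ℕ}
    (h : excl₂ l₁ l₂ [true, false] = true) ⦃u v : V⦄ (hu : code u ∈ l₁) (hv : code v ∈ l₂) :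
    False := by
  classical
  simp only [excl₂, List.all_eq_true] at h
  have := h _ hu _ hv (decide (G.Adj u v)) (by cases decide (G.Adj u v) <;> simp)
  rw [hc.search_eq_false h1 h2 hF1 _ u v v (by simp) (by simp) (by simp)] at this
  exact Bool.false_ne_true this

theorem IsCoding.false_of_excl₃ (hc : IsCoding G φ code) (h1 : IsFreeOf G graphP2P3)
    (h2 : IsFreeOf G graphGem) (hF1 : IsFreeOf G graphF1) {l₁ l₂ l₃ : List ℕ} {s : Bool}
    (h : excl₃ l₁ l₂ l₃ s = true) ⦃u v w : V⦄ (hu : code u ∈ l₁) (hv : code v ∈ l₂)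
    (hw : code w ∈ l₃) (huv : G.Adj u v) (huw : s = true ↔ G.Adj u w) : False := by
  classical
  simp only [excl₃, List.all_eq_true] at h
  have := h _ hu _ hv _ hw (decide (G.Adj v w)) (by cases decide (G.Adj v w) <;> simp)
  rw [hc.search_eq_false h1 h2 hF1 _ u v w (by simpa using huv) huw (by simp)] at this
  exact Bool.false_ne_true this

theorem IsCoding.code_mem (hc : IsCoding G φ code) (h1 : IsFreeOf G graphP2P3)
    (h2 : IsFreeOf G graphGem) (hF1 : IsFreeOf G graphF1) (u : V) :
    code u ∈ [0, 32, 64, 96, 13, 45, 77, 109, 11, 21, 1, 12, 5, 9, 4, 8, 50, 82, 114, 100, 104, 108,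
      106, 97, 98, 99, 116, 112, 113] := by
  refine (search_extAdj_one _ (hc.lt u)).resolve_left fun h => ?_
  rw [hc.search_eq_false h1 h2 hF1 _ u u u (by simp) (by simp) (by simp)] at h
  exact Bool.false_ne_true h

/-- The graph obtained from `G` by isolating the vertices outside `Z`. -/
def isolateCompl (G : SimpleGraph V) (Z : V → Prop) : SimpleGraph V where
  Adj u w := Z u ∧ Z w ∧ G.Adj u w
  symm := ⟨fun _ _ h => ⟨h.2.1, h.1, h.2.2.symm⟩⟩
  loopless := ⟨fun _ h => h.2.2.ne rfl⟩

theorem isClique_card_add_two_le [Fintype V] {s : Finset V} (hs : G.IsClique (s : Set V))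
    {x y : V} (hxy : G.Adj x y) (h : ∀ u ∈ s, G.Adj u x ∧ G.Adj u y) :
    s.card + 2 ≤ G.cliqueNum := by
  classical
  have hy : G.IsClique ((insert y s : Finset V) : Set V) := by
    rw [Finset.coe_insert]
    exact hs.insert fun u hu _ => (h u hu).2.symm
  have hx : G.IsClique ((insert x (insert y s) : Finset V) : Set V) := by
    rw [Finset.coe_insert]
    refine hy.insert fun u hu _ => ?_
    rcases Finset.mem_insert.1 hu with rfl | hu
    · exact hxy
    · exact (h u hu).1.symm
  have hcard : (insert x (insert y s)).card = s.card + 2 := by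
    rw [Finset.card_insert_of_notMem, Finset.card_insert_of_notMem]
    · exact fun hm => (h y hm).2.ne rfl
    · intro hm
      rcases Finset.mem_insert.1 hm with rfl | hm
      · exact hxy.ne rfl
      · exact (h x hm).1.ne rfl
  exact hcard ▸ hx.card_le_cliqueNum

theorem IsCoding.adj (hc : IsCoding G φ code) {u : V} {l : List ℕ} (hu : code u ∈ l) {i : ℕ}
    (hi : i < 7) (hl : ∀ m ∈ l, bit m i = true) : G.Adj u (φ i) :=
  (hc.bits u i hi).1 (hl _ hu)

theorem IsCoding.four_le_cliqueNum [Fintype V] (hc : IsCoding G φ code) : 4 ≤ G.cliqueNum := by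
  classical
  have h56 : G.Adj (φ 5) (φ 6) := (hc.base 5 (by norm_num) 6 (by norm_num)).1 (by decide)
  have h23 : G.Adj (φ 2) (φ 3) := (hc.base 2 (by norm_num) 3 (by norm_num)).1 (by decide)
  have := isClique_card_add_two_le (s := {φ 5, φ 6}) (by simpa [isClique_pair] using fun _ => h56)
    h23 (by
      simp only [Finset.mem_insert, Finset.mem_singleton, forall_eq_or_imp, forall_eq]
      refine ⟨⟨?_, ?_⟩, ?_, ?_⟩ <;> exact (hc.base _ (by norm_num) _ (by norm_num)).1 (by decide))
  rwa [Finset.card_pair h56.ne] at this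

/-- The bit masks of the vertices that receive the first `G.cliqueNum - 2` colours. -/
def cliqueCodes : List ℕ := [13, 45, 77, 109, 11, 21, 1, 12]

theorem excl₂_12 : excl₂ [12] [11, 21, 1] [true, false] = true := by
  decide +kernel

theorem excl₂_1 : excl₂ [1] [11, 21, 12, 1] [true] = true := by
  decide +kernel

theorem excl₂_mixed : excl₂ [13, 45, 77, 109, 12] [11, 21] [true] = true := by
  decide +kernel

theorem excl₂_11_21 : excl₂ [11] [21] [true] = true := by
  decide +kernel

theorem IsCoding.exists_common_adj (hc : IsCoding G φ code) (h1 : IsFreeOf G graphP2P3)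
    (h2 : IsFreeOf G graphGem) (hF1 : IsFreeOf G graphF1) :
    ∃ x, ∀ u, code u ∈ cliqueCodes → G.Adj u x := by
  by_cases h : ∃ b, code b ∈ [12]
  · obtain ⟨b, hb⟩ := h
    refine ⟨φ 2, fun u hu => ?_⟩
    have hno : code u ∉ [11, 21, 1] := fun hu' =>
      hc.false_of_excl₂ h1 h2 hF1 excl₂_12 hb hu'
    refine hc.adj (l := [13, 45, 77, 109, 12]) ?_ (by norm_num) (by decide)
    simp only [cliqueCodes, List.mem_cons, List.not_mem_nil, or_false] at hu hno ⊢
    omega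
  · refine ⟨φ 0, fun u hu => hc.adj (l := [13, 45, 77, 109, 11, 21, 1]) ?_ (by norm_num)
      (by decide)⟩
    have hno : code u ∉ [12] := fun hu' => h ⟨u, hu'⟩
    simp only [cliqueCodes, List.mem_cons, List.not_mem_nil, or_false] at hu hno ⊢
    omega

theorem IsCoding.clique_card_add_two_le [Fintype V] (hc : IsCoding G φ code)
    (h1 : IsFreeOf G graphP2P3) (h2 : IsFreeOf G graphGem) (hF1 : IsFreeOf G graphF1)
    (hA : ∀ a z z', code a ∈ [1] → code z ∈ [13, 45, 77, 109] → code z' ∈ [13, 45, 77, 109] →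
      G.Adj a z → G.Adj a z' → G.Adj z z' → False)
    {s : Finset V} (hs : G.IsClique (s : Set V)) (hsZ : ∀ u ∈ s, code u ∈ cliqueCodes) :
    s.card + 2 ≤ G.cliqueNum := by
  classical
  have h4 := hc.four_le_cliqueNum
  rcases le_or_gt s.card 2 with h | hcard
  · omega
  have hone : ∀ a ∈ s, code a ≠ 1 := by
    intro a ha ha1
    have hz : ∀ z ∈ s.erase a, G.Adj a z ∧ code z ∈ [13, 45, 77, 109] := by
      intro z hz
      rw [Finset.mem_erase] at hz
      have haz : G.Adj a z := hs ha hz.2 hz.1.symm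
      refine ⟨haz, ?_⟩
      have hno : code z ∉ [11, 21, 12, 1] := fun h =>
        hc.not_adj_of_excl₂ h1 h2 hF1 excl₂_1 (List.mem_singleton.2 ha1) h haz
      have := hsZ z hz.2
      simp only [cliqueCodes, List.mem_cons, List.not_mem_nil, or_false] at this hno ⊢
      omega
    obtain ⟨z, hzs, z', hzs', hne⟩ := Finset.one_lt_card.1
      (show 1 < (s.erase a).card by rw [Finset.card_erase_of_mem ha]; omega)
    exact hA a z z' (List.mem_singleton.2 ha1) (hz z hzs).2 (hz z' hzs').2 (hz z hzs).1
      (hz z' hzs').1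
      (hs (Finset.mem_of_mem_erase hzs) (Finset.mem_of_mem_erase hzs') hne)
  have hbase : ∀ i < 7, ∀ j < 7, bit (rowF2 i) j = true → G.Adj (φ i) (φ j) :=
    fun i hi j hj => (hc.base i hi j hj).1
  have hmem : ∀ u ∈ s, code u ∈ [13, 45, 77, 109, 12] ∨ code u ∈ [11] ∨ code u ∈ [21] := by
    intro u hu
    have := hone u hu
    have := hsZ u hu
    simp only [cliqueCodes, List.mem_cons, List.not_mem_nil, or_false] at this ⊢
    omega
  have hadj : ∀ {u w}, u ∈ s → w ∈ s → code u ≠ code w → G.Adj u w :=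
    fun hu hw h => hs hu hw fun h' => h (h' ▸ rfl)
  have hmix : ∀ u ∈ s, ∀ w ∈ s, code u ∈ [13, 45, 77, 109, 12] → code w ∉ [11, 21] :=
    fun u hu w hw h h' => hc.not_adj_of_excl₂ h1 h2 hF1 excl₂_mixed h h'
      (hadj hu hw (by
        simp only [List.mem_cons, List.not_mem_nil, or_false] at h h'
        omega))
  have hmix' : ∀ u ∈ s, ∀ w ∈ s, code u ∈ [11] → code w ∉ [21] :=
    fun u hu w hw h h' => hc.not_adj_of_excl₂ h1 h2 hF1 excl₂_11_21 h h'
      (hadj hu hw (by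
        simp only [List.mem_cons, List.not_mem_nil, or_false] at h h'
        omega))
  have hall : (∀ u ∈ s, code u ∈ [13, 45, 77, 109, 12]) ∨ (∀ u ∈ s, code u ∈ [11]) ∨
      ∀ u ∈ s, code u ∈ [21] := by
    obtain ⟨u, hu⟩ : s.Nonempty := Finset.card_pos.1 (by omega)
    have hlist : ∀ w, code w ∈ [11, 21] ↔ code w ∈ [11] ∨ code w ∈ [21] := fun w => by
      simp
    rcases hmem u hu with h | h | h
    · refine Or.inl fun w hw => (hmem w hw).resolve_right fun h' => ?_
      exact hmix u hu w hw h ((hlist w).2 h')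
    · refine Or.inr (Or.inl fun w hw => ?_)
      rcases hmem w hw with h' | h' | h'
      · exact (hmix w hw u hu h' ((hlist u).2 (Or.inl h))).elim
      · exact h'
      · exact (hmix' u hu w hw h h').elim
    · refine Or.inr (Or.inr fun w hw => ?_)
      rcases hmem w hw with h' | h' | h'
      · exact (hmix w hw u hu h' ((hlist u).2 (Or.inr h))).elim
      · exact (hmix' w hw u hu h' h).elim
      · exact h'
  rcases hall with h | h | h
  · exact isClique_card_add_two_le hs (hbase 2 (by norm_num) 3 (by norm_num) (by decide))
      fun w hw => ⟨hc.adj (h w hw) (by norm_num) (by decide),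
        hc.adj (h w hw) (by norm_num) (by decide)⟩
  · exact isClique_card_add_two_le hs (hbase 0 (by norm_num) 1 (by norm_num) (by decide))
      fun w hw => ⟨hc.adj (h w hw) (by norm_num) (by decide),
        hc.adj (h w hw) (by norm_num) (by decide)⟩
  · exact isClique_card_add_two_le hs (hbase 0 (by norm_num) 4 (by norm_num) (by decide))
      fun w hw => ⟨hc.adj (h w hw) (by norm_num) (by decide),
        hc.adj (h w hw) (by norm_num) (by decide)⟩

theorem IsCoding.exists_clique_coloring [Fintype V] (hc : IsCoding G φ code)
    (h1 : IsFreeOf G graphP2P3) (h2 : IsFreeOf G graphGem) (hF1 : IsFreeOf G graphF1)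
    (hA : ∀ a z z', code a ∈ [1] → code z ∈ [13, 45, 77, 109] → code z' ∈ [13, 45, 77, 109] →
      G.Adj a z → G.Adj a z' → G.Adj z z' → False) :
    ∃ c : V → ℕ, (∀ u, c u + 2 < G.cliqueNum) ∧ ∀ u w, code u ∈ cliqueCodes →
      code w ∈ cliqueCodes → G.Adj u w → c u ≠ c w := by
  classical
  obtain ⟨x, hx⟩ := hc.exists_common_adj h1 h2 hF1
  obtain ⟨c, hcol, hcl⟩ := exists_coloring_of_isFreeP4
    (isolateCompl G fun u => code u ∈ cliqueCodes) (by
      rintro a b c d ⟨ha, hb, hab⟩ ⟨-, hc', hbc⟩ ⟨-, hd, hcd⟩ hac had hbd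
      exact h2.gem hab hbc hcd (hx a ha).symm (hx b hb).symm (hx c hc').symm (hx d hd).symm
        (fun h => hac ⟨ha, hc', h⟩) (fun h => had ⟨ha, hd, h⟩) fun h => hbd ⟨hb, hd, h⟩)
  refine ⟨c, fun v => ?_, fun u w hu hw huw => hcol u w ⟨hu, hw, huw⟩⟩
  obtain ⟨s, hs, hcard⟩ := hcl v
  have h4 := hc.four_le_cliqueNum
  rcases Nat.eq_zero_or_pos (c v) with h0 | hpos
  · omega
  have hG : G.IsClique (s : Set V) := fun u hu w hw huw => (hs hu hw huw).2.2
  have := hc.clique_card_add_two_le h1 h2 hF1 hA hG fun u hu => by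
    obtain ⟨w, hw, hwu⟩ := Finset.exists_mem_ne (show 1 < s.card by omega) u
    exact (hs hu hw hwu.symm).1
  omega

end Coding

section Classes

variable {V : Type*} {G : SimpleGraph V} {φ : ℕ → V} {code : V → ℕ}

/-- The vertex `u` has a neighbour with bit mask `m`. -/
def HasNbr (G : SimpleGraph V) (code : V → ℕ) (u : V) (m : ℕ) : Prop :=
  ∃ v, G.Adj u v ∧ code v ∈ [m]

/-- The first of the three additional colour classes. -/
def ClassA (G : SimpleGraph V) (code : V → ℕ) (u : V) : Prop :=
  (code u ∈ [50, 82, 114] ∧ ¬ HasNbr G code u 108) ∨ code u ∈ [100, 104] ∨ code u ∈ [108] ∨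
    (code u ∈ [0, 32, 64, 96] ∧ ∃ b, code b ∈ [108])

/-- The second of the three additional colour classes. -/
def ClassB (G : SimpleGraph V) (code : V → ℕ) (u : V) : Prop :=
  (code u ∈ [50, 82, 114] ∧ HasNbr G code u 108) ∨ code u ∈ [106] ∨ code u ∈ [97, 98, 99] ∨
    (code u ∈ [9] ∧ HasNbr G code u 21) ∨
    (code u ∈ [0, 32, 64, 96] ∧ (¬ ∃ b, code b ∈ [108]) ∧ HasNbr G code u 116)

/-- The third of the three additional colour classes. -/
def ClassC (G : SimpleGraph V) (code : V → ℕ) (u : V) : Prop :=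
  (code u ∈ [5] ∧ HasNbr G code u 11) ∨ code u ∈ [116, 112, 113] ∨
    (code u ∈ [0, 32, 64, 96] ∧ (¬ ∃ b, code b ∈ [108]) ∧ ¬ HasNbr G code u 116)

theorem IsCoding.not_adj_of_classA (hc : IsCoding G φ code) (h1 : IsFreeOf G graphP2P3)
    (h2 : IsFreeOf G graphGem) (hF1 : IsFreeOf G graphF1) {u w : V} (hu : ClassA G code u)
    (hw : ClassA G code w) : ¬ G.Adj u w := by
  have hXX := hc.not_adj_of_excl₂ h1 h2 hF1
    (show excl₂ [50, 82, 114] [50, 82, 114] [true] = true by decide +kernel)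
  have hXP := hc.not_adj_of_excl₂ h1 h2 hF1
    (show excl₂ [50, 82, 114] [100, 104] [true] = true by decide +kernel)
  have hPP := hc.not_adj_of_excl₂ h1 h2 hF1
    (show excl₂ [100, 104] [100, 104] [true] = true by decide +kernel)
  have hQP := hc.not_adj_of_excl₂ h1 h2 hF1
    (show excl₂ [108] [100, 104] [true] = true by decide +kernel)
  have hQQ := hc.not_adj_of_excl₂ h1 h2 hF1
    (show excl₂ [108] [108] [true] = true by decide +kernel)
  have hTP := hc.not_adj_of_excl₂ h1 h2 hF1
    (show excl₂ [0, 32, 64, 96] [100, 104] [true] = true by decide +kernel)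
  have hTQ := hc.not_adj_of_excl₂ h1 h2 hF1
    (show excl₂ [0, 32, 64, 96] [108] [true] = true by decide +kernel)
  have hTT := hc.not_adj_of_excl₂ h1 h2 hF1
    (show excl₂ [0, 32, 64, 96] [0, 32, 64, 96] [true] = true by decide +kernel)
  have hXTQ := hc.false_of_excl₃ h1 h2 hF1
    (show excl₃ [50, 82, 114] [0, 32, 64, 96] [108] false = true by decide +kernel)
  have hXQ : ∀ {u w}, ¬ HasNbr G code u 108 → code w ∈ [108] → ¬ G.Adj u w :=
    fun hN hw huw => hN ⟨_, huw, hw⟩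
  have hXT : ∀ {u w}, code u ∈ [50, 82, 114] → ¬ HasNbr G code u 108 →
      code w ∈ [0, 32, 64, 96] → (∃ b, code b ∈ [108]) → ¬ G.Adj u w :=
    fun hu hN hw ⟨b, hb⟩ huw => hXTQ hu hw hb huw (by simpa using hXQ hN hb)
  intro huw
  rcases hu with ⟨hu, hN⟩ | hu | hu | ⟨hu, hE⟩ <;> rcases hw with ⟨hw, hN'⟩ | hw | hw | ⟨hw, hE'⟩
  · exact hXX hu hw huw
  · exact hXP hu hw huw
  · exact hXQ hN hw huw
  · exact hXT hu hN hw hE' huw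
  · exact hXP hw hu huw.symm
  · exact hPP hu hw huw
  · exact hQP hw hu huw.symm
  · exact hTP hw hu huw.symm
  · exact hXQ hN' hu huw.symm
  · exact hQP hu hw huw
  · exact hQQ hu hw huw
  · exact hTQ hw hu huw.symm
  · exact hXT hw hN' hu hE huw.symm
  · exact hTP hu hw huw
  · exact hTQ hu hw huw
  · exact hTT hu hw huw

theorem IsCoding.not_adj_of_classB (hc : IsCoding G φ code) (h1 : IsFreeOf G graphP2P3)
    (h2 : IsFreeOf G graphGem) (hF1 : IsFreeOf G graphF1) {u w : V} (hu : ClassB G code u)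
    (hw : ClassB G code w) : ¬ G.Adj u w := by
  have hXX := hc.not_adj_of_excl₂ h1 h2 hF1
    (show excl₂ [50, 82, 114] [50, 82, 114] [true] = true by decide +kernel)
  have hXM := hc.not_adj_of_excl₂ h1 h2 hF1
    (show excl₂ [50, 82, 114] [106] [true] = true by decide +kernel)
  have hMM := hc.not_adj_of_excl₂ h1 h2 hF1
    (show excl₂ [106] [106] [true] = true by decide +kernel)
  have hML := hc.not_adj_of_excl₂ h1 h2 hF1
    (show excl₂ [106] [97, 98, 99] [true] = true by decide +kernel)
  have hLL := hc.not_adj_of_excl₂ h1 h2 hF1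
    (show excl₂ [97, 98, 99] [97, 98, 99] [true] = true by decide +kernel)
  have hKK := hc.not_adj_of_excl₂ h1 h2 hF1
    (show excl₂ [9] [9] [true] = true by decide +kernel)
  have hTL := hc.not_adj_of_excl₂ h1 h2 hF1
    (show excl₂ [0, 32, 64, 96] [97, 98, 99] [true] = true by decide +kernel)
  have hTT := hc.not_adj_of_excl₂ h1 h2 hF1
    (show excl₂ [0, 32, 64, 96] [0, 32, 64, 96] [true] = true by decide +kernel)
  have hXQL := hc.false_of_excl₃ h1 h2 hF1
    (show excl₃ [50, 82, 114] [108] [97, 98, 99] true = true by decide +kernel)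
  have hXQ21 := hc.false_of_excl₃ h1 h2 hF1
    (show excl₃ [50, 82, 114] [108] [21] true = true by decide +kernel)
  have hXQ21' := hc.false_of_excl₃ h1 h2 hF1
    (show excl₃ [50, 82, 114] [108] [21] false = true by decide +kernel)
  have hK21 := hc.false_of_excl₃ h1 h2 hF1
    (show excl₃ [9] [21] [97, 98, 99, 106, 0, 32, 64, 96] true = true by decide +kernel)
  have hT116 := hc.false_of_excl₃ h1 h2 hF1
    (show excl₃ [0, 32, 64, 96] [116] [106] true = true by decide +kernel)
  have hXL : ∀ {u w}, HasNbr G code u 108 → code u ∈ [50, 82, 114] → code w ∈ [97, 98, 99] →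
      ¬ G.Adj u w :=
    fun ⟨_, hv, hv'⟩ hu hw huw => hXQL hu hv' hw hv (by simpa using huw)
  have hXK : ∀ {u w}, HasNbr G code u 108 → code u ∈ [50, 82, 114] → HasNbr G code w 21 → False :=
    fun {u _} ⟨_, hv, hv'⟩ hu ⟨b, _, hb⟩ => (em (G.Adj u b)).elim
      (fun h => hXQ21 hu hv' hb hv (by simpa using h))
      fun h => hXQ21' hu hv' hb hv (by simpa using h)
  have hK : ∀ {u w}, HasNbr G code u 21 → code u ∈ [9] →
      code w ∈ [97, 98, 99, 106, 0, 32, 64, 96] → ¬ G.Adj u w :=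
    fun ⟨_, hv, hv'⟩ hu hw huw => hK21 hu hv' hw hv (by simpa using huw)
  have hTM : ∀ {u w}, HasNbr G code u 116 → code u ∈ [0, 32, 64, 96] → code w ∈ [106] →
      ¬ G.Adj u w :=
    fun ⟨_, hv, hv'⟩ hu hw huw => hT116 hu hv' hw hv (by simpa using huw)
  have hQ : ∀ {u}, HasNbr G code u 108 → ∃ b, code b ∈ [108] := fun ⟨v, _, hv⟩ => ⟨v, hv⟩
  have hL' : [97, 98, 99] ⊆ [97, 98, 99, 106, 0, 32, 64, 96] := by decide
  have hM' : [106] ⊆ [97, 98, 99, 106, 0, 32, 64, 96] := by decide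
  have hT' : [0, 32, 64, 96] ⊆ [97, 98, 99, 106, 0, 32, 64, 96] := by decide
  intro huw
  rcases hu with ⟨hu, hN⟩ | hu | hu | ⟨hu, hN⟩ | ⟨hu, hE, hN⟩ <;>
    rcases hw with ⟨hw, hN'⟩ | hw | hw | ⟨hw, hN'⟩ | ⟨hw, hE', hN'⟩
  · exact hXX hu hw huw
  · exact hXM hu hw huw
  · exact hXL hN hu hw huw
  · exact hXK hN hu hN'
  · exact hE' (hQ hN)
  · exact hXM hw hu huw.symm
  · exact hMM hu hw huw
  · exact hML hu hw huw
  · exact hK hN' hw (hM' hu) huw.symm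
  · exact hTM hN' hw hu huw.symm
  · exact hXL hN' hw hu huw.symm
  · exact hML hw hu huw.symm
  · exact hLL hu hw huw
  · exact hK hN' hw (hL' hu) huw.symm
  · exact hTL hw hu huw.symm
  · exact hXK hN' hw hN
  · exact hK hN hu (hM' hw) huw
  · exact hK hN hu (hL' hw) huw
  · exact hKK hu hw huw
  · exact hK hN hu (hT' hw) huw
  · exact hE (hQ hN')
  · exact hTM hN hu hw huw
  · exact hTL hu hw huw
  · exact hK hN' hw (hT' hu) huw.symm
  · exact hTT hu hw huw

theorem IsCoding.not_adj_of_classC (hc : IsCoding G φ code) (h1 : IsFreeOf G graphP2P3)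
    (h2 : IsFreeOf G graphGem) (hF1 : IsFreeOf G graphF1) {u w : V} (hu : ClassC G code u)
    (hw : ClassC G code w) : ¬ G.Adj u w := by
  have hRR := hc.not_adj_of_excl₂ h1 h2 hF1
    (show excl₂ [116, 112, 113] [116, 112, 113] [true] = true by decide +kernel)
  have hTR := hc.not_adj_of_excl₂ h1 h2 hF1
    (show excl₂ [0, 32, 64, 96] [112, 113] [true] = true by decide +kernel)
  have hKK := hc.not_adj_of_excl₂ h1 h2 hF1
    (show excl₂ [5] [5] [true] = true by decide +kernel)
  have hTT := hc.not_adj_of_excl₂ h1 h2 hF1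
    (show excl₂ [0, 32, 64, 96] [0, 32, 64, 96] [true] = true by decide +kernel)
  have hK11 := hc.false_of_excl₃ h1 h2 hF1
    (show excl₃ [5] [11] [116, 112, 113, 0, 32, 64, 96] true = true by decide +kernel)
  have hK : ∀ {u w}, HasNbr G code u 11 → code u ∈ [5] →
      code w ∈ [116, 112, 113, 0, 32, 64, 96] → ¬ G.Adj u w :=
    fun ⟨_, hv, hv'⟩ hu hw huw => hK11 hu hv' hw hv (by simpa using huw)
  have hT : ∀ {u w}, ¬ HasNbr G code u 116 → code u ∈ [0, 32, 64, 96] →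
      code w ∈ [116, 112, 113] → ¬ G.Adj u w := fun {u w} hN hu hw huw =>
    (show code w ∈ [116] ∨ code w ∈ [112, 113] by simpa using hw).elim
      (fun h => hN ⟨w, huw, h⟩) fun h => hTR hu h huw
  have hR' : [116, 112, 113] ⊆ [116, 112, 113, 0, 32, 64, 96] := by decide
  have hT' : [0, 32, 64, 96] ⊆ [116, 112, 113, 0, 32, 64, 96] := by decide
  intro huw
  rcases hu with ⟨hu, hN⟩ | hu | ⟨hu, -, hN⟩ <;> rcases hw with ⟨hw, hN'⟩ | hw | ⟨hw, -, hN'⟩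
  · exact hKK hu hw huw
  · exact hK hN hu (hR' hw) huw
  · exact hK hN hu (hT' hw) huw
  · exact hK hN' hw (hR' hu) huw.symm
  · exact hRR hu hw huw
  · exact hT hN' hw hu huw.symm
  · exact hK hN' hw (hT' hu) huw.symm
  · exact hT hN hu hw huw
  · exact hTT hu hw huw

theorem IsCoding.colorable [Fintype V] (hc : IsCoding G φ code)
    (h1 : IsFreeOf G graphP2P3) (h2 : IsFreeOf G graphGem) (hF1 : IsFreeOf G graphF1)
    (hA : ∀ a z z', code a ∈ [1] → code z ∈ [13, 45, 77, 109] → code z' ∈ [13, 45, 77, 109] →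
      G.Adj a z → G.Adj a z' → G.Adj z z' → False) :
    G.Colorable (G.cliqueNum + 1) := by
  obtain ⟨c, hlt, hcol⟩ := hc.exists_clique_coloring h1 h2 hF1 hA
  have h4 := hc.four_le_cliqueNum
  have hZ5 := hc.not_adj_of_excl₂ h1 h2 hF1
    (show excl₂ [5] [13, 45, 77, 109, 21, 1, 12] [true] = true by decide +kernel)
  have hZ9 := hc.not_adj_of_excl₂ h1 h2 hF1
    (show excl₂ [9] [13, 45, 77, 109, 11, 1, 12] [true] = true by decide +kernel)
  have hZ48 := hc.not_adj_of_excl₂ h1 h2 hF1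
    (show excl₂ cliqueCodes [4, 8] [true] = true by decide +kernel)
  have h55 := hc.not_adj_of_excl₂ h1 h2 hF1
    (show excl₂ [5] [5] [true] = true by decide +kernel)
  have h489 := hc.not_adj_of_excl₂ h1 h2 hF1
    (show excl₂ [4, 8, 9] [4, 8, 9] [true] = true by decide +kernel)
  suffices G.Colorable (G.cliqueNum - 2 + 3) by
    rwa [show G.cliqueNum - 2 + 3 = G.cliqueNum + 1 by omega] at this
  refine colorable_of_cover (by omega) (c := c) (Z := fun u => code u ∈ cliqueCodes)
    (S := fun u => code u ∈ [5] ∧ ¬ HasNbr G code u 11)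
    (T := fun u => code u ∈ [4, 8] ∨ code u ∈ [9] ∧ ¬ HasNbr G code u 21)
    (A := ClassA G code) (B := ClassB G code) (C := ClassC G code)
    ?_ (fun u _ => by have := hlt u; omega) hcol ?_ ?_ (fun u w hu hw => h55 hu.1 hw.1) ?_
    (fun u w hu hw => hc.not_adj_of_classA h1 h2 hF1 hu hw)
    (fun u w hu hw => hc.not_adj_of_classB h1 h2 hF1 hu hw)
    (fun u w hu hw => hc.not_adj_of_classC h1 h2 hF1 hu hw)
  · intro u
    have := hc.code_mem h1 h2 hF1 u
    simp only [ClassA, ClassB, ClassC, cliqueCodes, List.mem_cons, List.not_mem_nil,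
      or_false] at this ⊢
    grind
  · rintro u w hu ⟨hw, hN⟩ huw
    refine hZ5 hw ?_ huw.symm
    have : code u ∉ [11] := fun h => hN ⟨u, huw.symm, h⟩
    simp only [cliqueCodes, List.mem_cons, List.not_mem_nil, or_false] at hu this ⊢
    omega
  · rintro u w hu (hw | ⟨hw, hN⟩) huw
    · exact hZ48 hu hw huw
    · refine hZ9 hw ?_ huw.symm
      have : code u ∉ [21] := fun h => hN ⟨u, huw.symm, h⟩
      simp only [cliqueCodes, List.mem_cons, List.not_mem_nil, or_false] at hu this ⊢
      omega
  · intro u w hu hw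
    have h : ∀ {u}, (code u ∈ [4, 8] ∨ code u ∈ [9] ∧ ¬ HasNbr G code u 21) →
        code u ∈ [4, 8, 9] := by
      rintro u (h | ⟨h, -⟩)
      · exact (by decide : [4, 8] ⊆ [4, 8, 9]) h
      · exact (by decide : [9] ⊆ [4, 8, 9]) h
    exact h489 (h hu) (h hw)

end Classes

section Replacement

variable {V : Type*} {G : SimpleGraph V} {φ : ℕ → V} {code : V → ℕ}

theorem IsCoding.exists_code_eq (hc : IsCoding G φ code) {a z z' : V} (ha : code a ∈ [1])
    (hz : code z ∈ [13, 45, 77, 109]) (hz' : code z' ∈ [13, 45, 77, 109]) (haz : G.Adj a z)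
    (haz' : G.Adj a z') (hzz' : G.Adj z z') :
    ∃ φ' code', IsCoding G φ' code' ∧ code' a ∈ [97] := by
  let ψ : ℕ → V := fun i => if i = 5 then z else if i = 6 then z' else φ i
  have hψ : ∀ i < 5, ψ i = φ i := fun i hi => by
    simp only [ψ]
    rw [if_neg (by omega), if_neg (by omega)]
  have hrow : ∀ m ∈ [13, 45, 77, 109], ∀ i < 5,
      bit (rowF2 5) i = bit m i ∧ bit (rowF2 6) i = bit m i ∧
      bit (rowF2 i) 5 = bit m i ∧ bit (rowF2 i) 6 = bit m i := by
    decide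
  have hadj : ∀ x, code x ∈ [13, 45, 77, 109] → ∀ i < 5,
      (bit (rowF2 5) i = true ↔ G.Adj x (φ i)) ∧ (bit (rowF2 6) i = true ↔ G.Adj x (φ i)) ∧
      (bit (rowF2 i) 5 = true ↔ G.Adj (φ i) x) ∧ (bit (rowF2 i) 6 = true ↔ G.Adj (φ i) x) := by
    intro x hx i hi
    obtain ⟨e₁, e₂, e₃, e₄⟩ := hrow _ hx i hi
    rw [e₁, e₂, e₃, e₄, G.adj_comm (φ i), hc.bits x i (by omega)]
    simp
  have h5 : ψ 5 = z := rfl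
  have h6 : ψ 6 = z' := rfl
  have hsplit : ∀ i < 7, i < 5 ∨ i = 5 ∨ i = 6 := fun i hi => by omega
  obtain ⟨code', hc'⟩ := exists_isCoding (G := G) (φ := ψ) (by
    intro i hi j hj
    rcases hsplit i hi with hi' | rfl | rfl <;> rcases hsplit j hj with hj' | rfl | rfl
    · rw [hψ i hi', hψ j hj', hc.base i hi j hj]
    · rw [hψ i hi', h5, (hadj z hz i hi').2.2.1]
    · rw [hψ i hi', h6, (hadj z' hz' i hi').2.2.2]
    · rw [hψ j hj', h5, (hadj z hz j hj').1]
    · exact iff_of_false (by decide) G.irrefl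
    · exact iff_of_true (by decide) hzz'
    · rw [hψ j hj', h6, (hadj z' hz' j hj').2.1]
    · exact iff_of_true (by decide) hzz'.symm
    · exact iff_of_false (by decide) G.irrefl)
  refine ⟨ψ, code', hc', ?_⟩
  have hbits : ∀ m < 128, ((∀ i < 5, bit m i = bit 1 i) ∧ bit m 5 = true ∧ bit m 6 = true) →
      m ∈ [97] := by
    decide +kernel
  refine hbits _ (hc'.lt a) ⟨fun i hi => ?_, (hc'.bits a 5 (by norm_num)).2 haz,
    (hc'.bits a 6 (by norm_num)).2 haz'⟩
  rw [Bool.eq_iff_iff, hc'.bits a i (by omega), hψ i hi, ← List.mem_singleton.1 ha,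
    hc.bits a i (by omega)]

end Replacement

theorem exists_base {V : Type*} {G : SimpleGraph V} (f : graphF2 ↪g G) (i : ℕ) (hi : i < 7) (j : ℕ)
    (hj : j < 7) : bit (rowF2 i) j = true ↔ G.Adj (f (Fin.ofNat 7 i)) (f (Fin.ofNat 7 j)) := by
  have h : ∀ i j : Fin 7, bit (rowF2 i) j = true ↔ graphF2.Adj i j := by
    unfold graphF2
    simp only [SimpleGraph.fromRel_adj]
    decide +kernel
  rw [f.map_adj_iff, ← h]
  simp [Nat.mod_eq_of_lt hi, Nat.mod_eq_of_lt hj]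

theorem chi_le_of_F2 {V : Type*} [Fintype V] (G : SimpleGraph V)
    (h1 : IsFreeOf G graphP2P3) (h2 : IsFreeOf G graphGem)
    (hF1 : IsFreeOf G graphF1)
    (hF : Nonempty (graphF2 ↪g G)) :
    G.chromaticNumber ≤ (G.cliqueNum : ℕ∞) + 1 := by
  suffices G.Colorable (G.cliqueNum + 1) from mod_cast this.chromaticNumber_le
  obtain ⟨f⟩ := hF
  obtain ⟨code, hc⟩ := exists_isCoding (φ := fun i => f (Fin.ofNat 7 i)) (exists_base f)
  by_cases h : ∃ φ code, IsCoding G φ code ∧ ∃ b, code b ∈ [97]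
  · obtain ⟨φ, code, hc, b, hb⟩ := h
    refine hc.colorable h1 h2 hF1 fun a _ _ ha _ _ _ _ _ => hc.false_of_excl₂ h1 h2 hF1
      (show excl₂ [1] [97] [true, false] = true by decide +kernel) ha hb
  · refine hc.colorable h1 h2 hF1 fun a z z' ha hz hz' haz haz' hzz' => h ?_
    obtain ⟨φ', code', hc', ha'⟩ := hc.exists_code_eq ha hz hz' haz haz' hzz'
    exact ⟨φ', code', hc', a, ha'⟩
end
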